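/- Let n ≥ 2 and p ≥ 2. There exists ε > 0, depending only on n and p, with the following property: if Ω ⊆ ℝⁿ is open, u : Ω → ℝ^p is an energy minimizing map into the unit sphere S^{p−1} with weak gradient g, B̄_ρ(y) ⊂ Ω, and ρ^{2−n} ∫_{B_ρ(y)} |Du|² < ε, then y ∈ reg(u), i.e., u agrees almost everywhere with a C^∞ map on some neighborhood of y. -/

import Mathlib

open MeasureTheory Metric Filter Set

noncomputable section

/-- The pointwise energy density `|Du|²(x) = ∑_{i,j} ((g(x)eᵢ)_j)²` associated to a
(weak) gradient `g`. -/
def energyDensity (n p : ℕ)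
    (g : EuclideanSpace ℝ (Fin n) →
      (EuclideanSpace ℝ (Fin n) →L[ℝ] EuclideanSpace ℝ (Fin p)))
    (x : EuclideanSpace ℝ (Fin n)) : ℝ :=
  ∑ i : Fin n, ∑ j : Fin p, (g x (EuclideanSpace.single i 1) j) ^ 2

/-- `u` has weak gradient `g` on `Ω`: both are locally integrable on `Ω` and the
integration-by-parts identity holds against every smooth compactly supported test
function with support in `Ω`. -/
def HasWeakGradient (n p : ℕ) (Ω : Set (EuclideanSpace ℝ (Fin n)))
    (u : EuclideanSpace ℝ (Fin n) → EuclideanSpace ℝ (Fin p))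
    (g : EuclideanSpace ℝ (Fin n) →
      (EuclideanSpace ℝ (Fin n) →L[ℝ] EuclideanSpace ℝ (Fin p))) : Prop :=
  LocallyIntegrableOn u Ω volume ∧ LocallyIntegrableOn g Ω volume ∧
  ∀ φ : EuclideanSpace ℝ (Fin n) → ℝ, ContDiff ℝ (⊤ : ℕ∞) φ → HasCompactSupport φ →
    tsupport φ ⊆ Ω → ∀ i : Fin n, ∀ j : Fin p,
      ∫ x in Ω, u x j * fderiv ℝ φ x (EuclideanSpace.single i 1) =
        - ∫ x in Ω, φ x * g x (EuclideanSpace.single i 1) j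

/-- `u : Ω → ℝᵖ` is an energy minimizing map into the unit sphere `S^(p-1)` with weak
gradient `g`: `u` has weak gradient `g` with locally integrable energy density,
`‖u‖ = 1` a.e. on `Ω`, and `u` minimizes energy in every ball `B_ρ(y)` with closure in
`Ω` among sphere-valued competitors `w` agreeing with `u` a.e. outside a smaller
concentric ball. -/
def IsEnergyMinimizingToSphere (n p : ℕ) (Ω : Set (EuclideanSpace ℝ (Fin n)))
    (u : EuclideanSpace ℝ (Fin n) → EuclideanSpace ℝ (Fin p))
    (g : EuclideanSpace ℝ (Fin n) →
      (EuclideanSpace ℝ (Fin n) →L[ℝ] EuclideanSpace ℝ (Fin p))) : Prop :=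
  HasWeakGradient n p Ω u g ∧
  LocallyIntegrableOn (energyDensity n p g) Ω volume ∧
  (∀ᵐ x ∂volume.restrict Ω, ‖u x‖ = 1) ∧
  ∀ (y : EuclideanSpace ℝ (Fin n)) (ρ : ℝ), 0 < ρ → closedBall y ρ ⊆ Ω →
    ∀ (w : EuclideanSpace ℝ (Fin n) → EuclideanSpace ℝ (Fin p))
      (h : EuclideanSpace ℝ (Fin n) →
        (EuclideanSpace ℝ (Fin n) →L[ℝ] EuclideanSpace ℝ (Fin p))),
      HasWeakGradient n p Ω w h →
      LocallyIntegrableOn (energyDensity n p h) Ω volume →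
      (∀ᵐ x ∂volume.restrict Ω, ‖w x‖ = 1) →
      (∃ σ : ℝ, σ < ρ ∧ ∀ᵐ x ∂volume.restrict (Ω \ ball y σ), w x = u x) →
      ∫ x in ball y ρ, energyDensity n p g x ≤ ∫ x in ball y ρ, energyDensity n p h x

/-- The regular set of `u`: points of `Ω` having an open neighborhood (inside `Ω`) on
which `u` agrees almost everywhere with a `C^∞` map. -/
def regSet (n p : ℕ) (Ω : Set (EuclideanSpace ℝ (Fin n)))
    (u : EuclideanSpace ℝ (Fin n) → EuclideanSpace ℝ (Fin p)) :
    Set (EuclideanSpace ℝ (Fin n)) :=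
  {x | x ∈ Ω ∧ ∃ V : Set (EuclideanSpace ℝ (Fin n)), IsOpen V ∧ x ∈ V ∧ V ⊆ Ω ∧
    ∃ v : EuclideanSpace ℝ (Fin n) → EuclideanSpace ℝ (Fin p),
      ContDiffOn ℝ (⊤ : ℕ∞) v V ∧ ∀ᵐ z ∂volume.restrict V, u z = v z}

section
open scoped ContDiff Topology Convolution


abbrev Eu (n : ℕ) := EuclideanSpace ℝ (Fin n)

/-- partial derivative -/
def pd {n : ℕ} (i : Fin n) (f : Eu n → ℝ) (x : Eu n) : ℝ :=
  fderiv ℝ f x (EuclideanSpace.single i 1)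

/-- Laplacian -/
def lap {n : ℕ} (f : Eu n → ℝ) (x : Eu n) : ℝ := ∑ i, pd i (pd i f) x

structure Test {n : ℕ} (O : Set (Eu n)) (ψ : Eu n → ℝ) : Prop where
  smooth : ContDiff ℝ ∞ ψ
  cpt : HasCompactSupport ψ
  sub : tsupport ψ ⊆ O

/-- mollification with kernel `κ` at scale `t` (not normalized) -/
def cv {n : ℕ} (κ U : Eu n → ℝ) (t : ℝ) (x : Eu n) : ℝ := ∫ z, κ (t⁻¹ • (x - z)) * U z

variable {n : ℕ}

theorem contDiff_pd {f : Eu n → ℝ} (hf : ContDiff ℝ ∞ f) (i : Fin n) : ContDiff ℝ ∞ (pd i f) := by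
  unfold pd
  exact (hf.fderiv_right (m := ∞) (by simp)).clm_apply contDiff_const

theorem contDiff_lap {f : Eu n → ℝ} (hf : ContDiff ℝ ∞ f) : ContDiff ℝ ∞ (lap f) := by
  unfold lap
  exact ContDiff.sum fun i _ => contDiff_pd (contDiff_pd hf i) i

theorem tsupport_pd_subset (f : Eu n → ℝ) (i : Fin n) : tsupport (pd i f) ⊆ tsupport f :=
  tsupport_fderiv_apply_subset ℝ _

theorem pd_add {f g : Eu n → ℝ} {x : Eu n} (i : Fin n) (hf : DifferentiableAt ℝ f x)
    (hg : DifferentiableAt ℝ g x) : pd i (fun y => f y + g y) x = pd i f x + pd i g x := by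
  unfold pd
  rw [fderiv_fun_add hf hg]; rfl

theorem pd_sub {f g : Eu n → ℝ} {x : Eu n} (i : Fin n) (hf : DifferentiableAt ℝ f x)
    (hg : DifferentiableAt ℝ g x) : pd i (fun y => f y - g y) x = pd i f x - pd i g x := by
  unfold pd
  rw [fderiv_fun_sub hf hg]; rfl

theorem pd_mul {f g : Eu n → ℝ} {x : Eu n} (i : Fin n) (hf : DifferentiableAt ℝ f x)
    (hg : DifferentiableAt ℝ g x) :
    pd i (fun y => f y * g y) x = pd i f x * g x + f x * pd i g x := by
  unfold pd
  rw [fderiv_fun_mul hf hg]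
  simp only [add_apply, smul_apply, smul_eq_mul]
  ring

theorem pd_const_mul {f : Eu n → ℝ} {x : Eu n} (i : Fin n) (c : ℝ) (hf : DifferentiableAt ℝ f x) :
    pd i (fun y => c * f y) x = c * pd i f x := by
  unfold pd
  rw [fderiv_const_mul hf]; rfl

theorem pd_sum {ι : Type*} (s : Finset ι) {f : ι → Eu n → ℝ} {x : Eu n} (i : Fin n)
    (hf : ∀ j ∈ s, DifferentiableAt ℝ (f j) x) :
    pd i (fun y => ∑ j ∈ s, f j y) x = ∑ j ∈ s, pd i (f j) x := by
  unfold pd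
  rw [fderiv_fun_sum hf]; simp

theorem pd_congr {f g : Eu n → ℝ} {x : Eu n} (i : Fin n) (h : f =ᶠ[𝓝 x] g) :
    pd i f x = pd i g x := by
  unfold pd; rw [h.fderiv_eq]

theorem pd_comm {f : Eu n → ℝ} (hf : ContDiff ℝ ∞ f) (i j : Fin n) :
    pd i (pd j f) = pd j (pd i f) := by
  funext x
  have h2 : ContDiffAt ℝ 2 f x := (contDiff_infty.1 hf 2).contDiffAt
  have hs : IsSymmSndFDerivAt ℝ f x := h2.isSymmSndFDerivAt (by simp)
  have hd : DifferentiableAt ℝ (fderiv ℝ f) x :=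
    (hf.fderiv_right (m := ∞) (by simp)).differentiable (by simp) x
  unfold pd
  rw [fderiv_clm_apply hd (by fun_prop), fderiv_clm_apply hd (by fun_prop)]
  simp only [fderiv_fun_const]
  simpa using hs _ _

theorem fderiv_eq_sum_pd (f : Eu n → ℝ) (x v : Eu n) : fderiv ℝ f x v = ∑ i, v i * pd i f x := by
  have hv : v = ∑ i, v i • EuclideanSpace.single i (1 : ℝ) := by
    have := (EuclideanSpace.basisFun (Fin n) ℝ).sum_repr v
    simpa using this.symm
  conv_lhs => rw [hv]
  simp [map_sum, pd]

theorem norm_fderiv_le_sum_pd (f : Eu n → ℝ) (x : Eu n) : ‖fderiv ℝ f x‖ ≤ ∑ i, |pd i f x| := by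
  refine ContinuousLinearMap.opNorm_le_bound _ (Finset.sum_nonneg fun _ _ => abs_nonneg _) fun v => ?_
  rw [fderiv_eq_sum_pd, Finset.sum_mul]
  refine (norm_sum_le _ _).trans (Finset.sum_le_sum fun i _ => ?_)
  rw [norm_mul, mul_comm]
  refine mul_le_mul_of_nonneg_left ?_ (abs_nonneg _)
  exact PiLp.norm_apply_le v i

namespace Test

variable {O O' : Set (Eu n)} {ψ χ : Eu n → ℝ}

theorem mono (h : Test O ψ) (hO : O ⊆ O') : Test O' ψ := ⟨h.1, h.2, h.3.trans hO⟩

protected theorem pd (h : Test O ψ) (i : Fin n) : Test O (pd i ψ) :=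
  ⟨contDiff_pd h.1 i, h.2.mono' (subset_closure.trans (tsupport_pd_subset ψ i)),
    (tsupport_pd_subset ψ i).trans h.3⟩

theorem add (h : Test O ψ) (h' : Test O χ) : Test O (fun x => ψ x + χ x) :=
  ⟨h.1.add h'.1, h.2.add h'.2, (tsupport_add ψ χ).trans (union_subset h.3 h'.3)⟩

theorem mul (h : Test O ψ) (h' : ContDiff ℝ ∞ χ) : Test O (fun x => ψ x * χ x) :=
  ⟨h.1.mul h', h.2.mul_right, (tsupport_mul_subset_left).trans h.3⟩

theorem const_mul (h : Test O ψ) (c : ℝ) : Test O (fun x => c * ψ x) :=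
  ⟨contDiff_const.mul h.1, h.2.mul_left, (tsupport_mul_subset_right).trans h.3⟩

theorem zero : Test O (fun _ => (0:ℝ)) :=
  ⟨contDiff_const, HasCompactSupport.zero, by simp [tsupport, Function.support]⟩

theorem sum {ι : Type*} (s : Finset ι) {f : ι → Eu n → ℝ} (h : ∀ i ∈ s, Test O (f i)) :
    Test O (fun x => ∑ i ∈ s, f i x) := by
  classical
  induction s using Finset.induction_on with
  | empty => simpa using zero
  | insert a s ha ih =>
    simp only [Finset.sum_insert ha]
    exact (h a (by simp)).add (ih fun i hi => h i (by simp [hi]))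

protected theorem lap (h : Test O ψ) : Test O (lap ψ) := by
  unfold _root_.lap
  exact Test.sum _ fun i _ => (h.pd i).pd i

theorem continuous (h : Test O ψ) : Continuous ψ := h.1.continuous

theorem eq_zero (h : Test O ψ) {x : Eu n} (hx : x ∉ O) : ψ x = 0 :=
  image_eq_zero_of_notMem_tsupport fun h' => hx (h.3 h')

theorem bdd (h : Test O ψ) : ∃ M : ℝ, 0 < M ∧ ∀ x, |ψ x| ≤ M := by
  obtain ⟨M, hM⟩ := h.2.exists_bound_of_continuous h.continuous
  exact ⟨max M 1, by positivity, fun x => (hM x).trans (le_max_left _ _)⟩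

theorem integrable_mul (h : Test O ψ) {f : Eu n → ℝ} (hf : LocallyIntegrable f) :
    Integrable (fun x => ψ x * f x) := by
  have := hf.integrable_smul_left_of_hasCompactSupport h.continuous h.2
  simpa [smul_eq_mul] using this

/-- kernels -/
theorem scl (h : Test (ball 0 1) ψ) {t : ℝ} (ht : 0 < t) (x : Eu n) :
    Test (ball x t) (fun z => ψ (t⁻¹ • (x - z))) := by
  have hc : IsClosed ((fun z : Eu n => t⁻¹ • (x - z)) ⁻¹' tsupport ψ) :=
    (isClosed_tsupport ψ).preimage (by fun_prop)
  have hs : tsupport (fun z => ψ (t⁻¹ • (x - z))) ⊆ (fun z : Eu n => t⁻¹ • (x - z)) ⁻¹' tsupport ψ := by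
    refine closure_minimal ?_ hc
    intro z hz
    exact subset_tsupport _ hz
  have hb : tsupport (fun z => ψ (t⁻¹ • (x - z))) ⊆ ball x t := by
    intro z hz
    have h1 := h.3 (hs hz)
    rw [mem_ball_zero_iff, norm_smul, norm_inv, Real.norm_of_nonneg ht.le] at h1
    rw [mem_ball, dist_comm, dist_eq_norm]
    rwa [inv_mul_lt_iff₀ ht, mul_one] at h1
  refine ⟨h.1.comp (by fun_prop), ?_, hb⟩
  exact HasCompactSupport.of_support_subset_isCompact (isCompact_closedBall x t)
    ((subset_tsupport _).trans (hb.trans ball_subset_closedBall))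

end Test

theorem pd_scl {κ : Eu n → ℝ} (hκ : ContDiff ℝ ∞ κ) (t : ℝ) (x : Eu n) (i : Fin n) :
    pd i (fun z => κ (t⁻¹ • (x - z))) = fun z => (-t⁻¹) * pd i κ (t⁻¹ • (x - z)) := by
  funext z
  have hd : HasFDerivAt (fun z : Eu n => t⁻¹ • (x - z)) (t⁻¹ • (-ContinuousLinearMap.id ℝ (Eu n))) z := by
    have h1 : HasFDerivAt (fun z : Eu n => x - z) (-ContinuousLinearMap.id ℝ (Eu n)) z :=
      (hasFDerivAt_id z).const_sub x
    exact h1.const_smul t⁻¹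
  have hk : HasFDerivAt κ (fderiv ℝ κ (t⁻¹ • (x - z))) (t⁻¹ • (x - z)) :=
    (hκ.differentiable (by simp) _).hasFDerivAt
  unfold pd
  have := (hk.comp z hd).fderiv
  simp only [Function.comp_def] at this
  rw [this]
  simp

theorem lap_scl {κ : Eu n → ℝ} (hκ : ContDiff ℝ ∞ κ) (t : ℝ) (x : Eu n) :
    lap (fun z => κ (t⁻¹ • (x - z))) = fun z => (t⁻¹)^2 * lap κ (t⁻¹ • (x - z)) := by
  funext z
  unfold lap
  rw [Finset.mul_sum]
  refine Finset.sum_congr rfl fun i _ => ?_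
  rw [pd_scl hκ]
  rw [pd_const_mul, pd_scl (contDiff_pd hκ i)]
  · ring
  · exact ((contDiff_pd hκ i).comp (by fun_prop)).differentiable (by simp) _

theorem lap_pd {κ : Eu n → ℝ} (hκ : ContDiff ℝ ∞ κ) (j : Fin n) :
    lap (pd j κ) = pd j (lap κ) := by
  funext x
  have hl : lap κ = fun y => ∑ i, pd i (pd i κ) y := rfl
  rw [hl, pd_sum]
  · unfold lap
    refine Finset.sum_congr rfl fun i _ => ?_
    rw [pd_comm hκ i j, pd_comm (contDiff_pd hκ i) i j]
  · intro i _
    exact (contDiff_pd (contDiff_pd hκ i) i).differentiable (by simp) _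

theorem cv_eq_conv (κ U : Eu n → ℝ) (t : ℝ) :
    cv κ U t = ((fun w => κ (t⁻¹ • w)) ⋆[ContinuousLinearMap.mul ℝ ℝ, volume] U) := by
  funext x
  rw [convolution_eq_swap]
  rfl

theorem test_dil {κ : Eu n → ℝ} (hκ : Test (ball 0 1) κ) {t : ℝ} (ht : 0 < t) :
    Test (ball 0 t) (fun w => κ (t⁻¹ • w)) := by
  have h := hκ.scl ht 0
  have h2 : HasCompactSupport (fun w => κ (t⁻¹ • w)) := by
    have := h.2.comp_homeomorph (Homeomorph.neg (Eu n))
    convert this using 2 with w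
    simp
  refine ⟨hκ.1.comp (by fun_prop), h2, ?_⟩
  intro w hw
  have h3 : tsupport (fun w => κ (t⁻¹ • w)) = (Homeomorph.neg (Eu n)) ⁻¹'
      tsupport (fun z => κ (t⁻¹ • (0 - z))) := by
    rw [← tsupport_comp_eq_preimage]
    congr 1
    funext w
    simp
  rw [h3] at hw
  have := h.3 hw
  simpa using this

theorem contDiff_cv {κ U : Eu n → ℝ} (hκ : Test (ball 0 1) κ) (hU : LocallyIntegrable U) {t : ℝ}
    (ht : 0 < t) : ContDiff ℝ ∞ (cv κ U t) := by
  rw [cv_eq_conv]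
  exact (test_dil hκ ht).2.contDiff_convolution_left (n := ⊤) _ (test_dil hκ ht).1 hU

theorem pd_cv {κ U : Eu n → ℝ} (hκ : Test (ball 0 1) κ) (hU : LocallyIntegrable U) {t : ℝ}
    (ht : 0 < t) (i : Fin n) : pd i (cv κ U t) = fun x => t⁻¹ * cv (pd i κ) U t x := by
  funext x
  have hT := test_dil hκ ht
  have h1 := hT.2.hasFDerivAt_convolution_left (ContinuousLinearMap.mul ℝ ℝ)
    (hT.1.of_le (by exact_mod_cast le_top)) hU x
  rw [← cv_eq_conv] at h1
  unfold pd
  rw [h1.fderiv]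
  have hex : ConvolutionExistsAt (fderiv ℝ fun w => κ (t⁻¹ • w)) U x
      ((ContinuousLinearMap.mul ℝ ℝ).precompL (Eu n)) volume :=
    HasCompactSupport.convolutionExists_left _ (hT.2.fderiv ℝ)
      (hT.1.continuous_fderiv (by simp)) hU x
  rw [convolution_eq_swap]
  have hint : Integrable (fun z => (((ContinuousLinearMap.mul ℝ ℝ).precompL (Eu n))
      ((fderiv ℝ fun w => κ (t⁻¹ • w)) (x - z))) (U z)) := hex.integrable_swap
  rw [← ContinuousLinearMap.apply_apply (EuclideanSpace.single i (1:ℝ)) (∫ _, _),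
    ← ContinuousLinearMap.integral_comp_comm _ hint]
  unfold cv
  rw [← integral_const_mul]
  congr 1
  funext z
  have hd : HasFDerivAt (fun z : Eu n => t⁻¹ • z) (t⁻¹ • (ContinuousLinearMap.id ℝ (Eu n))) (x - z) :=
    (hasFDerivAt_id _).const_smul t⁻¹
  have hk : HasFDerivAt κ (fderiv ℝ κ (t⁻¹ • (x - z))) (t⁻¹ • (x - z)) :=
    (hκ.1.differentiable (by simp) _).hasFDerivAt
  have := (hk.comp (x - z) hd).fderiv
  simp only [Function.comp_def] at this
  simp [this]

/-- basic bound -/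
theorem cv_bound {κ : Eu n → ℝ} (hκ : Test (ball 0 1) κ) {M : ℝ} (hM : ∀ x, |κ x| ≤ M) {U : Eu n → ℝ}
    {t : ℝ} (ht : 0 < t) (x : Eu n) (hU : IntegrableOn U (ball x t)) :
    |cv κ U t x| ≤ M * ∫ z in ball x t, |U z| := by
  unfold cv
  rw [← setIntegral_eq_integral_of_forall_compl_eq_zero (s := ball x t)
    (fun z hz => by rw [(hκ.scl ht x).eq_zero hz, zero_mul])]
  rw [← integral_const_mul, ← Real.norm_eq_abs]
  refine norm_integral_le_of_norm_le (hU.abs.const_mul M) (ae_of_all _ fun z => ?_)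
  rw [norm_mul]
  exact mul_le_mul_of_nonneg_right (hM _) (abs_nonneg _)

theorem cv_congr {κ : Eu n → ℝ} (hκ : Test (ball 0 1) κ) {U V : Eu n → ℝ}
    {t : ℝ} (ht : 0 < t) (x : Eu n) (h : ∀ᵐ z, z ∈ ball x t → U z = V z) :
    cv κ U t x = cv κ V t x := by
  unfold cv
  refine integral_congr_ae ?_
  filter_upwards [h] with z hz
  by_cases hzb : z ∈ ball x t
  · rw [hz hzb]
  · rw [(hκ.scl ht x).eq_zero hzb, zero_mul, zero_mul]
end

section
open scoped ContDiff Topology Convolution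

variable {n : ℕ}

theorem pd_radial {m : ℝ → ℝ} (hm : ContDiff ℝ ∞ m) (i : Fin n) :
    pd i (fun y : Eu n => m (‖y‖^2)) = fun y => 2 * y i * deriv m (‖y‖^2) := by
  funext y
  have h1 : HasFDerivAt (fun y : Eu n => ‖y‖^2) (2 • (innerSL ℝ y)) y := by
    exact (hasStrictFDerivAt_norm_sq y).hasFDerivAt
  have h2 : HasDerivAt m (deriv m (‖y‖^2)) (‖y‖^2) := (hm.differentiable (by simp) _).hasDerivAt
  have := (h2.comp_hasFDerivAt y h1).fderiv
  simp only [Function.comp_def] at this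
  unfold pd
  rw [this]
  simp [EuclideanSpace.inner_single_right]
  ring

theorem pd_coord (i j : Fin n) (y : Eu n) : pd i (fun y : Eu n => y j) y = if i = j then 1 else 0 := by
  unfold pd
  have : HasFDerivAt (fun y : Eu n => y j) (EuclideanSpace.proj j : Eu n →L[ℝ] ℝ) y :=
    (EuclideanSpace.proj j : Eu n →L[ℝ] ℝ).hasFDerivAt
  rw [this.fderiv]
  simp [eq_comm]

theorem contDiff_radial {m : ℝ → ℝ} (hm : ContDiff ℝ ∞ m) :
    ContDiff ℝ ∞ (fun y : Eu n => m (‖y‖^2)) := hm.comp (contDiff_norm_sq ℝ)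

theorem lap_radial {m : ℝ → ℝ} (hm : ContDiff ℝ ∞ m) (y : Eu n) :
    lap (fun y : Eu n => m (‖y‖^2)) y =
      2 * n * deriv m (‖y‖^2) + 4 * ‖y‖^2 * deriv (deriv m) (‖y‖^2) := by
  have hm' : ContDiff ℝ ∞ (deriv m) := (contDiff_infty_iff_deriv.1 hm).2
  unfold lap
  have : ∀ i : Fin n, pd i (pd i (fun y : Eu n => m (‖y‖^2))) y =
      2 * deriv m (‖y‖^2) + 4 * (y i)^2 * deriv (deriv m) (‖y‖^2) := by
    intro i
    rw [pd_radial hm, pd_mul, pd_const_mul, pd_coord, pd_radial hm']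
    · simp; ring
    · fun_prop
    · fun_prop
    · exact (contDiff_radial hm').differentiable (by simp) _
  rw [Finset.sum_congr rfl fun i _ => this i, Finset.sum_add_distrib, ← Finset.sum_mul,
    ← Finset.sum_mul, ← Finset.mul_sum, ← EuclideanSpace.real_norm_sq_eq]
  simp only [Finset.sum_const, Finset.card_univ, Fintype.card_fin, nsmul_eq_mul]
  ring

theorem contDiff_mul_rpow {f : ℝ → ℝ} (hf : ContDiff ℝ ∞ f) {a : ℝ} (ha : 0 < a)
    (h0 : ∀ s < a, f s = 0) (r : ℝ) : ContDiff ℝ ∞ (fun s => f s * s ^ r) := by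
  rw [contDiff_iff_contDiffAt]
  intro s
  rcases lt_or_ge s a with h | h
  · have : (fun s => f s * s ^ r) =ᶠ[𝓝 s] fun _ => 0 := by
      filter_upwards [Iio_mem_nhds h] with z hz
      rw [h0 z hz, zero_mul]
    exact contDiffAt_const.congr_of_eventuallyEq this
  · exact hf.contDiffAt.mul (Real.contDiffAt_rpow_const_of_ne (by linarith))

theorem test_radial {m : ℝ → ℝ} (hm : ContDiff ℝ ∞ m) {a : ℝ} (ha : a < 1)
    (h0 : ∀ s, a < s → m s = 0) : Test (ball 0 1) (fun y : Eu n => m (‖y‖^2)) := by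
  have hc : IsClosed {y : Eu n | ‖y‖^2 ≤ a} := isClosed_le (by fun_prop) continuous_const
  have hs : tsupport (fun y : Eu n => m (‖y‖^2)) ⊆ {y : Eu n | ‖y‖^2 ≤ a} := by
    refine closure_minimal ?_ hc
    intro y hy
    by_contra h
    exact hy (h0 _ (not_le.1 h))
  have hb : tsupport (fun y : Eu n => m (‖y‖^2)) ⊆ ball 0 1 := by
    intro y hy
    have := hs hy
    simp only [mem_ofPred_eq] at this
    rw [mem_ball_zero_iff]
    nlinarith [norm_nonneg y]
  exact ⟨contDiff_radial hm, HasCompactSupport.of_support_subset_isCompact (isCompact_closedBall 0 1)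
    ((subset_tsupport _).trans (hb.trans ball_subset_closedBall)), hb⟩

theorem exists_kernel (n : ℕ) (hn : 0 < n) : ∃ φ Γ : Eu n → ℝ, Test (ball 0 1) φ ∧ Test (ball 0 1) Γ ∧
    ∫ y, φ y = 1 ∧ ∀ y, lap Γ y = φ y - 2^n * φ ((2:ℝ) • y) := by
  set ζ : ℝ → ℝ := fun s => Real.smoothTransition (4 * s - 1) with hζ
  have hζs : ContDiff ℝ ∞ ζ := Real.smoothTransition.contDiff.comp (by fun_prop)
  have hζ0 : ∀ s ≤ 1/4, ζ s = 0 := fun s hs => Real.smoothTransition.zero_of_nonpos (by linarith)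
  have hζ1 : ∀ s, 1/2 ≤ s → ζ s = 1 := fun s hs => Real.smoothTransition.one_of_one_le (by linarith)
  have hζ' : ContDiff ℝ ∞ (deriv ζ) := (contDiff_infty_iff_deriv.1 hζs).2
  have hζ'0 : ∀ s < 1/4, deriv ζ s = 0 := by
    intro s hs
    have : ζ =ᶠ[𝓝 s] fun _ => 0 := by
      filter_upwards [Iio_mem_nhds hs] with z hz using hζ0 z (le_of_lt hz)
    rw [this.deriv_eq]; simp
  have hζ'1 : ∀ s, 1/2 < s → deriv ζ s = 0 := by
    intro s hs
    have : ζ =ᶠ[𝓝 s] fun _ => 1 := by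
      filter_upwards [Ioi_mem_nhds hs] with z hz using hζ1 z (le_of_lt hz)
    rw [this.deriv_eq]; simp
  have hζmono : Monotone ζ := fun a b hab => Real.smoothTransition.monotone (by linarith)
  have hζ'n : ∀ s, 0 ≤ deriv ζ s := fun s => hζmono.deriv_nonneg
  set D : ℝ → ℝ := fun s => ζ s - ζ (4 * s) with hD
  have hDs : ContDiff ℝ ∞ D := hζs.sub (hζs.comp (by fun_prop))
  have hD0 : ∀ s < 1/16, D s = 0 := by
    intro s hs
    simp only [hD]
    rw [hζ0 s (by linarith), hζ0 (4*s) (by linarith), sub_zero]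
  have hD1 : ∀ s, 1/2 ≤ s → D s = 0 := by
    intro s hs
    simp only [hD]
    rw [hζ1 s (by linarith), hζ1 (4*s) (by linarith), sub_self]
  set k : ℝ → ℝ := fun s => D s * s ^ (-(n:ℝ)/2) with hk
  have hks : ContDiff ℝ ∞ k := contDiff_mul_rpow hDs (by norm_num) hD0 _
  set B : ℝ → ℝ := fun s => 4 * deriv ζ s * s ^ (1-(n:ℝ)/2) with hB
  have hBs : ContDiff ℝ ∞ B :=
    contDiff_mul_rpow (contDiff_const.mul hζ') (a := 1/4) (by norm_num) (fun s hs => by rw [hζ'0 s hs, mul_zero]) _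
  set γ : ℝ → ℝ := fun s => ∫ r in (1:ℝ)..s, k r with hγ
  have hγd : ∀ s, HasDerivAt γ (k s) s := fun s =>
    intervalIntegral.integral_hasDerivAt_right (hks.continuous.intervalIntegrable _ _)
      (hks.continuous.stronglyMeasurableAtFilter _ _) hks.continuous.continuousAt
  have hγ' : deriv γ = k := funext fun s => (hγd s).deriv
  have hγs : ContDiff ℝ ∞ γ := contDiff_infty_iff_deriv.2
    ⟨fun s => (hγd s).differentiableAt, by rw [hγ']; exact hks⟩
  have hγ0 : ∀ s, 1/2 < s → γ s = 0 := by
    intro s hs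
    simp only [hγ]
    rw [intervalIntegral.integral_congr (g := fun _ => (0:ℝ))]
    · simp
    · intro r hr
      have : 1/2 ≤ r := by
        rcases le_total 1 s with h | h
        · rw [uIcc_of_le h] at hr; linarith [hr.1]
        · rw [uIcc_of_ge h] at hr; linarith [hr.1]
      simp [hk, hD1 r this]
  -- identity
  have hid : ∀ s, 0 ≤ s → 2 * n * k s + 4 * s * deriv k s = B s - 2^n * B (4 * s) := by
    intro s hs
    rcases lt_or_ge s (1/16) with h | h
    · have h1 : k s = 0 := by simp only [hk, hD0 s h, zero_mul]
      have h2 : deriv k s = 0 := by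
        have : k =ᶠ[𝓝 s] fun _ => 0 := by
          filter_upwards [Iio_mem_nhds h] with z hz
          simp only [hk, hD0 z hz, zero_mul]
        rw [this.deriv_eq]; simp
      simp only [h1, h2, hB, hζ'0 s (by linarith), hζ'0 (4*s) (by linarith)]
      ring
    · have hs0 : 0 < s := by linarith
      have hz1 : HasDerivAt ζ (deriv ζ s) s := (hζs.differentiable (by simp) _).hasDerivAt
      have hz2 : HasDerivAt (fun s => ζ (4 * s)) (deriv ζ (4*s) * 4) s := by
        have h1 : HasDerivAt ζ (deriv ζ (4*s)) (4*s) := (hζs.differentiable (by simp) _).hasDerivAt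
        have h2 : HasDerivAt (fun s : ℝ => 4 * s) 4 s := by simpa using (hasDerivAt_id s).const_mul 4
        exact h1.comp s h2
      have hk' : HasDerivAt k ((deriv ζ s - deriv ζ (4*s) * 4) * s ^ (-(n:ℝ)/2) +
          D s * ((-(n:ℝ)/2) * s ^ (-(n:ℝ)/2 - 1))) s :=
        (hz1.sub hz2).mul (Real.hasDerivAt_rpow_const (Or.inl hs0.ne'))
      rw [hk'.deriv]
      simp only [hk, hB]
      have e1 : s ^ (-(n:ℝ)/2 - 1) = s ^ (-(n:ℝ)/2) * s⁻¹ := by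
        rw [Real.rpow_sub hs0, Real.rpow_one]; rfl
      have e2 : s ^ (1-(n:ℝ)/2) = s * s ^ (-(n:ℝ)/2) := by
        rw [show 1-(n:ℝ)/2 = 1 + (-(n:ℝ)/2) by ring, Real.rpow_add hs0, Real.rpow_one]
      have e3 : (2:ℝ)^n * (4 * s) ^ (1-(n:ℝ)/2) = 4 * (s * s ^ (-(n:ℝ)/2)) := by
        rw [Real.mul_rpow (by norm_num) hs, e2, ← mul_assoc]
        congr 1
        rw [show (4:ℝ) = 2^(2:ℝ) by norm_num, ← Real.rpow_mul (by norm_num), ← Real.rpow_natCast,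
          ← Real.rpow_add (by norm_num)]
        congr 1; ring
      rw [show (2:ℝ)^n * (4 * deriv ζ (4 * s) * (4 * s) ^ (1 - (n:ℝ) / 2)) =
        4 * deriv ζ (4*s) * ((2:ℝ)^n * (4 * s) ^ (1-(n:ℝ)/2)) by ring, e3, e1, e2]
      field_simp
      ring
  have hφT : Test (ball 0 1) (fun y : Eu n => B (‖y‖^2)) :=
    test_radial hBs (a := 1/2) (by norm_num) fun s hs => by simp [hB, hζ'1 s hs]
  have hΓT : Test (ball 0 1) (fun y : Eu n => γ (‖y‖^2)) :=
    test_radial hγs (a := 1/2) (by norm_num) hγ0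
  have hlap : ∀ y : Eu n, lap (fun y : Eu n => γ (‖y‖^2)) y = B (‖y‖^2) - 2^n * B (‖(2:ℝ) • y‖^2) := by
    intro y
    rw [lap_radial hγs, hγ', hid _ (by positivity), norm_smul]
    congr 3
    simp; ring
  have hpos : 0 < ∫ y : Eu n, B (‖y‖^2) := by
    obtain ⟨c, hc, hc'⟩ := exists_deriv_eq_slope ζ (a := 1/4) (b := 1/2) (by norm_num)
      hζs.continuous.continuousOn (hζs.differentiable (by simp)).differentiableOn
    rw [hζ0 _ le_rfl, hζ1 _ le_rfl] at hc'
    have hc0 : 0 < c := by linarith [hc.1]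
    refine Continuous.integral_pos_of_hasCompactSupport_nonneg_nonzero
      (x := EuclideanSpace.single ⟨0, hn⟩ (Real.sqrt c)) hφT.continuous hφT.2 ?_ ?_
    · intro y
      simp only [hB, Pi.zero_apply]
      have := hζ'n (‖y‖^2)
      positivity
    · simp only [PiLp.norm_single, Real.norm_eq_abs, sq_abs, Real.sq_sqrt hc0.le, hB, hc']
      positivity
  set I := ∫ y : Eu n, B (‖y‖^2)
  refine ⟨fun y => I⁻¹ * B (‖y‖^2), fun y => I⁻¹ * γ (‖y‖^2), hφT.const_mul _, hΓT.const_mul _, ?_, ?_⟩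
  · rw [integral_const_mul]; exact inv_mul_cancel₀ hpos.ne'
  · intro y
    have : lap (fun y : Eu n => I⁻¹ * γ (‖y‖^2)) y = I⁻¹ * lap (fun y : Eu n => γ (‖y‖^2)) y := by
      unfold lap
      rw [Finset.mul_sum]
      refine Finset.sum_congr rfl fun i _ => ?_
      have : pd i (fun y : Eu n => I⁻¹ * γ (‖y‖^2)) = fun y => I⁻¹ * pd i (fun y : Eu n => γ (‖y‖^2)) y := by
        funext z
        rw [pd_const_mul]
        exact hΓT.1.differentiable (by simp) _
      rw [this, pd_const_mul]
      exact (hΓT.pd i).1.differentiable (by simp) _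
    rw [this, hlap]; ring
end

section
open scoped ContDiff Topology Convolution

variable {n : ℕ}

theorem mp_sub (h : Eu n) : MeasurePreserving (fun x : Eu n => x - h) volume volume :=
  measurePreserving_sub_right volume h

theorem corr_continuous {b F : Eu n → ℝ} (hb : MemLp b 2) (hF : MemLp F 2) :
    Continuous (fun h : Eu n => ∫ x, b x * F (x - h)) := by
  let gg : Eu n → C(Eu n, Eu n) := fun h => ⟨fun x => x - h, by fun_prop⟩
  have hg : Continuous gg := ContinuousMap.continuous_of_continuous_uncurry _ (by
    simp only [gg]; unfold Function.uncurry; simp; fun_prop)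
  have hm : ∀ h, MeasurePreserving (gg h) volume volume := fun h => mp_sub h
  have hc := Continuous.compMeasurePreservingLp (f := fun _ : Eu n => hF.toLp F) continuous_const hg hm
    (by simp)
  have h2 : Continuous fun h : Eu n => inner ℝ (Lp.compMeasurePreserving (gg h) (hm h) (hF.toLp F)) (hb.toLp b) :=
    hc.inner continuous_const
  convert h2 using 2 with h
  rw [Lp.toLp_compMeasurePreserving, L2.inner_def]
  refine integral_congr_ae ?_
  filter_upwards [hb.coeFn_toLp, (hF.comp_measurePreserving (hm h)).coeFn_toLp] with x h1 h2
  rw [h1, h2]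
  simp [gg]

theorem memLp_mul {b F : Eu n → ℝ} (hb : MemLp b 2) (hF : MemLp F 2) :
    Integrable (fun x => b x * F x) := MemLp.integrable_mul hb hF

theorem cv_eq_int (φ F : Eu n → ℝ) {t : ℝ} (ht : 0 < t) (x : Eu n) :
    (t⁻¹)^n * cv φ F t x = ∫ w, φ w * F (x - t • w) := by
  unfold cv
  have h1 : ∫ z, φ (t⁻¹ • (x - z)) * F z = ∫ z, φ (t⁻¹ • z) * F (x - z) := by
    rw [← integral_sub_left_eq_self (fun z => φ (t⁻¹ • z) * F (x - z)) volume x]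
    simp
  have h2 := Measure.integral_comp_smul volume (fun w : Eu n => φ w * F (x - t • w)) t⁻¹
  rw [h1]
  simp only [smul_smul, mul_inv_cancel₀ ht.ne', one_smul] at h2
  rw [h2]
  simp only [finrank_euclideanSpace, Fintype.card_fin, smul_eq_mul]
  rw [← mul_assoc, abs_of_pos (by positivity)]
  rw [inv_pow, inv_inv, inv_mul_cancel₀ (by positivity), one_mul]

theorem weak_conv {b F φ : Eu n → ℝ} (hb : MemLp b 2) (hF : MemLp F 2) (hφ : Test (ball 0 1) φ)
    (h1 : ∫ y, φ y = 1) :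
    Tendsto (fun t : ℝ => ∫ x, b x * ((t⁻¹)^n * cv φ F t x)) (𝓝[>] 0) (𝓝 (∫ x, b x * F x)) := by
  set C : Eu n → ℝ := fun h => ∫ x, b x * F (x - h) with hC
  have hCc : Continuous C := corr_continuous hb hF
  have key : ∀ t : ℝ, 0 < t → ∫ x, b x * ((t⁻¹)^n * cv φ F t x) = ∫ w, φ w * C (t • w) := by
    intro t ht
    simp_rw [cv_eq_int φ F ht, ← integral_const_mul]
    rw [integral_integral_swap]
    · refine integral_congr_ae (ae_of_all _ fun w => ?_)
      simp only [hC]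
      rw [← integral_const_mul]
      congr 1; funext x; ring
    · have hmeas : AEStronglyMeasurable (Function.uncurry fun (x w : Eu n) => b x * (φ w * F (x - t • w)))
          (volume.prod volume) := by
        refine (hb.1.comp_fst).mul ((hφ.continuous.aestronglyMeasurable.comp_snd).mul ?_)
        have hq : Measure.QuasiMeasurePreserving (fun p : Eu n × Eu n => p.1 - t • p.2)
            (volume.prod volume) volume := by
          have hmm : Measurable (fun p : Eu n × Eu n => p.1 - t • p.2) := by fun_prop
          refine ⟨hmm, ?_⟩
          refine Measure.AbsolutelyContinuous.mk fun s hs h0 => ?_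
          rw [Measure.map_apply hmm hs, Measure.measure_prod_null (hmm hs)]
          refine ae_of_all _ fun x => ?_
          have e : (Prod.mk x ⁻¹' ((fun p : Eu n × Eu n => p.1 - t • p.2) ⁻¹' s)) =
            (fun w : Eu n => t • w) ⁻¹' ((fun w => x - w) ⁻¹' s) := rfl
          simp only [Pi.zero_apply]
          rw [e, Measure.addHaar_preimage_smul _ ht.ne',
            (Measure.measurePreserving_sub_left volume x).measure_preimage hs.nullMeasurableSet, h0]
          simp
        exact hF.1.comp_quasiMeasurePreserving hq
      rw [integrable_prod_iff' hmeas]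
      refine ⟨ae_of_all _ fun w => ?_, ?_⟩
      · have := (memLp_mul hb (hF.comp_measurePreserving (mp_sub (t • w)))).const_mul (φ w)
        refine this.congr (ae_of_all _ fun x => ?_)
        simp only [Function.uncurry, Function.comp_def]; ring
      · have hc2 : Continuous fun h : Eu n => ∫ x, |b x| * |F (x - h)| := corr_continuous hb.norm hF.norm
        have hc3 : Continuous fun w : Eu n => |φ w| * ∫ x, |b x| * |F (x - t • w)| :=
          hφ.continuous.abs.mul (hc2.comp (continuous_const_smul t))
        have hi : Integrable fun w : Eu n => |φ w| * ∫ x, |b x| * |F (x - t • w)| :=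
          hc3.integrable_of_hasCompactSupport (hφ.2.norm.mul_right)
        refine hi.congr (ae_of_all _ fun w => ?_)
        simp only [Function.uncurry, norm_mul, Real.norm_eq_abs]
        rw [← integral_const_mul]
        congr 1; funext x; ring
  have hlim : Tendsto (fun t : ℝ => ∫ w, φ w * C (t • w)) (𝓝 0) (𝓝 (∫ w, φ w * C ((0:ℝ) • w))) := by
    have hK : IsCompact ((fun p : ℝ × Eu n => p.1 • p.2) '' (closedBall 0 1 ×ˢ closedBall 0 1)) :=
      ((isCompact_closedBall _ _).prod (isCompact_closedBall _ _)).image (by fun_prop)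
    obtain ⟨M, hM⟩ := hK.exists_bound_of_continuousOn hCc.continuousOn
    refine tendsto_integral_filter_of_dominated_convergence (fun w => |φ w| * M) ?_ ?_ ?_ ?_
    · exact Eventually.of_forall fun t => (hφ.continuous.mul (hCc.comp (continuous_const_smul t))).aestronglyMeasurable
    · filter_upwards [closedBall_mem_nhds (0:ℝ) one_pos] with t ht
      refine ae_of_all _ fun w => ?_
      rw [norm_mul]
      by_cases hw : w ∈ ball (0:Eu n) 1
      · exact mul_le_mul_of_nonneg_left (hM _ ⟨(t, w), ⟨ht, ball_subset_closedBall hw⟩, rfl⟩) (norm_nonneg _)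
      · simp [hφ.eq_zero hw]
    · exact ((hφ.continuous.abs.integrable_of_hasCompactSupport hφ.2.norm).mul_const M)
    · refine ae_of_all _ fun w => ?_
      have : Continuous fun t : ℝ => φ w * C (t • w) :=
        continuous_const.mul (hCc.comp (by fun_prop))
      exact this.tendsto 0
  have e0 : ∫ w, φ w * C ((0:ℝ) • w) = ∫ x, b x * F x := by
    simp only [zero_smul]
    rw [integral_mul_const, h1, one_mul]
    simp [hC]
  rw [e0] at hlim
  refine (hlim.mono_left nhdsWithin_le_nhds).congr' ?_
  filter_upwards [self_mem_nhdsWithin] with t ht using (key t ht).symm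

/-- weak derivative in an open set (scalar, globally defined functions) -/
def WD (O : Set (Eu n)) (l : Fin n) (U G : Eu n → ℝ) : Prop :=
  ∀ ψ, Test O ψ → ∫ x, U x * pd l ψ x = - ∫ x, ψ x * G x

theorem pd_cv_weak {O : Set (Eu n)} {U G : Eu n → ℝ} {l : Fin n} (hU : LocallyIntegrable U)
    (h : WD O l U G) {κ : Eu n → ℝ} (hκ : Test (ball 0 1) κ) {t : ℝ} (ht : 0 < t) {x : Eu n}
    (hx : ball x t ⊆ O) : pd l (cv κ U t) x = cv κ G t x := by
  rw [pd_cv hκ hU ht]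
  have := h _ ((hκ.scl ht x).mono hx)
  rw [pd_scl hκ.1] at this
  unfold cv
  rw [← neg_eq_iff_eq_neg, ← integral_neg] at this
  rw [← this]
  simp only
  rw [← integral_const_mul]
  congr 1; funext z; ring

theorem approx_id {y : Eu n} {ρ r' : ℝ} (hr : r' < ρ) (hn : 0 < n) {U : Eu n → ℝ} {G : Fin n → Eu n → ℝ}
    (hU : MemLp U 2) (hG : ∀ l, MemLp (G l) 2) (hW : ∀ l, WD (ball y ρ) l U (G l))
    {a : Eu n → ℝ} {b : Fin n → Eu n → ℝ} (ha : MemLp a 2) (hb : ∀ l, MemLp (b l) 2)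
    (hb0 : ∀ l, ∀ x ∉ closedBall y r', b l x = 0)
    (H : ∀ v : Eu n → ℝ, ContDiff ℝ ∞ v → (∫ x, a x * v x) + ∑ l, ∫ x, b l x * pd l v x = 0) :
    (∫ x, a x * U x) + ∑ l, ∫ x, b l x * G l x = 0 := by
  obtain ⟨φ, -, hφ, -, h1, -⟩ := exists_kernel n hn
  have hUl : LocallyIntegrable U := hU.locallyIntegrable (by norm_num)
  have T := (weak_conv ha hU hφ h1).add
    (tendsto_finsetSum Finset.univ fun l _ => weak_conv (hb l) (hG l) hφ h1)
  refine tendsto_nhds_unique T (tendsto_const_nhds.congr' ?_)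
  have : Ioo 0 (ρ - r') ∈ 𝓝[>] (0:ℝ) := Ioo_mem_nhdsGT (by linarith)
  filter_upwards [this] with t ht
  have hs := contDiff_cv hφ hUl ht.1
  rw [← H (fun x => (t⁻¹)^n * cv φ U t x) (contDiff_const.mul hs)]
  congr 1
  refine Finset.sum_congr rfl fun l _ => integral_congr_ae (ae_of_all _ fun x => ?_)
  by_cases hx : x ∈ closedBall y r'
  · simp only
    rw [pd_const_mul _ _ (hs.differentiable (by simp) _), pd_cv_weak hUl (hW l) hφ ht.1]
    refine ball_subset_ball' ?_
    rw [mem_closedBall] at hx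
    linarith [ht.2]
  · simp [hb0 l x hx]
end

section
open scoped ContDiff Topology Convolution

variable {n p : ℕ}

theorem memLp_bdd_mul {f g : Eu n → ℝ} {C : ℝ} (hf : AEStronglyMeasurable f volume)
    (hC : ∀ᵐ x, |f x| ≤ C) (hg : MemLp g 2) : MemLp (fun x => f x * g x) 2 := by
  refine hg.of_le_mul (c := C) (hf.mul hg.1) ?_
  filter_upwards [hC] with x hx
  rw [norm_mul]
  exact mul_le_mul_of_nonneg_right hx (norm_nonneg _)

theorem Test.memLp_mul {O : Set (Eu n)} {ψ g : Eu n → ℝ} (h : Test O ψ) (hg : MemLp g 2) :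
    MemLp (fun x => ψ x * g x) 2 := by
  obtain ⟨M, -, hM⟩ := h.bdd
  exact memLp_bdd_mul h.continuous.aestronglyMeasurable (ae_of_all _ hM) hg

theorem Test.memLp {O : Set (Eu n)} {ψ : Eu n → ℝ} (h : Test O ψ) : MemLp ψ 2 :=
  h.continuous.memLp_of_hasCompactSupport h.2

theorem Test.int_mul {O : Set (Eu n)} {ψ g : Eu n → ℝ} (h : Test O ψ) (hg : MemLp g 2) :
    Integrable (fun x => ψ x * g x) := _root_.memLp_mul h.memLp hg

theorem Test.exists_radius {y : Eu n} {ρ : ℝ} {ψ : Eu n → ℝ} (h : Test (ball y ρ) ψ) :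
    ∃ r' < ρ, ∀ x ∉ closedBall y r', ψ x = 0 := by
  obtain ⟨r', hr, hs⟩ := exists_lt_subset_ball (isClosed_tsupport ψ) h.3
  exact ⟨r', hr, fun x hx => image_eq_zero_of_notMem_tsupport fun h' =>
    hx (ball_subset_closedBall (hs h'))⟩

theorem Test.diff {O : Set (Eu n)} {ψ : Eu n → ℝ} (h : Test O ψ) : Differentiable ℝ ψ :=
  h.1.differentiable (by simp)

theorem integral_pd_eq_zero {O : Set (Eu n)} {ψ : Eu n → ℝ} (h : Test O ψ) (i : Fin n) :
    ∫ x, pd i ψ x = 0 := by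
  have := integral_mul_fderiv_eq_neg_fderiv_mul_of_integrable (μ := (volume : Measure (Eu n)))
    (f := fun _ => (1:ℝ)) (g := ψ)
    (v := EuclideanSpace.single i (1:ℝ)) (by simp)
    (by simp only [one_mul]; exact (h.pd i).continuous.integrable_of_hasCompactSupport (h.pd i).2)
    (by simpa using h.continuous.integrable_of_hasCompactSupport h.2) (by intros; simp) (fun x _ => h.diff x)
  simpa [pd] using this

def VV (U : Fin p → Eu n → ℝ) (G : Fin n → Fin p → Eu n → ℝ) (i : Fin n) (a b : Fin p) (x : Eu n) : ℝ :=
  U a x * G i b x - U b x * G i a x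

/-- energy density -/
def ed (G : Fin n → Fin p → Eu n → ℝ) (x : Eu n) : ℝ := ∑ i, ∑ b, (G i b x)^2

structure Sys (y : Eu n) (ρ : ℝ) (U : Fin p → Eu n → ℝ) (G : Fin n → Fin p → Eu n → ℝ) : Prop where
  hn : 0 < n
  memU : ∀ a, MemLp (U a) 2
  memG : ∀ i a, MemLp (G i a) 2
  wd : ∀ i a, WD (ball y ρ) i (U a) (G i a)
  bdd : ∀ᵐ x, ∀ a, |U a x| ≤ 1
  sph : ∀ᵐ x, x ∈ ball y ρ → ∑ a, (U a x)^2 = 1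
  el : ∀ a b ψ, Test (ball y ρ) ψ → ∑ i, ∫ x, pd i ψ x * VV U G i a b x = 0

namespace Sys
variable {y : Eu n} {ρ : ℝ} {U : Fin p → Eu n → ℝ} {G : Fin n → Fin p → Eu n → ℝ}

theorem memUmul (S : Sys y ρ U G) (a : Fin p) {g : Eu n → ℝ} (hg : MemLp g 2) :
    MemLp (fun x => U a x * g x) 2 :=
  memLp_bdd_mul (S.memU a).1 (by filter_upwards [S.bdd] with x hx using hx a) hg

theorem memV (S : Sys y ρ U G) (i : Fin n) (a b : Fin p) : MemLp (VV U G i a b) 2 :=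
  (S.memUmul a (S.memG i b)).sub (S.memUmul b (S.memG i a))

/-- product rule, tested -/
theorem sq_rule (S : Sys y ρ U G) (i : Fin n) (a : Fin p) {ψ : Eu n → ℝ} (h : Test (ball y ρ) ψ) :
    (∫ x, U a x * U a x * pd i ψ x) + 2 * ∫ x, ψ x * (U a x * G i a x) = 0 := by
  obtain ⟨r', hr, h0⟩ := h.exists_radius
  have hp := (h.pd i)
  have key := approx_id hr S.hn (S.memU a) (S.memG · a) (S.wd · a)
    (a := fun x => pd i ψ x * U a x + ψ x * G i a x)
    (b := fun l x => if l = i then ψ x * U a x else 0)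
    ((hp.memLp_mul (S.memU a)).add (h.memLp_mul (S.memG i a)))
    (by intro l; by_cases hl : l = i
        · simpa [hl] using h.memLp_mul (S.memU a)
        · simp [hl])
    (by intro l x hx; simp [h0 x hx])
    (by
      intro v hv
      have hvd : Differentiable ℝ v := hv.differentiable (by simp)
      have w := S.wd i a _ (h.mul hv)
      have e : ∀ x, pd i (fun x => ψ x * v x) x = pd i ψ x * v x + ψ x * pd i v x :=
        fun x => pd_mul i (h.diff x) (hvd x)
      simp only [e] at w
      have i1 : Integrable fun x => (pd i ψ x * U a x + ψ x * G i a x) * v x := by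
        have := ((hp.mul hv).int_mul (S.memU a)).add ((h.mul hv).int_mul (S.memG i a))
        refine this.congr (ae_of_all _ fun x => ?_)
        simp only [Pi.add_apply]; ring
      have i2 : Integrable fun x => ψ x * U a x * pd i v x := by
        have := ((h.mul (contDiff_pd hv i)).int_mul (S.memU a))
        refine this.congr (ae_of_all _ fun x => ?_)
        simp only; ring
      rw [Finset.sum_eq_single i]
      · simp only [if_true]
        rw [← integral_add i1 i2]
        have i3 : Integrable fun x => U a x * (pd i ψ x * v x + ψ x * pd i v x) := by
          have := ((hp.mul hv).int_mul (S.memU a)).add ((h.mul (contDiff_pd hv i)).int_mul (S.memU a))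
          refine this.congr (ae_of_all _ fun x => ?_)
          simp only [Pi.add_apply]; ring
        have i4 := (h.mul hv).int_mul (S.memG i a)
        rw [eq_neg_iff_add_eq_zero, ← integral_add i3 i4] at w
        rw [← w]
        congr 1; funext x; ring
      · intro l _ hl; simp [hl]
      · simp)
  have j1 : Integrable fun x => U a x * U a x * pd i ψ x := by
    have := memLp_mul (hp.memLp_mul (S.memU a)) (S.memU a)
    exact this.congr (ae_of_all _ fun x => by simp only; ring)
  have j2 : Integrable fun x => ψ x * (U a x * G i a x) := by
    have := memLp_mul (h.memLp_mul (S.memU a)) (S.memG i a)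
    exact this.congr (ae_of_all _ fun x => by simp only; ring)
  rw [Finset.sum_eq_single i (by intro l _ hl; simp [hl]) (by simp)] at key
  simp only [if_true] at key
  rw [← key, ← integral_const_mul, ← integral_add j1 (j2.const_mul 2)]
  rw [← integral_add]
  · congr 1; funext x; ring
  · have := j1.add j2
    exact this.congr (ae_of_all _ fun x => by simp only [Pi.add_apply]; ring)
  · exact j2.congr (ae_of_all _ fun x => by simp only; ring)

theorem f1 (S : Sys y ρ U G) (i : Fin n) : ∀ᵐ x, x ∈ ball y ρ → ∑ a, U a x * G i a x = 0 := by
  have hint : ∀ a, Integrable (fun x => U a x * G i a x) := fun a => memLp_mul (S.memU a) (S.memG i a)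
  refine isOpen_ball.ae_eq_zero_of_integral_contDiff_smul_eq_zero
    (f := fun x => ∑ a, U a x * G i a x) ?_ ?_
  · exact (integrable_finsetSum _ fun a _ => hint a).locallyIntegrable.locallyIntegrableOn _
  · intro ψ h1 h2 h3
    have h : Test (ball y ρ) ψ := ⟨h1, h2, h3⟩
    have hj : ∀ a, Integrable fun x => ψ x * (U a x * G i a x) := fun a => by
      have := memLp_mul (h.memLp_mul (S.memU a)) (S.memG i a)
      exact this.congr (ae_of_all _ fun x => by simp only; ring)
    have hj1 : ∀ a, Integrable fun x => U a x * U a x * pd i ψ x := fun a => by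
      have := memLp_mul ((h.pd i).memLp_mul (S.memU a)) (S.memU a)
      exact this.congr (ae_of_all _ fun x => by simp only; ring)
    have e1 : ∫ x, ψ x • ∑ a, U a x * G i a x = ∑ a, ∫ x, ψ x * (U a x * G i a x) := by
      rw [← integral_finsetSum _ fun a _ => hj a]
      congr 1; funext x; rw [smul_eq_mul, Finset.mul_sum]
    have e2 : ∑ a, ∫ x, U a x * U a x * pd i ψ x = 0 := by
      rw [← integral_finsetSum _ fun a _ => hj1 a, ← integral_pd_eq_zero h i]
      refine integral_congr_ae ?_
      filter_upwards [S.sph] with x hx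
      by_cases hxb : x ∈ ball y ρ
      · rw [← Finset.sum_mul]
        have := hx hxb
        simp only [sq] at this
        rw [this, one_mul]
      · simp [(h.pd i).eq_zero hxb]
    have e3 := Finset.sum_congr (rfl : (Finset.univ : Finset (Fin p)) = _) fun a _ => S.sq_rule i a h
    rw [Finset.sum_add_distrib, e2, ← Finset.mul_sum] at e3
    rw [e1]
    simpa using e3

theorem sumVU (S : Sys y ρ U G) (i : Fin n) (a : Fin p) :
    ∀ᵐ x, x ∈ ball y ρ → ∑ b, VV U G i a b x * U b x = - G i a x := by
  filter_upwards [S.sph, S.f1 i] with x h1 h2 hx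
  have h1 := h1 hx
  have h2 := h2 hx
  have : ∑ b, VV U G i a b x * U b x = U a x * ∑ b, U b x * G i b x - G i a x * ∑ b, (U b x)^2 := by
    rw [Finset.mul_sum, Finset.mul_sum, ← Finset.sum_sub_distrib]
    refine Finset.sum_congr rfl fun b _ => ?_
    unfold VV; ring
  rw [this, h1, h2]; ring

theorem sumVG (S : Sys y ρ U G) (a : Fin p) :
    ∀ᵐ x, x ∈ ball y ρ → ∑ i, ∑ b, VV U G i a b x * G i b x = ed G x * U a x := by
  filter_upwards [eventually_countable_forall.2 S.f1] with x h2 hx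
  unfold ed
  rw [Finset.sum_mul]
  refine Finset.sum_congr rfl fun i _ => ?_
  have h2 := h2 i hx
  have : ∑ b, VV U G i a b x * G i b x = U a x * ∑ b, (G i b x)^2 - G i a x * ∑ b, U b x * G i b x := by
    rw [Finset.mul_sum, Finset.mul_sum, ← Finset.sum_sub_distrib]
    refine Finset.sum_congr rfl fun b _ => ?_
    unfold VV; ring
  rw [this, h2]; ring

theorem lap_eq (S : Sys y ρ U G) (a : Fin p) {ψ : Eu n → ℝ} (h : Test (ball y ρ) ψ) :
    ∫ x, U a x * lap ψ x = - ∑ i, ∫ x, pd i ψ x * G i a x := by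
  unfold lap
  rw [← Finset.sum_neg_distrib]
  simp_rw [Finset.mul_sum]
  rw [integral_finsetSum]
  · exact Finset.sum_congr rfl fun i _ => S.wd i a _ (h.pd i)
  · intro i _
    exact (((h.pd i).pd i).int_mul (S.memU a)).congr (ae_of_all _ fun x => by simp only; ring)

theorem intVU (S : Sys y ρ U G) (i : Fin n) (a b : Fin p) {ψ : Eu n → ℝ} (h : Test (ball y ρ) ψ) :
    Integrable fun x => ψ x * VV U G i a b x * U b x :=
  memLp_mul (h.memLp_mul (S.memV i a b)) (S.memU b)

theorem lap_eq2 (S : Sys y ρ U G) (a : Fin p) {ψ : Eu n → ℝ} (h : Test (ball y ρ) ψ) :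
    ∫ x, U a x * lap ψ x = ∑ i, ∑ b, ∫ x, pd i ψ x * VV U G i a b x * U b x := by
  rw [S.lap_eq a h, ← Finset.sum_neg_distrib]
  refine Finset.sum_congr rfl fun i _ => ?_
  rw [← integral_finsetSum _ fun b _ => S.intVU i a b (h.pd i), ← integral_neg]
  refine integral_congr_ae ?_
  filter_upwards [S.sumVU i a] with x hx
  by_cases hxb : x ∈ ball y ρ
  · have := hx hxb
    simp_rw [mul_assoc]
    rw [← Finset.mul_sum, this]; ring
  · simp [(h.pd i).eq_zero hxb]

/-- F2' -/
theorem f2 (S : Sys y ρ U G) (a : Fin p) {ψ : Eu n → ℝ} (h : Test (ball y ρ) ψ) (c : Fin p → ℝ) :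
    ∫ x, U a x * lap ψ x = ∑ i, ∑ b, ∫ x, pd i ψ x * VV U G i a b x * (U b x - c b) := by
  have e : ∑ i, ∑ b, ∫ x, pd i ψ x * VV U G i a b x * (U b x - c b) =
      (∑ i, ∑ b, ∫ x, pd i ψ x * VV U G i a b x * U b x) -
      ∑ b, c b * ∑ i, ∫ x, pd i ψ x * VV U G i a b x := by
    simp_rw [Finset.mul_sum]
    rw [Finset.sum_comm (s := (Finset.univ : Finset (Fin p))), ← Finset.sum_sub_distrib]
    refine Finset.sum_congr rfl fun i _ => ?_
    rw [← Finset.sum_sub_distrib]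
    refine Finset.sum_congr rfl fun b _ => ?_
    rw [← integral_const_mul, ← integral_sub (S.intVU i a b (h.pd i))
      (((h.pd i).int_mul (S.memV i a b)).const_mul _)]
    congr 1; funext x; ring
  rw [e, S.lap_eq2 a h]
  simp [S.el a _ _ h]

/-- F3 -/
theorem f3 (S : Sys y ρ U G) (a : Fin p) {ψ : Eu n → ℝ} (h : Test (ball y ρ) ψ) :
    ∫ x, U a x * lap ψ x = - ∫ x, ψ x * (ed G x * U a x) := by
  have hVG : ∀ i b, Integrable fun x => ψ x * VV U G i a b x * G i b x := fun i b =>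
    memLp_mul (h.memLp_mul (S.memV i a b)) (S.memG i b)
  have key : ∀ b, (∑ i, ∫ x, pd i ψ x * VV U G i a b x * U b x) +
      ∑ i, ∫ x, ψ x * VV U G i a b x * G i b x = 0 := by
    intro b
    obtain ⟨r', hr, h0⟩ := h.exists_radius
    have := approx_id hr S.hn (S.memU b) (S.memG · b) (S.wd · b)
      (a := fun x => ∑ i, pd i ψ x * VV U G i a b x)
      (b := fun i x => ψ x * VV U G i a b x)
      (memLp_finsetSum _ fun i _ => (h.pd i).memLp_mul (S.memV i a b))
      (fun i => h.memLp_mul (S.memV i a b))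
      (by intro l x hx; simp [h0 x hx])
      (by
        intro v hv
        have hvd : Differentiable ℝ v := hv.differentiable (by simp)
        rw [← S.el a b _ (h.mul hv)]
        simp_rw [Finset.sum_mul]
        have i1 : ∀ i, Integrable fun x => pd i ψ x * VV U G i a b x * v x := fun i => by
          refine (((h.pd i).mul hv).int_mul (S.memV i a b)).congr (ae_of_all _ fun x => by simp only; ring)
        have i2 : ∀ i, Integrable fun x => ψ x * VV U G i a b x * pd i v x := fun i => by
          refine ((h.mul (contDiff_pd hv i)).int_mul (S.memV i a b)).congr (ae_of_all _ fun x => by simp only; ring)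
        rw [integral_finsetSum _ fun i _ => i1 i, ← Finset.sum_add_distrib]
        refine Finset.sum_congr rfl fun i _ => ?_
        rw [← integral_add (i1 i) (i2 i)]
        congr 1; funext x
        rw [pd_mul i (h.diff x) (hvd x)]; ring)
    rw [← this]
    simp_rw [Finset.sum_mul]
    rw [integral_finsetSum _ fun i _ => S.intVU i a b (h.pd i)]
  have k2 := Finset.sum_congr (rfl : (Finset.univ : Finset (Fin p)) = _) fun b _ => key b
  rw [Finset.sum_add_distrib, Finset.sum_comm, ← S.lap_eq2 a h, Finset.sum_const_zero] at k2
  rw [eq_neg_iff_add_eq_zero, ← k2]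
  congr 1
  rw [Finset.sum_comm]
  simp_rw [← integral_finsetSum _ fun b _ => hVG _ b]
  rw [← integral_finsetSum _ fun i _ => integrable_finsetSum _ fun b _ => hVG i b]
  refine integral_congr_ae ?_
  filter_upwards [S.sumVG a] with x hx
  by_cases hxb : x ∈ ball y ρ
  · have := hx hxb
    simp_rw [mul_assoc]
    rw [← this, Finset.mul_sum]
    simp_rw [Finset.mul_sum]
  · simp [h.eq_zero hxb]

end Sys
end

section
open scoped ContDiff Topology Convolution

variable {n p : ℕ}

theorem cs_int {α : Type*} [MeasurableSpace α] {μ : Measure α} {f g : α → ℝ} (hf : MemLp f 2 μ)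
    (hg : MemLp g 2 μ) : (∫ x, f x * g x ∂μ)^2 ≤ (∫ x, f x ^2 ∂μ) * ∫ x, g x ^2 ∂μ := by
  have h := real_inner_mul_inner_self_le (hf.toLp f) (hg.toLp g)
  have e : ∀ {u v : α → ℝ} (hu : MemLp u 2 μ) (hv : MemLp v 2 μ),
      inner ℝ (hu.toLp u) (hv.toLp v) = ∫ x, u x * v x ∂μ := by
    intro u v hu hv
    rw [L2.inner_def]
    refine integral_congr_ae ?_
    filter_upwards [hu.coeFn_toLp, hv.coeFn_toLp] with x h1 h2
    rw [h1, h2]; simp [mul_comm]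
  rw [e, e, e] at h
  simpa only [sq] using h

def om (n : ℕ) : ℝ := volume.real (ball (0 : Eu n) 1)

theorem om_pos : 0 < om n := by
  unfold om
  rw [measureReal_def]
  exact ENNReal.toReal_pos (measure_ball_pos _ _ one_pos).ne' measure_ball_lt_top.ne

theorem vol_ball (x : Eu n) {t : ℝ} (ht : 0 < t) : volume.real (ball x t) = t^n * om n := by
  unfold om
  rw [measureReal_def, measureReal_def, Measure.addHaar_ball_of_pos _ _ ht, ENNReal.toReal_mul,
    finrank_euclideanSpace, Fintype.card_fin, ENNReal.toReal_ofReal (by positivity)]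

def osc (U : Fin p → Eu n → ℝ) (c : Fin p → ℝ) (z : Eu n) : ℝ := ∑ b, (U b z - c b)^2

theorem osc_nonneg (U : Fin p → Eu n → ℝ) (c : Fin p → ℝ) (z : Eu n) : 0 ≤ osc U c z :=
  Finset.sum_nonneg fun _ _ => sq_nonneg _

theorem ed_nonneg (G : Fin n → Fin p → Eu n → ℝ) (z : Eu n) : 0 ≤ ed G z :=
  Finset.sum_nonneg fun _ _ => Finset.sum_nonneg fun _ _ => sq_nonneg _

theorem D2 {f : Eu n → ℝ} (hf : Integrable f) (h0 : ∀ x, 0 ≤ f x) (x0 : Eu n) (r : ℝ) {t : ℝ} (ht : 0 < t) :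
    IntegrableOn (fun x => ∫ z in ball x t, f z) (ball x0 r) ∧
    ∫ x in ball x0 r, ∫ z in ball x t, f z ≤ t^n * om n * ∫ z in ball x0 (r+t), f z := by
  set B := ball x0 r
  let F : Eu n × Eu n → ℝ := {q : Eu n × Eu n | dist q.2 q.1 < t}.indicator (fun q => f q.2)
  have hms : MeasurableSet {q : Eu n × Eu n | dist q.2 q.1 < t} :=
    (isOpen_lt (by fun_prop) continuous_const).measurableSet
  have hi0 : Integrable (fun q : Eu n × Eu n => f q.2) ((volume.restrict B).prod volume) := by
    have h1 : Integrable (fun _ : Eu n => (1:ℝ)) (volume.restrict B) :=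
      integrableOn_const measure_ball_lt_top.ne
    simpa using h1.mul_prod hf
  have hF : Integrable F ((volume.restrict B).prod volume) := hi0.indicator hms
  have hFe : ∀ x z, F (x, z) = (ball x t).indicator f z := by
    intro x z
    simp only [F, indicator, mem_ball, mem_ofPred_eq]
  have hFe2 : ∀ x z, F (x, z) = (ball z t).indicator (fun _ => f z) x := by
    intro x z
    simp only [F, indicator, mem_ball, mem_ofPred_eq, dist_comm]
  have e1 : ∀ x, ∫ z, F (x, z) = ∫ z in ball x t, f z := fun x => by
    simp_rw [hFe]; rw [integral_indicator measurableSet_ball]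
  have I1 := hF.integral_prod_left
  simp only [e1] at I1
  refine ⟨I1, ?_⟩
  have hsw := integral_integral_swap (f := fun x z => F (x, z)) hF
  simp only [e1] at hsw
  rw [hsw, ← integral_indicator measurableSet_ball, ← integral_const_mul]
  refine integral_mono hF.integral_prod_right ((hf.indicator measurableSet_ball).const_mul _) fun z => ?_
  simp only
  by_cases hz : z ∈ ball x0 (r + t)
  · rw [indicator_of_mem hz]
    have : ∫ x in B, F (x, z) ≤ ∫ x, (ball z t).indicator (fun _ => f z) x := by
      simp_rw [hFe2]
      refine setIntegral_le_integral ?_ (ae_of_all _ fun x => indicator_nonneg (fun _ _ => h0 z) x)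
      exact (integrableOn_const measure_ball_lt_top.ne).integrable_indicator measurableSet_ball
    refine this.trans_eq ?_
    rw [integral_indicator measurableSet_ball, setIntegral_const, vol_ball z ht, smul_eq_mul]
  · rw [indicator_of_notMem hz, mul_zero]
    refine le_of_eq (setIntegral_eq_zero_of_forall_eq_zero fun x hx => ?_)
    rw [hFe2, indicator_of_notMem]
    intro hxz
    apply hz
    rw [mem_ball] at hx hxz ⊢
    calc dist z x0 ≤ dist z x + dist x x0 := dist_triangle _ _ _
      _ < r + t := by rw [dist_comm z x]; linarith

namespace Sys
variable {y : Eu n} {ρ : ℝ} {U : Fin p → Eu n → ℝ} {G : Fin n → Fin p → Eu n → ℝ}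

theorem ed_int (S : Sys y ρ U G) : Integrable (ed G) := by
  unfold ed
  exact integrable_finsetSum _ fun i _ => integrable_finsetSum _ fun b _ => (S.memG i b).integrable_sq

theorem memUc (S : Sys y ρ U G) (b : Fin p) (c : ℝ) (x : Eu n) (t : ℝ) :
    MemLp (fun z => U b z - c) 2 (volume.restrict (ball x t)) := by
  have : IsFiniteMeasure (volume.restrict (ball x t)) := isFiniteMeasure_restrict.2 measure_ball_lt_top.ne
  exact ((S.memU b).restrict _).sub (memLp_const c)

theorem osc_int (S : Sys y ρ U G) (c : Fin p → ℝ) (x : Eu n) (t : ℝ) :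
    IntegrableOn (osc U c) (ball x t) := by
  unfold osc
  exact integrable_finsetSum _ fun b _ => (S.memUc b (c b) x t).integrable_sq

theorem memSqrtEd (S : Sys y ρ U G) : MemLp (fun z => Real.sqrt (ed G z)) 2 := by
  rw [memLp_two_iff_integrable_sq (Real.continuous_sqrt.comp_aestronglyMeasurable S.ed_int.1)]
  refine S.ed_int.congr (ae_of_all _ fun z => ?_)
  simp only; rw [Real.sq_sqrt (ed_nonneg G z)]

theorem memSqrtOsc (S : Sys y ρ U G) (c : Fin p → ℝ) (x : Eu n) (t : ℝ) :
    MemLp (fun z => Real.sqrt (osc U c z)) 2 (volume.restrict (ball x t)) := by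
  rw [memLp_two_iff_integrable_sq (Real.continuous_sqrt.comp_aestronglyMeasurable (S.osc_int c x t).1)]
  refine (S.osc_int c x t).congr (ae_of_all _ fun z => ?_)
  simp only; rw [Real.sq_sqrt (osc_nonneg U c z)]

theorem abs_V_le (S : Sys y ρ U G) : ∀ᵐ z, ∀ i a b, |VV U G i a b z| ≤ 2 * Real.sqrt (ed G z) := by
  filter_upwards [S.bdd] with z hz i a b
  have hg : ∀ c, |G i c z| ≤ Real.sqrt (ed G z) := by
    intro c
    rw [← Real.sqrt_sq_eq_abs]
    refine Real.sqrt_le_sqrt ?_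
    unfold ed
    refine le_trans ?_ (Finset.single_le_sum (fun j _ => Finset.sum_nonneg fun _ _ => sq_nonneg _) (Finset.mem_univ i))
    exact Finset.single_le_sum (f := fun c => (G i c z)^2) (fun _ _ => sq_nonneg _) (Finset.mem_univ c)
  unfold VV
  calc |U a z * G i b z - U b z * G i a z| ≤ |U a z * G i b z| + |U b z * G i a z| := abs_sub _ _
    _ ≤ 1 * Real.sqrt (ed G z) + 1 * Real.sqrt (ed G z) := by
        rw [abs_mul, abs_mul]
        exact add_le_add (mul_le_mul (hz a) (hg b) (abs_nonneg _) zero_le_one)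
          (mul_le_mul (hz b) (hg a) (abs_nonneg _) zero_le_one)
    _ = _ := by ring

theorem cv_lap (_S : Sys y ρ U G) (a : Fin p) {κ : Eu n → ℝ} (hκ : Test (ball 0 1) κ) {t : ℝ} (ht : 0 < t)
    (x : Eu n) : cv (lap κ) (U a) t x = t^2 * ∫ z, U a z * lap (fun z => κ (t⁻¹ • (x - z))) z := by
  rw [lap_scl hκ.1]
  unfold cv
  rw [← integral_const_mul]
  congr 1; funext z
  field_simp

theorem D1 (S : Sys y ρ U G) (a : Fin p) {κ : Eu n → ℝ} (hκ : Test (ball 0 1) κ) {M : ℝ}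
    (hM : ∀ i x, |pd i κ x| ≤ M) {t : ℝ} (ht : 0 < t) {x : Eu n} (hx : ball x t ⊆ ball y ρ)
    (c : Fin p → ℝ) : (cv (lap κ) (U a) t x)^2 ≤
      (2 * n * p * M)^2 * t^2 * (∫ z in ball x t, ed G z) * ∫ z in ball x t, osc U c z := by
  have hψ := (hκ.scl ht x)
  have hψ' := hψ.mono hx
  set T := ∫ z in ball x t, Real.sqrt (ed G z) * Real.sqrt (osc U c z) with hT
  have hM0 : 0 ≤ M := (abs_nonneg _).trans (hM ⟨0, S.hn⟩ 0)
  have hTi : IntegrableOn (fun z => Real.sqrt (ed G z) * Real.sqrt (osc U c z)) (ball x t) :=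
    MemLp.integrable_mul (S.memSqrtEd.restrict _) (S.memSqrtOsc c x t)
  have h1 : ∀ i b, |∫ z, pd i (fun z => κ (t⁻¹ • (x - z))) z * VV U G i a b z * (U b z - c b)| ≤
      t⁻¹ * M * 2 * T := by
    intro i b
    rw [← setIntegral_eq_integral_of_forall_compl_eq_zero (s := ball x t)
      (fun z hz => by rw [(hψ.pd i).eq_zero hz, zero_mul, zero_mul]), hT, ← integral_const_mul,
      ← Real.norm_eq_abs]
    refine norm_integral_le_of_norm_le (hTi.const_mul _) ?_
    filter_upwards [ae_restrict_of_ae S.abs_V_le] with z hz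
    rw [norm_mul, norm_mul, pd_scl hκ.1, norm_mul, norm_neg, norm_inv, Real.norm_of_nonneg ht.le]
    have h2 : |U b z - c b| ≤ Real.sqrt (osc U c z) := by
      rw [← Real.sqrt_sq_eq_abs]
      exact Real.sqrt_le_sqrt (Finset.single_le_sum (f := fun b => (U b z - c b)^2) (fun _ _ => sq_nonneg _) (Finset.mem_univ b))
    have h3 := hz i a b
    have h4 := hM i (t⁻¹ • (x - z))
    simp only [Real.norm_eq_abs]
    calc t⁻¹ * |pd i κ (t⁻¹ • (x - z))| * |VV U G i a b z| * |U b z - c b|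
        ≤ t⁻¹ * M * (2 * Real.sqrt (ed G z)) * Real.sqrt (osc U c z) := by gcongr
      _ = _ := by ring
  have h5 : |∫ z, U a z * lap (fun z => κ (t⁻¹ • (x - z))) z| ≤ n * p * (t⁻¹ * M * 2 * T) := by
    rw [S.f2 a hψ' c]
    refine (Finset.abs_sum_le_sum_abs _ _).trans ?_
    refine (Finset.sum_le_sum fun i _ => (Finset.abs_sum_le_sum_abs _ _).trans
      (Finset.sum_le_sum fun b _ => h1 i b)).trans ?_
    simp; ring_nf; exact le_rfl
  have h6 : T^2 ≤ (∫ z in ball x t, ed G z) * ∫ z in ball x t, osc U c z := by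
    refine (cs_int (S.memSqrtEd.restrict _) (S.memSqrtOsc c x t)).trans_eq ?_
    simp_rw [Real.sq_sqrt (ed_nonneg G _), Real.sq_sqrt (osc_nonneg U c _)]
  rw [S.cv_lap a hκ ht, mul_pow, ← sq_abs (∫ z, _)]
  calc (t^2)^2 * |∫ z, U a z * lap (fun z => κ (t⁻¹ • (x - z))) z|^2
      ≤ (t^2)^2 * (n * p * (t⁻¹ * M * 2 * T))^2 := by gcongr
    _ = (2 * n * p * M)^2 * t^2 * T^2 := by field_simp
    _ ≤ (2 * n * p * M)^2 * t^2 * ((∫ z in ball x t, ed G z) * ∫ z in ball x t, osc U c z) := by gcongr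
    _ = _ := by ring

end Sys
end

section
open scoped ContDiff Topology Convolution

variable {n p : ℕ}

/-- normalized mollification -/
def ut (φ U : Eu n → ℝ) (t : ℝ) (x : Eu n) : ℝ := (t⁻¹)^n * cv φ U t x

theorem contDiff_ut {φ U : Eu n → ℝ} (hφ : Test (ball 0 1) φ) (hU : LocallyIntegrable U) {t : ℝ}
    (ht : 0 < t) : ContDiff ℝ ∞ (ut φ U t) := contDiff_const.mul (contDiff_cv hφ hU ht)

theorem ut_sub {φ Γ U : Eu n → ℝ} (hφ : Test (ball 0 1) φ) (hΓ : ∀ y, lap Γ y = φ y - 2^n * φ ((2:ℝ) • y))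
    (hU : LocallyIntegrable U) {t : ℝ} (ht : 0 < t) (x : Eu n) :
    ut φ U t x - ut φ U (t/2) x = (t⁻¹)^n * cv (lap Γ) U t x := by
  unfold ut cv
  have e : ((t/2)⁻¹)^n = (t⁻¹)^n * 2^n := by rw [← mul_pow]; congr 1; field_simp
  rw [e, mul_assoc, ← mul_sub, ← integral_const_mul, ← integral_sub]
  · congr 1
    refine integral_congr_ae (ae_of_all _ fun z => ?_)
    simp only
    rw [hΓ, smul_smul, show (t/2)⁻¹ = 2 * t⁻¹ by field_simp]; ring
  · exact (hφ.scl ht x).integrable_mul hU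
  · exact ((hφ.scl (half_pos ht) x).integrable_mul hU).const_mul _

theorem tendsto_dyadic {r : ℝ} (hr : 0 < r) : Tendsto (fun N : ℕ => r / 2^N) atTop (𝓝[>] 0) := by
  refine tendsto_nhdsWithin_iff.2 ⟨?_, Eventually.of_forall fun N => by simp only [mem_Ioi]; positivity⟩
  have h := (tendsto_pow_atTop_nhds_zero_of_lt_one (r := (1/2:ℝ)) (by norm_num) (by norm_num)).const_mul r
  simp only [mul_zero] at h
  refine h.congr fun N => ?_
  rw [div_pow, one_pow]; ring

theorem memLp_indicator_cont {v : Eu n → ℝ} (hv : Continuous v) (x : Eu n) (r : ℝ) :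
    MemLp v 2 (volume.restrict (ball x r)) := by
  obtain ⟨C, hC⟩ := (isCompact_closedBall x r).exists_bound_of_continuousOn hv.continuousOn
  have : IsFiniteMeasure (volume.restrict (ball x r)) := isFiniteMeasure_restrict.2 measure_ball_lt_top.ne
  refine MemLp.of_bound hv.aestronglyMeasurable C ?_
  filter_upwards [ae_restrict_mem measurableSet_ball] with z hz
  exact hC z (ball_subset_closedBall hz)

theorem weak_lsc {φ U v : Eu n → ℝ} (hφ : Test (ball 0 1) φ) (h1 : ∫ y, φ y = 1) (hU : MemLp U 2)
    (hv : Continuous v) {x0 : Eu n} {r X : ℝ} (hr : 0 < r)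
    (hX : ∀ N : ℕ, ∫ x in ball x0 r, (ut φ U (r/2^N) x - v x)^2 ≤ X) :
    ∫ x in ball x0 r, (U x - v x)^2 ≤ X := by
  have hUl : LocallyIntegrable U := hU.locallyIntegrable (by norm_num)
  have hf : MemLp (fun x => U x - v x) 2 (volume.restrict (ball x0 r)) :=
    (hU.restrict _).sub (memLp_indicator_cont hv x0 r)
  set b : Eu n → ℝ := (ball x0 r).indicator (fun x => U x - v x) with hb
  have hbm : MemLp b 2 := (memLp_indicator_iff_restrict measurableSet_ball).2 hf
  have T := (weak_conv hbm hU hφ h1).comp (tendsto_dyadic hr)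
  have eb : ∀ g : Eu n → ℝ, ∫ x, b x * g x = ∫ x in ball x0 r, (U x - v x) * g x := by
    intro g
    rw [← integral_indicator measurableSet_ball]
    congr 1; funext x
    by_cases hx : x ∈ ball x0 r <;> simp [hb, hx]
  have I := hf.integrable_sq
  have hbound : ∀ N : ℕ, (∫ x, b x * ut φ U (r/2^N) x) ≤
      (∫ x in ball x0 r, (U x - v x) * v x) + (X/2 + (1/2) * ∫ x in ball x0 r, (U x - v x)^2) := by
    intro N
    have ht : 0 < r / 2^N := by positivity
    have hw := memLp_indicator_cont (contDiff_ut hφ hUl ht).continuous x0 r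
    have hwv := hw.sub (memLp_indicator_cont hv x0 r)
    rw [eb]
    have i1 : IntegrableOn (fun x => (U x - v x) * v x) (ball x0 r) :=
      MemLp.integrable_mul hf (memLp_indicator_cont hv x0 r)
    have i2 : IntegrableOn (fun x => (ut φ U (r/2^N) x - v x)^2) (ball x0 r) := hwv.integrable_sq
    have i3 : IntegrableOn (fun x => (1/2) * (ut φ U (r/2^N) x - v x)^2 + (1/2) * (U x - v x)^2) (ball x0 r) :=
      (i2.const_mul _).add (I.const_mul _)
    calc ∫ x in ball x0 r, (U x - v x) * ut φ U (r/2^N) x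
        ≤ ∫ x in ball x0 r, ((U x - v x) * v x + ((1/2) * (ut φ U (r/2^N) x - v x)^2 + (1/2) * (U x - v x)^2)) := by
          refine integral_mono (MemLp.integrable_mul hf hw) (i1.add i3) fun x => ?_
          simp only
          nlinarith [sq_nonneg ((ut φ U (r/2^N) x - v x) - (U x - v x))]
      _ = (∫ x in ball x0 r, (U x - v x) * v x) + ((1/2) * (∫ x in ball x0 r, (ut φ U (r/2^N) x - v x)^2)
          + (1/2) * ∫ x in ball x0 r, (U x - v x)^2) := by
          rw [integral_add i1 i3,
            integral_add (i2.const_mul _) (I.const_mul _), integral_const_mul, integral_const_mul]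
      _ ≤ _ := by linarith [hX N]
  have L := le_of_tendsto' T hbound
  have e2 : ∫ x, b x * U x = (∫ x in ball x0 r, (U x - v x)^2) + ∫ x in ball x0 r, (U x - v x) * v x := by
    have i1 : IntegrableOn (fun x => (U x - v x) * v x) (ball x0 r) :=
      MemLp.integrable_mul hf (memLp_indicator_cont hv x0 r)
    rw [eb, ← integral_add I i1]
    congr 1; funext x; ring
  rw [e2] at L
  linarith

theorem cs_sum (d : ℕ → ℝ) (N : ℕ) :
    (∑ k ∈ Finset.range N, d k)^2 ≤ 2 * ∑ k ∈ Finset.range N, 2^k * (d k)^2 := by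
  have h := Finset.sum_sq_le_sum_mul_sum_of_sq_le_mul (Finset.range N) (r := d)
    (f := fun k => (1/2:ℝ)^k) (g := fun k => 2^k * (d k)^2) (fun _ _ => by positivity)
    (fun _ _ => by positivity) (fun k _ => by rw [← mul_assoc, ← mul_pow]; norm_num)
  refine h.trans (mul_le_mul_of_nonneg_right ?_ (Finset.sum_nonneg fun _ _ => by positivity))
  have := geom_sum_eq (x := (1/2:ℝ)) (by norm_num) N
  rw [this]
  have : (0:ℝ) < (1/2)^N := by positivity
  rw [div_le_iff_of_neg (by norm_num)]; linarith

namespace Sys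
variable {y : Eu n} {ρ : ℝ} {U : Fin p → Eu n → ℝ} {G : Fin n → Fin p → Eu n → ℝ}

theorem locU (S : Sys y ρ U G) (a : Fin p) : LocallyIntegrable (U a) :=
  (S.memU a).locallyIntegrable (by norm_num)

theorem memCv (S : Sys y ρ U G) {κ : Eu n → ℝ} (hκ : Test (ball 0 1) κ) {t : ℝ} (ht : 0 < t) (a : Fin p)
    (x : Eu n) (r : ℝ) : IntegrableOn (fun x => (cv κ (U a) t x)^2) (ball x r) :=
  (memLp_indicator_cont (contDiff_cv hκ (S.locU a) ht).continuous x r).integrable_sq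

theorem D12 (S : Sys y ρ U G) (a : Fin p) {κ : Eu n → ℝ} (hκ : Test (ball 0 1) κ) {M : ℝ}
    (hM : ∀ i x, |pd i κ x| ≤ M) {x0 : Eu n} {r t q : ℝ} (ht : 0 < t) (htr : t ≤ r)
    (hb : ball x0 (2 * r) ⊆ ball y ρ)
    (hq : ∀ x ∈ ball x0 r, ∃ c, ∫ z in ball x t, osc U c z ≤ q * t^n) :
    ∫ x in ball x0 r, ((t⁻¹)^n * cv (lap κ) (U a) t x)^2 ≤
      (2 * n * p * M)^2 * q * om n * t^2 * ∫ z in ball x0 (2*r), ed G z := by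
  obtain ⟨hi, hD⟩ := _root_.D2 S.ed_int (ed_nonneg G) x0 r ht
  have hq0 : 0 ≤ q := by
    obtain ⟨c, hc⟩ := hq x0 (mem_ball_self (by linarith))
    have : 0 ≤ q * t^n := (setIntegral_nonneg measurableSet_ball fun z _ => osc_nonneg U c z).trans hc
    exact nonneg_of_mul_nonneg_left this (by positivity)
  have h1 : ∀ x ∈ ball x0 r, ((t⁻¹)^n * cv (lap κ) (U a) t x)^2 ≤
      ((2 * n * p * M)^2 * q * t^2 * (t⁻¹)^n) * ∫ z in ball x t, ed G z := by
    intro x hx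
    obtain ⟨c, hc⟩ := hq x hx
    have hE : 0 ≤ ∫ z in ball x t, ed G z := setIntegral_nonneg measurableSet_ball fun z _ => ed_nonneg G z
    have hxb : ball x t ⊆ ball y ρ := by
      refine Subset.trans (ball_subset_ball' ?_) hb
      rw [mem_ball] at hx; linarith
    have := S.D1 a hκ hM ht hxb c
    rw [mul_pow]
    calc ((t⁻¹)^n)^2 * (cv (lap κ) (U a) t x)^2
        ≤ ((t⁻¹)^n)^2 * ((2 * n * p * M)^2 * t^2 * (∫ z in ball x t, ed G z) * (q * t^n)) := by
          refine mul_le_mul_of_nonneg_left (this.trans ?_) (by positivity)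
          exact mul_le_mul_of_nonneg_left hc (by positivity)
      _ = _ := by
          have : (t⁻¹)^n * t^n = 1 := by rw [← mul_pow, inv_mul_cancel₀ ht.ne', one_pow]
          linear_combination ((2 * n * p * M)^2 * t^2 * (∫ z in ball x t, ed G z) * q * (t⁻¹)^n) * this
  calc ∫ x in ball x0 r, ((t⁻¹)^n * cv (lap κ) (U a) t x)^2
      ≤ ∫ x in ball x0 r, ((2 * n * p * M)^2 * q * t^2 * (t⁻¹)^n) * ∫ z in ball x t, ed G z := by
        refine setIntegral_mono_on ?_ (hi.const_mul _) measurableSet_ball h1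
        simp_rw [mul_pow]
        exact (S.memCv hκ.lap ht a x0 r).const_mul _
    _ = ((2 * n * p * M)^2 * q * t^2 * (t⁻¹)^n) * ∫ x in ball x0 r, ∫ z in ball x t, ed G z := integral_const_mul _ _
    _ ≤ ((2 * n * p * M)^2 * q * t^2 * (t⁻¹)^n) * (t^n * om n * ∫ z in ball x0 (r+t), ed G z) := by gcongr
    _ = (2 * n * p * M)^2 * q * om n * t^2 * ∫ z in ball x0 (r+t), ed G z := by
          have : (t⁻¹)^n * t^n = 1 := by rw [← mul_pow, inv_mul_cancel₀ ht.ne', one_pow]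
          linear_combination ((2 * n * p * M)^2 * t^2 * om n * (∫ z in ball x0 (r+t), ed G z) * q) * this
    _ ≤ _ := by
        have := om_pos (n := n)
        refine mul_le_mul_of_nonneg_left ?_ (by positivity)
        exact setIntegral_mono_set S.ed_int.integrableOn (ae_of_all _ fun z => ed_nonneg G z)
          (Eventually.of_forall (ball_subset_ball (by linarith)))

theorem D3 (hn : 2 ≤ n) (S : Sys y ρ U G) (a : Fin p) {φ Γ : Eu n → ℝ} (hφ : Test (ball 0 1) φ)
    (hΓT : Test (ball 0 1) Γ) (hφ1 : ∫ y, φ y = 1)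
    (hΓ : ∀ y, lap Γ y = φ y - 2^n * φ ((2:ℝ) • y)) {M : ℝ}
    (hM : ∀ i x, |pd i Γ x| ≤ M) {x0 : Eu n} {r q e : ℝ} (hr : 0 < r) (hq0 : 0 ≤ q)
    (hb : ball x0 (2 * r) ⊆ ball y ρ)
    (hq : ∀ x ∈ ball x0 r, ∀ t, 0 < t → t ≤ r → ∃ c, ∫ z in ball x t, osc U c z ≤ q * t^n)
    (he : ∫ z in ball x0 (2*r), ed G z ≤ e * r^(n-2)) :
    ∫ x in ball x0 r, (U a x - ut φ (U a) r x)^2 ≤ 4 * (2 * n * p * M)^2 * om n * q * e * r^n := by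
  have hom := om_pos (n := n)
  refine weak_lsc hφ hφ1 (S.memU a) (contDiff_ut hφ (S.locU a) hr).continuous hr fun N => ?_
  set d : ℕ → Eu n → ℝ := fun k x => ((r/2^k)⁻¹)^n * cv (lap Γ) (U a) (r/2^k) x with hd
  have htel : ∀ x, (ut φ (U a) (r/2^N) x - ut φ (U a) r x)^2 = (∑ k ∈ Finset.range N, d k x)^2 := by
    intro x
    have : ∀ k, d k x = ut φ (U a) (r/2^k) x - ut φ (U a) (r/2^(k+1)) x := by
      intro k
      simp only [hd]
      rw [← ut_sub hφ hΓ (S.locU a) (by positivity)]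
      rw [pow_succ, div_div]
    simp_rw [this]
    rw [Finset.sum_range_sub' (fun k => ut φ (U a) (r/2^k) x)]
    simp only [pow_zero, div_one]; ring
  simp_rw [htel]
  have hE0 : 0 ≤ e * r^(n-2) := le_trans (setIntegral_nonneg measurableSet_ball fun z _ => ed_nonneg G z) he
  have hdi : ∀ k, IntegrableOn (fun x => (d k x)^2) (ball x0 r) := fun k => by
    simp_rw [hd, mul_pow]
    have h0 : 0 < r / 2^k := by positivity
    exact (S.memCv hΓT.lap h0 a x0 r).const_mul _
  have hdk : ∀ k, ∫ x in ball x0 r, (d k x)^2 ≤ (2 * n * p * M)^2 * q * om n * (r/2^k)^2 * (e * r^(n-2)) := by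
    intro k
    have htr : r/2^k ≤ r := div_le_self hr.le (one_le_pow₀ (by norm_num))
    refine (S.D12 a hΓT hM (by positivity) htr hb fun x hx => hq x hx _ (by positivity) htr).trans ?_
    gcongr
  have hrn : r^2 * r^(n-2) = r^n := by rw [← pow_add]; congr 1; omega
  calc ∫ x in ball x0 r, (∑ k ∈ Finset.range N, d k x)^2
      ≤ ∫ x in ball x0 r, 2 * ∑ k ∈ Finset.range N, 2^k * (d k x)^2 := by
        refine integral_mono_of_nonneg (ae_of_all _ fun x => sq_nonneg _) ?_ (ae_of_all _ fun x => cs_sum (fun k => d k x) N)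
        exact (integrable_finsetSum _ fun k _ => (hdi k).const_mul _).const_mul _
    _ = 2 * ∑ k ∈ Finset.range N, 2^k * ∫ x in ball x0 r, (d k x)^2 := by
        rw [integral_const_mul, integral_finsetSum _ fun k _ => (hdi k).const_mul _]
        simp_rw [integral_const_mul]
    _ ≤ 2 * ∑ k ∈ Finset.range N, (1/2)^k * ((2 * n * p * M)^2 * q * om n * e * r^n) := by
        refine mul_le_mul_of_nonneg_left (Finset.sum_le_sum fun k _ => ?_) (by norm_num)
        have h2 : (0:ℝ) ≤ 2^k := by positivity
        refine (mul_le_mul_of_nonneg_left (hdk k) h2).trans_eq ?_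
        rw [← hrn, div_pow, one_div, inv_pow]
        field_simp
    _ ≤ 2 * (2 * ((2 * n * p * M)^2 * q * om n * e * r^n)) := by
        rw [← Finset.sum_mul]
        have e0 : 0 ≤ e := nonneg_of_mul_nonneg_left hE0 (by positivity)
        gcongr
        rw [geom_sum_eq (x := (1/2:ℝ)) (by norm_num) N]
        have : (0:ℝ) < (1/2)^N := by positivity
        rw [div_le_iff_of_neg (by norm_num)]; linarith
    _ = _ := by ring

theorem D4a (S : Sys y ρ U G) (a : Fin p) {φ : Eu n → ℝ} (hφ : Test (ball 0 1) φ) {M : ℝ}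
    (hM : ∀ i x, |pd i φ x| ≤ M) {x : Eu n} {r q : ℝ} (hr : 0 < r) {c : Fin p → ℝ}
    (hq : ∫ z in ball x r, osc U c z ≤ q * r^n) (j : Fin n) :
    |pd j (ut φ (U a) r) x| ≤ M * Real.sqrt (om n * q) * r⁻¹ := by
  have hom := om_pos (n := n)
  have hM0 : 0 ≤ M := (abs_nonneg _).trans (hM j 0)
  have e1 : cv (pd j φ) (U a) r x = cv (pd j φ) (fun z => U a z - c a) r x := by
    unfold cv
    have h0 : ∫ z, pd j φ (r⁻¹ • (x - z)) = 0 := by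
      have := integral_pd_eq_zero (hφ.scl hr x) j
      rw [pd_scl hφ.1, integral_const_mul] at this
      simpa [hr.ne'] using this
    have i1 := ((hφ.pd j).scl hr x).integrable_mul (S.locU a)
    have i2 : Integrable fun z => pd j φ (r⁻¹ • (x - z)) :=
      ((hφ.pd j).scl hr x).continuous.integrable_of_hasCompactSupport ((hφ.pd j).scl hr x).2
    simp_rw [mul_sub]
    rw [integral_sub i1 (i2.mul_const _), integral_mul_const, h0]; ring
  have h2 : |cv (pd j φ) (U a) r x| ≤ M * ∫ z in ball x r, |U a z - c a| := by
    rw [e1]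
    have : IsFiniteMeasure (volume.restrict (ball x r)) := isFiniteMeasure_restrict.2 measure_ball_lt_top.ne
    exact cv_bound (hφ.pd j) (hM j) hr x ((S.memUc a (c a) x r).integrable (by norm_num))
  have h3 : (∫ z in ball x r, |U a z - c a|)^2 ≤ (q * r^n) * (r^n * om n) := by
    have : IsFiniteMeasure (volume.restrict (ball x r)) := isFiniteMeasure_restrict.2 measure_ball_lt_top.ne
    have := cs_int (S.memUc a (c a) x r).norm (memLp_const (1:ℝ) (μ := volume.restrict (ball x r)))
    simp only [mul_one, one_pow, integral_const, smul_eq_mul, Real.norm_eq_abs, sq_abs] at this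
    rw [measureReal_restrict_apply_univ, vol_ball x hr] at this
    refine this.trans (mul_le_mul_of_nonneg_right (le_trans ?_ hq) (by positivity))
    refine integral_mono (S.memUc a (c a) x r).integrable_sq (S.osc_int c x r) fun z => ?_
    exact Finset.single_le_sum (f := fun b => (U b z - c b)^2) (fun _ _ => sq_nonneg _) (Finset.mem_univ a)
  have h4 : ∫ z in ball x r, |U a z - c a| ≤ Real.sqrt (om n * q) * r^n := by
    refine (Real.le_sqrt_of_sq_le h3).trans_eq ?_
    rw [show q * r^n * (r^n * om n) = (om n * q) * (r^n)^2 by ring, Real.sqrt_mul' _ (by positivity),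
      Real.sqrt_sq (by positivity)]
  have e2 : pd j (ut φ (U a) r) x = (r⁻¹)^n * (r⁻¹ * cv (pd j φ) (U a) r x) := by
    unfold ut
    rw [pd_const_mul _ _ ((contDiff_cv hφ (S.locU a) hr).differentiable (by simp) _),
      pd_cv hφ (S.locU a) hr]
  rw [e2, abs_mul, abs_mul, abs_of_pos (by positivity : 0 < (r⁻¹)^n), abs_of_pos (inv_pos.2 hr)]
  calc (r⁻¹)^n * (r⁻¹ * |cv (pd j φ) (U a) r x|) ≤ (r⁻¹)^n * (r⁻¹ * (M * (Real.sqrt (om n * q) * r^n))) := by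
        gcongr; exact h2.trans (by gcongr)
    _ = _ := by
        have : (r⁻¹)^n * r^n = 1 := by rw [← mul_pow, inv_mul_cancel₀ hr.ne', one_pow]
        linear_combination (r⁻¹ * M * Real.sqrt (om n * q)) * this

theorem D4 (S : Sys y ρ U G) (a : Fin p) {φ : Eu n → ℝ} (hφ : Test (ball 0 1) φ) {M : ℝ}
    (hM : ∀ i x, |pd i φ x| ≤ M) {x0 : Eu n} {r q θ : ℝ} (hr : 0 < r) (hq0 : 0 ≤ q)
    (hθ : 0 < θ) (hθ1 : θ ≤ 1)
    (hq : ∀ x ∈ ball x0 r, ∃ c, ∫ z in ball x r, osc U c z ≤ q * r^n) {x : Eu n} (hx : x ∈ ball x0 (θ * r)) :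
    (ut φ (U a) r x - ut φ (U a) r x0)^2 ≤ n^2 * M^2 * om n * q * θ^2 := by
  have hom := om_pos (n := n)
  have hM0 : 0 ≤ M := (abs_nonneg _).trans (hM ⟨0, S.hn⟩ 0)
  have hD : ∀ x ∈ ball x0 (θ * r), ‖fderiv ℝ (ut φ (U a) r) x‖ ≤ n * (M * Real.sqrt (om n * q) * r⁻¹) := by
    intro x hx
    have hx' : x ∈ ball x0 r := ball_subset_ball (by nlinarith) hx
    obtain ⟨c, hc⟩ := hq x hx'
    refine (norm_fderiv_le_sum_pd _ _).trans ?_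
    refine (Finset.sum_le_sum fun j _ => S.D4a a hφ hM hr hc j).trans_eq ?_
    simp
  have h := (convex_ball x0 (θ * r)).norm_image_sub_le_of_norm_fderiv_le
    (fun x _ => (contDiff_ut hφ (S.locU a) hr).differentiable (by simp) x) hD
    (mem_ball_self (by positivity)) hx
  rw [Real.norm_eq_abs] at h
  rw [← sq_abs]
  have h2 : ‖x - x0‖ ≤ θ * r := by rw [← dist_eq_norm]; exact (mem_ball.1 hx).le
  calc |ut φ (U a) r x - ut φ (U a) r x0|^2 ≤ (n * (M * Real.sqrt (om n * q) * r⁻¹) * (θ * r))^2 := by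
        refine pow_le_pow_left₀ (abs_nonneg _) (h.trans ?_) 2
        gcongr
    _ = n^2 * M^2 * (Real.sqrt (om n * q))^2 * θ^2 := by field_simp
    _ = _ := by rw [Real.sq_sqrt (by positivity)]; ring

end Sys

theorem decay_step (n p : ℕ) (hn : 2 ≤ n) : ∃ C : ℝ, 0 < C ∧ ∀ (y : Eu n) (ρ : ℝ) (U : Fin p → Eu n → ℝ)
    (G : Fin n → Fin p → Eu n → ℝ), Sys y ρ U G → ∀ (x0 : Eu n) (r q e : ℝ), 0 < r → 0 ≤ q →
    ball x0 (2 * r) ⊆ ball y ρ →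
    (∀ x ∈ ball x0 r, ∀ t, 0 < t → t ≤ r → ∃ c, ∫ z in ball x t, osc U c z ≤ q * t^n) →
    (∫ z in ball x0 (2*r), ed G z ≤ e * r^(n-2)) →
    ∀ θ, 0 < θ → θ ≤ 1 → ∃ c, ∫ z in ball x0 (θ * r), osc U c z ≤ C * q * (e + θ^(n+2)) * r^n := by
  obtain ⟨φ, Γ, hφ, hΓT, hφ1, hΓ⟩ := exists_kernel n (by omega)
  have hbd : ∀ κ : Eu n → ℝ, Test (ball 0 1) κ → ∃ M : ℝ, 0 ≤ M ∧ ∀ i x, |pd i κ x| ≤ M := by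
    intro κ hκ
    choose M hM0 hM using fun i => (hκ.pd i).bdd
    refine ⟨∑ i, M i, Finset.sum_nonneg fun i _ => (hM0 i).le, fun i x => (hM i x).trans ?_⟩
    exact Finset.single_le_sum (fun i _ => (hM0 i).le) (Finset.mem_univ i)
  obtain ⟨M1, hM10, hM1⟩ := hbd φ hφ
  obtain ⟨M2, hM20, hM2⟩ := hbd Γ hΓT
  have hom := om_pos (n := n)
  refine ⟨p * (8 * (2 * n * p * M2)^2 * om n) + p * (2 * (n^2 * M1^2 * om n) * om n) + 1, by positivity, ?_⟩
  intro y ρ U G S x0 r q e hr hq0 hb hq he θ hθ hθ1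
  refine ⟨fun a => ut φ (U a) r x0, ?_⟩
  have he0 : 0 ≤ e := by
    have := (setIntegral_nonneg measurableSet_ball fun z _ => ed_nonneg G z).trans he
    exact nonneg_of_mul_nonneg_left this (by positivity)
  have hsub : ball x0 (θ * r) ⊆ ball x0 r := ball_subset_ball (by nlinarith)
  have key : ∀ a, ∫ z in ball x0 (θ * r), (U a z - ut φ (U a) r x0)^2 ≤
      8 * (2 * n * p * M2)^2 * om n * q * e * r^n + 2 * (n^2 * M1^2 * om n * q * θ^2) * ((θ * r)^n * om n) := by
    intro a
    have hcont := (contDiff_ut hφ (S.locU a) hr).continuous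
    have i1 : IntegrableOn (fun z => (U a z - ut φ (U a) r z)^2) (ball x0 r) :=
      (((S.memU a).restrict _).sub (memLp_indicator_cont hcont x0 r)).integrable_sq
    have i2 : IntegrableOn (fun z : Eu n => 2 * (n^2 * M1^2 * om n * q * θ^2)) (ball x0 (θ*r)) :=
      integrableOn_const measure_ball_lt_top.ne
    calc ∫ z in ball x0 (θ * r), (U a z - ut φ (U a) r x0)^2
        ≤ ∫ z in ball x0 (θ * r), (2 * (U a z - ut φ (U a) r z)^2 + 2 * (n^2 * M1^2 * om n * q * θ^2)) := by
          refine setIntegral_mono_on (S.memUc a _ x0 _).integrable_sq (((i1.mono_set hsub).const_mul 2).add i2)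
            measurableSet_ball fun z hz => ?_
          have := S.D4 a hφ hM1 hr hq0 hθ hθ1 (fun x hx => hq x hx r hr le_rfl) hz
          nlinarith [sq_nonneg ((U a z - ut φ (U a) r z) - (ut φ (U a) r z - ut φ (U a) r x0))]
      _ = 2 * (∫ z in ball x0 (θ * r), (U a z - ut φ (U a) r z)^2) +
            2 * (n^2 * M1^2 * om n * q * θ^2) * ((θ * r)^n * om n) := by
          rw [integral_add ((i1.mono_set hsub).const_mul 2) i2, integral_const_mul, setIntegral_const,
            vol_ball _ (by positivity), smul_eq_mul, mul_comm ((θ * r)^n * om n)]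
      _ ≤ 2 * (4 * (2 * n * p * M2)^2 * om n * q * e * r^n) +
            2 * (n^2 * M1^2 * om n * q * θ^2) * ((θ * r)^n * om n) := by
          gcongr
          exact (setIntegral_mono_set i1 (ae_of_all _ fun z => sq_nonneg _) (Eventually.of_forall hsub)).trans
            (S.D3 hn a hφ hΓT hφ1 hΓ hM2 hr hq0 hb hq he)
      _ = _ := by ring
  unfold osc
  rw [integral_finsetSum _ fun a _ => (S.memUc a _ x0 _).integrable_sq]
  refine (Finset.sum_le_sum fun a _ => key a).trans ?_
  simp only [Finset.sum_const, Finset.card_univ, Fintype.card_fin, nsmul_eq_mul]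
  have : 0 ≤ q * r^n := by positivity
  set A := (p:ℝ) * (8 * (2 * n * p * M2)^2 * om n)
  set B := (p:ℝ) * (2 * (n^2 * M1^2 * om n) * om n)
  have hA : 0 ≤ A := by positivity
  have hB : 0 ≤ B := by positivity
  calc (p:ℝ) * (8 * (2 * n * p * M2)^2 * om n * q * e * r^n + 2 * (n^2 * M1^2 * om n * q * θ^2) * ((θ * r)^n * om n))
      = (A * e + B * θ^(n+2)) * (q * r^n) := by rw [mul_pow, pow_add]; ring
    _ ≤ ((A + B + 1) * (e + θ^(n+2))) * (q * r^n) := by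
        refine mul_le_mul_of_nonneg_right ?_ this
        have : 0 ≤ θ^(n+2) := by positivity
        nlinarith [mul_nonneg hA this, mul_nonneg hB he0]
    _ = _ := by ring
end

section
open scoped ContDiff Topology Convolution

variable {n p : ℕ}

theorem decay (n p : ℕ) (hn : 2 ≤ n) : ∃ e0 : ℝ, 0 < e0 ∧ ∀ (y : Eu n) (ρ : ℝ) (U : Fin p → Eu n → ℝ)
    (G : Fin n → Fin p → Eu n → ℝ), 0 < ρ → Sys y ρ U G →
    (∀ x ∈ ball y (ρ/2), ∀ s, 0 < s → s ≤ ρ/2 → ∫ z in ball x s, ed G z ≤ e0 * s^(n-2)) →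
    ∃ C : ℝ, 0 ≤ C ∧ ∀ x ∈ ball y (ρ/4), ∀ j : ℕ, ∃ c, ∫ z in ball x (ρ/8/2^j), osc U c z ≤
      C * (ρ/8/2^j)^n * (9/25)^j := by
  obtain ⟨C, hC, H⟩ := decay_step n p hn
  obtain ⟨m, hm⟩ := exists_pow_lt_of_lt_one (x := 1/(2*C)) (y := (25/36:ℝ)) (by positivity) (by norm_num)
  have hom := om_pos (n := n)
  -- θ = (1/2)^(m+1), μ = (9/25)^(m+1)
  set θ : ℝ := (1/2)^(m+1) with hθ
  set μ : ℝ := (9/25)^(m+1) with hμ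
  have hθ0 : 0 < θ := by positivity
  have hθ1 : θ ≤ 1/2 := by
    rw [hθ, pow_succ]; have : (1/2:ℝ)^m ≤ 1 := pow_le_one₀ (by norm_num) (by norm_num)
    linarith
  have hμ0 : 0 < μ := by positivity
  have hCθ : C * θ^2 ≤ μ/2 := by
    have h1 : θ^2 = μ * (25/36)^(m+1) := by
      rw [hθ, hμ, ← mul_pow, ← pow_mul, mul_comm (m+1) 2, pow_mul]; norm_num
    have h2 : (25/36:ℝ)^(m+1) ≤ 1/(2*C) := by
      refine le_trans ?_ hm.le
      exact pow_le_pow_of_le_one (by norm_num) (by norm_num) (Nat.le_succ m)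
    rw [h1]
    calc C * (μ * (25/36)^(m+1)) ≤ C * (μ * (1/(2*C))) := by gcongr
      _ = μ/2 := by field_simp
  set e : ℝ := μ * θ^n / (2*C) with he
  have he0 : 0 < e := by positivity
  refine ⟨e / 2^(n-2), by positivity, ?_⟩
  intro y ρ U G hρ S hE
  have P : ∀ k : ℕ, ∀ x ∈ ball y (ρ/4 + ρ/4 * θ^k), ∀ s, 0 < s → s ≤ ρ/8 * θ^k →
      ∃ c, ∫ z in ball x s, osc U c z ≤ (om n * μ^k) * s^n := by
    intro k
    induction k with
    | zero =>
      intro x hx s hs hs1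
      simp only [pow_zero, mul_one] at hx hs1 ⊢
      refine ⟨0, le_of_eq ?_⟩
      have hsub : ball x s ⊆ ball y ρ := ball_subset_ball' (by rw [mem_ball] at hx; linarith)
      have : ∫ z in ball x s, osc U 0 z = ∫ z in ball x s, (1:ℝ) := by
        refine setIntegral_congr_ae measurableSet_ball ?_
        filter_upwards [S.sph] with z hz hzb
        simpa [osc] using hz (hsub hzb)
      rw [this, setIntegral_const, vol_ball x hs, smul_eq_mul]; ring
    | succ k ih =>
      intro x0 hx0 s hs hs1
      have hk0 : 0 < θ^k := by positivity
      have hk1 : θ^k ≤ 1 := pow_le_one₀ hθ0.le (by linarith)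
      have hkk : θ^(k+1) ≤ θ^k/2 := by rw [pow_succ]; nlinarith
      have hr : 0 < s/θ := by positivity
      have hr1 : s/θ ≤ ρ/8 * θ^k := by rw [div_le_iff₀ hθ0]; rw [pow_succ] at hs1; linarith
      have hr2 : s/θ ≤ ρ/8 := by nlinarith
      rw [mem_ball] at hx0
      have hR : ρ/4 * θ^(k+1) ≤ ρ/4 * θ^k - ρ/8 * θ^k := by nlinarith
      have hR1 : ρ/4 * θ^(k+1) ≤ ρ/4 := by nlinarith
      obtain ⟨c, hc⟩ := H y ρ U G S x0 (s/θ) (om n * μ^k) e hr (by positivity)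
        (ball_subset_ball' (by linarith))
        (fun x hx t ht ht1 => ih x (by
          rw [mem_ball] at hx ⊢
          have := dist_triangle x x0 y
          linarith) t ht (ht1.trans hr1))
        (by
          refine (hE x0 (by rw [mem_ball]; linarith) (2 * (s/θ)) (by positivity) (by linarith)).trans_eq ?_
          rw [mul_pow]; field_simp) θ hθ0 (by linarith)
      refine ⟨c, ?_⟩
      rw [mul_div_cancel₀ s hθ0.ne'] at hc
      refine hc.trans ?_
      have e1 : C * (om n * μ^k) * (e + θ^(n+2)) * (s/θ)^n = (om n * μ^k * s^n) * (C * e / θ^n + C * θ^2) := by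
        rw [div_pow, pow_add]; field_simp
      have e2 : C * e / θ^n = μ/2 := by rw [he]; field_simp
      rw [e1, e2]
      calc (om n * μ^k * s^n) * (μ/2 + C * θ^2) ≤ (om n * μ^k * s^n) * (μ/2 + μ/2) := by gcongr
        _ = _ := by rw [pow_succ]; ring
  refine ⟨om n * (25/9)^(m+1), by positivity, fun x hx j => ?_⟩
  have hk0 : 0 < θ^(j/(m+1)) := by positivity
  obtain ⟨c, hc⟩ := P (j/(m+1)) x (ball_subset_ball (by nlinarith) hx) (ρ/8/2^j) (by positivity) (by
    rw [div_eq_mul_inv (ρ/8)]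
    refine mul_le_mul_of_nonneg_left ?_ (by positivity)
    rw [hθ, ← pow_mul, ← inv_pow, ← one_div]
    exact pow_le_pow_of_le_one (by norm_num) (by norm_num) (Nat.mul_div_le j (m+1)))
  refine ⟨c, hc.trans ?_⟩
  have : μ^(j/(m+1)) ≤ (25/9)^(m+1) * (9/25)^j := by
    rw [hμ, ← pow_mul]
    calc (9/25:ℝ)^((m+1)*(j/(m+1))) = (25/9)^(m+1) * (9/25)^((m+1)*(j/(m+1)) + (m+1)) := by
          rw [pow_add (9/25:ℝ) _ (m+1), mul_left_comm, ← mul_pow]; norm_num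
      _ ≤ _ := by
          refine mul_le_mul_of_nonneg_left (pow_le_pow_of_le_one (by norm_num) (by norm_num) ?_) (by positivity)
          have := Nat.lt_mul_div_succ j (Nat.succ_pos m)
          simp only [Nat.succ_eq_add_one, mul_add, mul_one] at this
          omega
  calc om n * μ^(j/(m+1)) * (ρ/8/2^j)^n ≤ om n * ((25/9)^(m+1) * (9/25)^j) * (ρ/8/2^j)^n := by gcongr
    _ = _ := by ring
end

section
open scoped ContDiff Topology Convolution

variable {n p : ℕ}

/-- bounded, dyadic Hölder -/
def Hol (a : ℝ) (O : Set (Eu n)) (f : Eu n → ℝ) : Prop :=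
  ∃ C : ℝ, 0 ≤ C ∧ (∀ x ∈ O, |f x| ≤ C) ∧
    ∀ k : ℕ, ∀ x ∈ O, ∀ z ∈ O, ‖x - z‖ ≤ (1/2)^k → |f x - f z| ≤ C * a^k

def HC (a : ℝ) (O : Set (Eu n)) : ℕ → (Eu n → ℝ) → Prop
  | 0, f => Hol a O f
  | m+1, f => Hol a O f ∧ (∀ x ∈ O, DifferentiableAt ℝ f x) ∧ ∀ i, HC a O m (pd i f)

def F0 (a : ℝ) (O : Set (Eu n)) (v : ℕ → Eu n → ℝ) : Prop :=
  ∃ C : ℝ, 0 ≤ C ∧ ∀ k, ∀ x ∈ O, |v k x - v (k+1) x| ≤ C * a^k ∧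
    ∀ i, |pd i (v k) x - pd i (v (k+1)) x| ≤ C * (2*a)^k

def Fast (a : ℝ) (O : Set (Eu n)) : ℕ → (ℕ → Eu n → ℝ) → Prop
  | 0, v => F0 a O v
  | m+1, v => F0 a O v ∧ ∀ i, Fast a O m (fun k => pd i (v k))

theorem bdd_on_ball {f : Eu n → ℝ} (hf : Continuous f) (y : Eu n) (R : ℝ) :
    ∃ M : ℝ, 0 ≤ M ∧ ∀ x ∈ ball y R, |f x| ≤ M := by
  obtain ⟨C, hC⟩ := (isCompact_closedBall y R).exists_bound_of_continuousOn hf.continuousOn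
  exact ⟨max C 0, le_max_right _ _, fun x hx => (hC x (ball_subset_closedBall hx)).trans (le_max_left _ _)⟩

theorem seqHol {a : ℝ} (ha : 1/2 < a) (ha1 : a < 1) {y : Eu n} {R : ℝ} {v : ℕ → Eu n → ℝ}
    (hv : ∀ k, ContDiff ℝ ∞ (v k)) (h : F0 a (ball y R) v) :
    ∃ w, Hol a (ball y R) w ∧ ∃ C, ∀ k, ∀ x ∈ ball y R, |v k x - w x| ≤ C * a^k := by
  obtain ⟨C, hC0, hC⟩ := h
  have ha0 : 0 < a := by linarith
  have hlim : ∀ x ∈ ball y R, ∃ l, Tendsto (fun k => v k x) atTop (𝓝 l) := fun x hx =>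
    cauchySeq_tendsto_of_complete
      (cauchySeq_of_le_geometric a C ha1 fun k => by rw [Real.dist_eq]; exact (hC k x hx).1)
  choose! w hw using hlim
  have hd : ∀ k, ∀ x ∈ ball y R, |v k x - w x| ≤ C / (1-a) * a^k := by
    intro k x hx
    have := dist_le_of_le_geometric_of_tendsto a C ha1
      (fun k => by rw [Real.dist_eq]; exact (hC k x hx).1) (hw x hx) k
    rw [Real.dist_eq] at this
    rw [div_mul_eq_mul_div]; exact this
  have hC' : 0 ≤ C/(1-a) := div_nonneg hC0 (by linarith)
  obtain ⟨M, hM0, hM⟩ := bdd_on_ball (hv 0).continuous y R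
  choose N hN0 hN using fun i => bdd_on_ball (contDiff_pd (hv 0) i).continuous y R
  set C1 := (∑ i, N i) + C / (2*a-1) with hC1
  have h2a : 0 < 2*a - 1 := by linarith
  have hC10 : 0 ≤ C1 := add_nonneg (Finset.sum_nonneg fun i _ => hN0 i) (by positivity)
  have hg : ∀ k, ∀ x ∈ ball y R, ∀ i, |pd i (v k) x| ≤ C1 * (2*a)^k := by
    intro k x hx i
    induction k with
    | zero =>
      have := Finset.single_le_sum (fun i _ => hN0 i) (Finset.mem_univ i)
      have h3 : 0 ≤ C / (2*a-1) := by positivity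
      simp only [pow_zero, mul_one]
      linarith [hN i x hx]
    | succ k ih =>
      have h1 := (hC k x hx).2 i
      have h2 : C ≤ C1 * (2*a-1) := by
        rw [hC1, add_mul, div_mul_cancel₀ _ h2a.ne']
        have := mul_nonneg (Finset.sum_nonneg fun i (_ : i ∈ Finset.univ) => hN0 i) h2a.le
        linarith
      have h3 : |pd i (v (k+1)) x| ≤ |pd i (v k) x| + |pd i (v k) x - pd i (v (k+1)) x| := by
        have := abs_sub (pd i (v k) x) (pd i (v k) x - pd i (v (k+1)) x)
        rwa [sub_sub_cancel] at this
      have h4 : 0 < (2*a)^k := by positivity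
      rw [pow_succ]
      nlinarith
  refine ⟨w, ⟨M + 2 * (C/(1-a)) + n * C1, by positivity, ?_, ?_⟩, _, hd⟩
  · intro x hx
    have h1 := hd 0 x hx
    simp only [pow_zero, mul_one] at h1
    have h2 : |w x| ≤ |v 0 x| + |v 0 x - w x| := by
      have := abs_sub (v 0 x) (v 0 x - w x)
      rwa [sub_sub_cancel] at this
    have : 0 ≤ (n:ℝ) * C1 := by positivity
    linarith [hM x hx]
  · intro k x hx z hz hxz
    have h1 := hd k x hx
    have h2 := hd k z hz
    have h3 := (convex_ball y R).norm_image_sub_le_of_norm_fderiv_le (f := v k) (C := n * (C1 * (2*a)^k))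
      (fun x _ => (hv k).differentiable (by simp) x) (fun x hx => by
        refine (norm_fderiv_le_sum_pd _ _).trans ((Finset.sum_le_sum fun i _ => hg k x hx i).trans_eq ?_)
        simp) hz hx
    have h4 : (n:ℝ) * (C1 * (2*a)^k) * ‖x - z‖ ≤ n * C1 * a^k := by
      calc (n:ℝ) * (C1 * (2*a)^k) * ‖x - z‖ ≤ n * (C1 * (2*a)^k) * (1/2)^k := by gcongr
        _ = n * C1 * ((2*a) * (1/2))^k := by rw [mul_pow (2*a)]; ring
        _ = _ := by congr 2; ring
    rw [Real.norm_eq_abs] at h3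
    have h5 : w x - w z = (v k x - v k z) - (v k x - w x) + (v k z - w z) := by ring
    rw [h5]
    refine (abs_add_le _ _).trans ?_
    have h6 := abs_sub (v k x - v k z) (v k x - w x)
    have : 0 ≤ M * a^k := by positivity
    have e : (M + 2 * (C/(1-a)) + n * C1) * a^k = M * a^k + C/(1-a)*a^k + C/(1-a)*a^k + n*C1*a^k := by ring
    rw [e]
    linarith

theorem Hol.congr {a : ℝ} {O : Set (Eu n)} {f g : Eu n → ℝ} (h : Hol a O f) (e : ∀ x ∈ O, f x = g x) :
    Hol a O g := by
  obtain ⟨C, h0, h1, h2⟩ := h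
  refine ⟨C, h0, fun x hx => e x hx ▸ h1 x hx, fun k x hx z hz hxz => ?_⟩
  rw [← e x hx, ← e z hz]; exact h2 k x hx z hz hxz

theorem sum_proj_apply (c : Fin n → ℝ) (w : Eu n) :
    (∑ i, c i • (EuclideanSpace.proj i : Eu n →L[ℝ] ℝ)) w = ∑ i, c i * w i := by
  simp

theorem fderiv_eq_proj (f : Eu n → ℝ) (x : Eu n) :
    fderiv ℝ f x = ∑ i, pd i f x • (EuclideanSpace.proj i : Eu n →L[ℝ] ℝ) := by
  ext w
  rw [sum_proj_apply, fderiv_eq_sum_pd]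
  try exact Finset.sum_congr rfl fun i _ => mul_comm _ _

theorem norm_proj_le (i : Fin n) : ‖(EuclideanSpace.proj i : Eu n →L[ℝ] ℝ)‖ ≤ 1 :=
  ContinuousLinearMap.opNorm_le_bound _ zero_le_one fun w => by
    rw [one_mul]; exact PiLp.norm_apply_le w i

theorem fast_HC {a : ℝ} (ha : 1/2 < a) (ha1 : a < 1) {y : Eu n} {R : ℝ} (m : ℕ) :
    ∀ v : ℕ → Eu n → ℝ, (∀ k, ContDiff ℝ ∞ (v k)) → Fast a (ball y R) m v →
    ∀ w : Eu n → ℝ, (∀ x ∈ ball y R, Tendsto (fun k => v k x) atTop (𝓝 (w x))) → HC a (ball y R) m w := by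
  have hT : ∀ C : ℝ, Tendsto (fun k : ℕ => C * a^k) atTop (𝓝 0) := fun C => by
    simpa using (tendsto_pow_atTop_nhds_zero_of_lt_one (by linarith) ha1).const_mul C
  have hlim : ∀ v : ℕ → Eu n → ℝ, ∀ w : Eu n → ℝ, (∃ C, ∀ k, ∀ x ∈ ball y R, |v k x - w x| ≤ C * a^k) →
      ∀ x ∈ ball y R, Tendsto (fun k => v k x) atTop (𝓝 (w x)) := by
    rintro v w ⟨C, hC⟩ x hx
    rw [tendsto_iff_dist_tendsto_zero]
    exact squeeze_zero (fun _ => dist_nonneg) (fun k => by rw [Real.dist_eq]; exact hC k x hx) (hT C)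
  have h0 : ∀ v : ℕ → Eu n → ℝ, (∀ k, ContDiff ℝ ∞ (v k)) → F0 a (ball y R) v →
    ∀ w : Eu n → ℝ, (∀ x ∈ ball y R, Tendsto (fun k => v k x) atTop (𝓝 (w x))) → Hol a (ball y R) w := by
    intro v hv h w hw
    obtain ⟨w', hH, hC⟩ := seqHol ha ha1 hv h
    exact hH.congr fun x hx => tendsto_nhds_unique (hlim v w' hC x hx) (hw x hx)
  induction m with
  | zero => exact h0
  | succ m ih =>
    rintro v hv ⟨hF, hFi⟩ w hw
    have hF0 : ∀ i, F0 a (ball y R) (fun k => pd i (v k)) := fun i => by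
      have := hFi i
      cases m with
      | zero => exact this
      | succ m => exact this.1
    choose wi hH hC using fun i => seqHol ha ha1 (fun k => contDiff_pd (hv k) i) (hF0 i)
    have hdiff : ∀ x ∈ ball y R, HasFDerivAt w (∑ i, wi i x • (EuclideanSpace.proj i : Eu n →L[ℝ] ℝ)) x := by
      intro x hx
      refine hasFDerivAt_of_tendstoUniformlyOn (f := fun k => v k) (f' := fun k x => fderiv ℝ (v k) x)
        (g' := fun x => ∑ i, wi i x • (EuclideanSpace.proj i : Eu n →L[ℝ] ℝ)) (l := atTop) isOpen_ball ?_
        (fun k x _ => ((hv k).differentiable (by simp) x).hasFDerivAt) (fun x hx => hw x hx) hx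
      choose C hC' using hC
      rw [Metric.tendstoUniformlyOn_iff]
      intro ε hε
      have hT' := hT (∑ i, C i)
      filter_upwards [hT'.eventually_lt_const hε] with k hk z hz
      rw [dist_comm, dist_eq_norm, fderiv_eq_proj, ← Finset.sum_sub_distrib]
      refine lt_of_le_of_lt ?_ hk
      rw [Finset.sum_mul]
      refine norm_sum_le_of_le _ fun i _ => ?_
      rw [← sub_smul, norm_smul]
      have := hC' i k z hz
      calc _ ≤ ‖pd i (v k) z - wi i z‖ * 1 := by gcongr; exact norm_proj_le i
        _ ≤ _ := by rw [mul_one]; exact this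
    refine ⟨h0 v hv hF w hw, fun x hx => (hdiff x hx).differentiableAt, fun i => ?_⟩
    refine ih _ (fun k => contDiff_pd (hv k) i) (hFi i) _ fun x hx => ?_
    have : pd i w x = wi i x := by
      unfold pd
      rw [(hdiff x hx).fderiv, sum_proj_apply]
      simp
    rw [this]
    exact hlim _ _ (hC i) x hx

theorem HC.hol {a : ℝ} {O : Set (Eu n)} {m : ℕ} {f : Eu n → ℝ} (h : HC a O m f) : Hol a O f := by
  cases m with
  | zero => exact h
  | succ m => exact h.1

theorem HC.pred {a : ℝ} {O : Set (Eu n)} {m : ℕ} : ∀ {f : Eu n → ℝ}, HC a O (m+1) f → HC a O m f := by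
  induction m with
  | zero => exact fun h => h.1
  | succ m ih => exact fun h => ⟨h.1, h.2.1, fun i => ih (h.2.2 i)⟩

theorem Hol.mono {a : ℝ} {O O' : Set (Eu n)} (hO : O' ⊆ O) {f : Eu n → ℝ} (h : Hol a O f) : Hol a O' f := by
  obtain ⟨C, h0, h1, h2⟩ := h
  exact ⟨C, h0, fun x hx => h1 x (hO hx), fun k x hx z hz => h2 k x (hO hx) z (hO hz)⟩

theorem HC.mono {a : ℝ} {O O' : Set (Eu n)} (hO : O' ⊆ O) {m : ℕ} : ∀ {f : Eu n → ℝ}, HC a O m f → HC a O' m f := by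
  induction m with
  | zero => exact fun h => Hol.mono hO h
  | succ m ih => exact fun h => ⟨h.1.mono hO, fun x hx => h.2.1 x (hO hx), fun i => ih (h.2.2 i)⟩

theorem eqOn_nhds {O : Set (Eu n)} (hO : IsOpen O) {f g : Eu n → ℝ} (e : ∀ x ∈ O, f x = g x) {x : Eu n}
    (hx : x ∈ O) : f =ᶠ[𝓝 x] g := by
  filter_upwards [hO.mem_nhds hx] with z hz using e z hz

theorem pd_eqOn {O : Set (Eu n)} (hO : IsOpen O) {f g : Eu n → ℝ} (e : ∀ x ∈ O, f x = g x) (i : Fin n) :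
    ∀ x ∈ O, pd i f x = pd i g x := fun x hx => by
  unfold pd; rw [(eqOn_nhds hO e hx).fderiv_eq]

theorem HC.congr {a : ℝ} {O : Set (Eu n)} (hO : IsOpen O) {m : ℕ} : ∀ {f g : Eu n → ℝ}, HC a O m f →
    (∀ x ∈ O, f x = g x) → HC a O m g := by
  induction m with
  | zero => exact fun h e => Hol.congr h e
  | succ m ih =>
    exact fun h e => ⟨h.1.congr e, fun x hx => (h.2.1 x hx).congr_of_eventuallyEq (eqOn_nhds hO e hx).symm,
      fun i => ih (h.2.2 i) (pd_eqOn hO e i)⟩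

theorem Hol.add {a : ℝ} {O : Set (Eu n)} {f g : Eu n → ℝ} (hf : Hol a O f) (hg : Hol a O g) :
    Hol a O (fun x => f x + g x) := by
  obtain ⟨C, h0, h1, h2⟩ := hf
  obtain ⟨D, k0, k1, k2⟩ := hg
  refine ⟨C + D, by positivity, fun x hx => (abs_add_le _ _).trans (add_le_add (h1 x hx) (k1 x hx)),
    fun k x hx z hz hxz => ?_⟩
  rw [add_sub_add_comm, add_mul]
  exact (abs_add_le _ _).trans (add_le_add (h2 k x hx z hz hxz) (k2 k x hx z hz hxz))

theorem Hol.mul {a : ℝ} (ha : 0 ≤ a) {O : Set (Eu n)} {f g : Eu n → ℝ} (hf : Hol a O f) (hg : Hol a O g) :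
    Hol a O (fun x => f x * g x) := by
  obtain ⟨C, h0, h1, h2⟩ := hf
  obtain ⟨D, k0, k1, k2⟩ := hg
  refine ⟨2 * (C * D), by positivity, fun x hx => ?_, fun k x hx z hz hxz => ?_⟩
  · rw [abs_mul]
    have := mul_le_mul (h1 x hx) (k1 x hx) (abs_nonneg _) h0
    nlinarith [mul_nonneg h0 k0]
  · have e : f x * g x - f z * g z = (f x - f z) * g x + f z * (g x - g z) := by ring
    rw [e]
    refine (abs_add_le _ _).trans ?_
    rw [abs_mul, abs_mul]
    have i1 := mul_le_mul (h2 k x hx z hz hxz) (k1 x hx) (abs_nonneg _) (by positivity)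
    have i2 := mul_le_mul (h1 z hz) (k2 k x hx z hz hxz) (abs_nonneg _) h0
    nlinarith

theorem HC.add {a : ℝ} {O : Set (Eu n)} (hO : IsOpen O) {m : ℕ} : ∀ {f g : Eu n → ℝ}, HC a O m f → HC a O m g →
    HC a O m (fun x => f x + g x) := by
  induction m with
  | zero => exact fun h h' => Hol.add h h'
  | succ m ih =>
    exact fun h h' => ⟨h.1.add h'.1, fun x hx => (h.2.1 x hx).add (h'.2.1 x hx), fun i =>
      (ih (h.2.2 i) (h'.2.2 i)).congr hO fun x hx => (pd_add i (h.2.1 x hx) (h'.2.1 x hx)).symm⟩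

theorem HC.mul {a : ℝ} (ha : 0 ≤ a) {O : Set (Eu n)} (hO : IsOpen O) {m : ℕ} : ∀ {f g : Eu n → ℝ}, HC a O m f →
    HC a O m g → HC a O m (fun x => f x * g x) := by
  induction m with
  | zero => exact fun h h' => Hol.mul ha h h'
  | succ m ih =>
    exact fun h h' => ⟨h.1.mul ha h'.1, fun x hx => (h.2.1 x hx).mul (h'.2.1 x hx), fun i =>
      (HC.add hO (ih (h.2.2 i) h'.pred) (ih h.pred (h'.2.2 i))).congr hO
        fun x hx => (pd_mul i (h.2.1 x hx) (h'.2.1 x hx)).symm⟩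

theorem HC.zero {a : ℝ} (ha : 0 ≤ a) {O : Set (Eu n)} (m : ℕ) : HC a O m (fun _ => 0) := by
  have h0 : Hol a O (fun _ => 0) := ⟨0, le_rfl, by simp, by simp⟩
  induction m with
  | zero => exact h0
  | succ m ih =>
    refine ⟨h0, fun x _ => differentiableAt_const _, fun i => ?_⟩
    have : pd i (fun _ : Eu n => (0:ℝ)) = fun _ => 0 := by funext x; simp [pd]
    rw [this]; exact ih

theorem HC.sum {a : ℝ} (ha : 0 ≤ a) {O : Set (Eu n)} (hO : IsOpen O) {m : ℕ} {ι : Type*} (s : Finset ι)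
    {f : ι → Eu n → ℝ} (h : ∀ i ∈ s, HC a O m (f i)) : HC a O m (fun x => ∑ i ∈ s, f i x) := by
  classical
  induction s using Finset.induction_on with
  | empty => simpa using HC.zero ha m
  | insert i s hi ih =>
    simp_rw [Finset.sum_insert hi]
    exact HC.add hO (h i (Finset.mem_insert_self _ _)) (ih fun j hj => h j (Finset.mem_insert_of_mem hj))

theorem HC.contDiffOn {a : ℝ} (ha : 0 ≤ a) (ha1 : a < 1) {O : Set (Eu n)} (hO : IsOpen O) {m : ℕ} : ∀ {f : Eu n → ℝ},
    HC a O m f → ContDiffOn ℝ m f O := by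
  induction m with
  | zero =>
    rintro f ⟨C, h0, h1, h2⟩
    rw [Nat.cast_zero, contDiffOn_zero]
    intro x hx
    rw [Metric.continuousWithinAt_iff]
    intro ε hε
    have hT : Tendsto (fun k : ℕ => C * a^k) atTop (𝓝 0) := by
      simpa using (tendsto_pow_atTop_nhds_zero_of_lt_one ha ha1).const_mul C
    obtain ⟨k, hk⟩ := (hT.eventually_lt_const hε).exists
    refine ⟨(1/2)^k, by positivity, fun z hz hd => ?_⟩
    rw [Real.dist_eq]
    exact (h2 k z hz x hx (by rw [← dist_eq_norm]; exact hd.le)).trans_lt hk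
  | succ m ih =>
    intro f h
    rw [Nat.cast_succ, contDiffOn_succ_iff_fderiv_of_isOpen hO]
    refine ⟨fun x hx => (h.2.1 x hx).differentiableWithinAt, by simp, ?_⟩
    have : fderiv ℝ f = fun x => ∑ i, pd i f x • (EuclideanSpace.proj i : Eu n →L[ℝ] ℝ) := by
      funext x; exact fderiv_eq_proj f x
    rw [this]
    exact ContDiffOn.sum fun i _ => (ih (h.2.2 i)).smul contDiffOn_const
end

section
open scoped ContDiff Topology Convolution

variable {n p : ℕ}

def Qb (b r : ℝ) (O : Set (Eu n)) (U : Eu n → ℝ) : Prop :=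
  ∀ κ, Test (ball 0 1) κ → ∃ C : ℝ, 0 ≤ C ∧ ∀ k : ℕ, ∀ x ∈ O,
    |((r/2^k)⁻¹)^n * cv (lap κ) U (r/2^k) x| ≤ C * b^k

theorem Qb_Fast {a b r : ℝ} (hb : 0 ≤ b) (hr : 0 < r) {O : Set (Eu n)} {U : Eu n → ℝ}
    (hU : LocallyIntegrable U) (hQ : Qb b r O U) (m : ℕ) : ∀ (j : ℕ) (κ : Eu n → ℝ) (v : ℕ → Eu n → ℝ),
    2^(j+m) * b ≤ a → Test (ball 0 1) κ → (∀ k, ContDiff ℝ ∞ (v k)) →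
    (∀ k x, v k x - v (k+1) x = ((r/2^k)⁻¹)^j * (((r/2^k)⁻¹)^n * cv (lap κ) U (r/2^k) x)) → Fast a O m v := by
  have hpd : ∀ (j : ℕ) (κ : Eu n → ℝ) (v : ℕ → Eu n → ℝ), Test (ball 0 1) κ → (∀ k, ContDiff ℝ ∞ (v k)) →
    (∀ k x, v k x - v (k+1) x = ((r/2^k)⁻¹)^j * (((r/2^k)⁻¹)^n * cv (lap κ) U (r/2^k) x)) →
    ∀ i k x, pd i (v k) x - pd i (v (k+1)) x =
      ((r/2^k)⁻¹)^(j+1) * (((r/2^k)⁻¹)^n * cv (lap (pd i κ)) U (r/2^k) x) := by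
    intro j κ v hκ hv h i k x
    have ht : 0 < r/2^k := by positivity
    rw [← pd_sub i ((hv k).differentiable (by simp) x) ((hv (k+1)).differentiable (by simp) x)]
    have : (fun y => v k y - v (k+1) y) = fun y => (((r/2^k)⁻¹)^j * ((r/2^k)⁻¹)^n) * cv (lap κ) U (r/2^k) y := by
      funext y; rw [h]; ring
    rw [this, pd_const_mul _ _ ((contDiff_cv hκ.lap hU ht).differentiable (by simp) _), pd_cv hκ.lap hU ht,
      lap_pd hκ.smooth]
    ring
  have hF0 : ∀ (j : ℕ) (κ : Eu n → ℝ) (v : ℕ → Eu n → ℝ), 2^j * b ≤ a → Test (ball 0 1) κ → (∀ k, ContDiff ℝ ∞ (v k)) →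
    (∀ k x, v k x - v (k+1) x = ((r/2^k)⁻¹)^j * (((r/2^k)⁻¹)^n * cv (lap κ) U (r/2^k) x)) → F0 a O v := by
    intro j κ v hj hκ hv h
    have key : ∀ (j : ℕ) (a : ℝ) (κ : Eu n → ℝ), 2^j * b ≤ a → Test (ball 0 1) κ → ∃ C : ℝ, 0 ≤ C ∧ ∀ k, ∀ x ∈ O,
        |((r/2^k)⁻¹)^j * (((r/2^k)⁻¹)^n * cv (lap κ) U (r/2^k) x)| ≤ C * a^k := by
      intro j a κ hj hκ
      obtain ⟨C, hC0, hC⟩ := hQ κ hκ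
      refine ⟨(r⁻¹)^j * C, by positivity, fun k x hx => ?_⟩
      rw [abs_mul, abs_of_pos (by positivity : 0 < ((r/2^k)⁻¹)^j)]
      calc ((r/2^k)⁻¹)^j * _ ≤ ((r/2^k)⁻¹)^j * (C * b^k) := mul_le_mul_of_nonneg_left (hC k x hx) (by positivity)
        _ = (r⁻¹)^j * C * (2^j * b)^k := by
            rw [inv_div, div_eq_mul_inv, mul_pow, mul_pow, ← pow_mul, ← pow_mul, mul_comm k j]; ring
        _ ≤ _ := by gcongr
    obtain ⟨C, hC0, hC⟩ := key j a κ hj hκ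
    choose D hD0 hD using fun i => key (j+1) (2*a) (pd i κ) (by rw [pow_succ]; linarith) (hκ.pd i)
    have hs : 0 ≤ ∑ i, D i := Finset.sum_nonneg fun i _ => hD0 i
    have ha : 0 ≤ a := le_trans (by positivity) hj
    refine ⟨C + ∑ i, D i, by positivity, fun k x hx => ⟨?_, fun i => ?_⟩⟩
    · rw [h]; refine (hC k x hx).trans ?_
      gcongr; linarith
    · rw [hpd j κ v hκ hv h]; refine (hD i k x hx).trans ?_
      have := Finset.single_le_sum (fun i _ => hD0 i) (Finset.mem_univ i)
      gcongr; linarith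
  induction m with
  | zero => exact fun j κ v hj hκ hv h => hF0 j κ v hj hκ hv h
  | succ m ih =>
    intro j κ v hj hκ hv h
    refine ⟨hF0 j κ v (le_trans ?_ hj) hκ hv h, fun i => ?_⟩
    · gcongr
      · norm_num
      · omega
    · exact ih (j+1) (pd i κ) _ (by rwa [add_assoc, add_comm 1 m]) (hκ.pd i) (fun k => contDiff_pd (hv k) i)
        (hpd j κ v hκ hv h i)

theorem Qb_HC (hn : 0 < n) {a b r : ℝ} (ha : 1/2 < a) (ha1 : a < 1) (hb : 0 ≤ b) (hr : 0 < r) {y : Eu n} {R : ℝ}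
    {U : Eu n → ℝ} (hU : MemLp U 2) (hQ : Qb b r (ball y R) U) {m : ℕ} (hm : 2^m * b ≤ a) :
    ∃ w, HC a (ball y R) m w ∧ ∀ᵐ x, x ∈ ball y R → U x = w x := by
  obtain ⟨φ, Γ, hφ, hΓT, hφ1, hΓ⟩ := exists_kernel n hn
  have hUl : LocallyIntegrable U := hU.locallyIntegrable (by norm_num)
  set v : ℕ → Eu n → ℝ := fun k => ut φ U (r/2^k) with hv
  have hvs : ∀ k, ContDiff ℝ ∞ (v k) := fun k => contDiff_ut hφ hUl (by positivity)
  have hdv : ∀ k x, v k x - v (k+1) x = ((r/2^k)⁻¹)^0 * (((r/2^k)⁻¹)^n * cv (lap Γ) U (r/2^k) x) := by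
    intro k x
    rw [pow_zero, one_mul, ← ut_sub hφ hΓ hUl (by positivity)]
    simp only [hv]; rw [pow_succ, div_div]
  have hF : Fast a (ball y R) m v := Qb_Fast hb hr hUl hQ m 0 Γ v (by simpa using hm) hΓT hvs hdv
  have hF0 : F0 a (ball y R) v := by
    cases m with
    | zero => exact hF
    | succ m => exact hF.1
  obtain ⟨w, hw, C, hC⟩ := seqHol ha ha1 hvs hF0
  have hT : Tendsto (fun k : ℕ => C * a^k) atTop (𝓝 0) := by
    simpa using (tendsto_pow_atTop_nhds_zero_of_lt_one (by linarith) ha1).const_mul C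
  refine ⟨w, fast_HC ha ha1 m v hvs hF w fun x hx => ?_, ?_⟩
  · rw [tendsto_iff_dist_tendsto_zero]
    exact squeeze_zero (fun _ => dist_nonneg) (fun k => by rw [Real.dist_eq]; exact hC k x hx) hT
  have hfin : IsFiniteMeasure (volume.restrict (ball y R)) := isFiniteMeasure_restrict.2 measure_ball_lt_top.ne
  have hwc : ContinuousOn w (ball y R) :=
    (HC.contDiffOn (m := 0) (by linarith) ha1 isOpen_ball hw).continuousOn
  have hwm : MemLp w 2 (volume.restrict (ball y R)) := by
    obtain ⟨D, _, hD, _⟩ := hw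
    refine MemLp.of_bound (hwc.aestronglyMeasurable measurableSet_ball) D ?_
    filter_upwards [ae_restrict_mem measurableSet_ball] with z hz using hD z hz
  have hf : MemLp (fun x => U x - w x) 2 (volume.restrict (ball y R)) := (hU.restrict _).sub hwm
  set g : Eu n → ℝ := (ball y R).indicator (fun x => U x - w x) with hg
  have hgm : MemLp g 2 := (memLp_indicator_iff_restrict measurableSet_ball).2 hf
  have eb : ∀ h : Eu n → ℝ, ∫ x, g x * h x = ∫ x in ball y R, (U x - w x) * h x := by
    intro h
    rw [← integral_indicator measurableSet_ball]
    congr 1; funext x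
    by_cases hx : x ∈ ball y R <;> simp [hg, hx]
  have T1 : Tendsto (fun k => ∫ x in ball y R, (U x - w x) * v k x) atTop (𝓝 (∫ x in ball y R, (U x - w x) * U x)) := by
    have := (weak_conv hgm hU hφ hφ1).comp (tendsto_dyadic hr)
    rw [eb] at this
    refine this.congr fun k => ?_
    rw [← eb]; rfl
  have iw : IntegrableOn (fun x => (U x - w x) * w x) (ball y R) := MemLp.integrable_mul hf hwm
  have iU : IntegrableOn (fun x => (U x - w x) * U x) (ball y R) := MemLp.integrable_mul hf (hU.restrict _)
  have T2 : Tendsto (fun k => ∫ x in ball y R, (U x - w x) * v k x) atTop (𝓝 (∫ x in ball y R, (U x - w x) * w x)) := by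
    rw [tendsto_iff_dist_tendsto_zero]
    have hT' : Tendsto (fun k : ℕ => (C * a^k) * ∫ x in ball y R, |U x - w x|) atTop (𝓝 0) := by
      simpa using hT.mul_const (∫ x in ball y R, |U x - w x|)
    refine squeeze_zero (fun _ => dist_nonneg) (fun k => ?_) hT'
    have iv : IntegrableOn (fun x => (U x - w x) * v k x) (ball y R) :=
      MemLp.integrable_mul hf (memLp_indicator_cont (hvs k).continuous y R)
    rw [Real.dist_eq, ← integral_sub iv iw, ← integral_const_mul, ← Real.norm_eq_abs]
    refine norm_integral_le_of_norm_le ((hf.integrable (by norm_num)).abs.const_mul _) ?_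
    filter_upwards [ae_restrict_mem measurableSet_ball] with x hx
    rw [← mul_sub, Real.norm_eq_abs, abs_mul, mul_comm]
    exact mul_le_mul_of_nonneg_right (hC k x hx) (abs_nonneg _)
  have e0 : ∫ x in ball y R, (U x - w x)^2 = 0 := by
    have := tendsto_nhds_unique T1 T2
    rw [← sub_eq_zero, ← integral_sub iU iw] at this
    rw [← this]; congr 1; funext x; ring
  rw [integral_eq_zero_iff_of_nonneg (fun x => sq_nonneg _) hf.integrable_sq] at e0
  have := (ae_restrict_iff' measurableSet_ball).1 e0
  filter_upwards [this] with x hx hxb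
  have := hx hxb
  simpa [sub_eq_zero] using this
end

section
open scoped ContDiff Topology Convolution

variable {n p : ℕ}

theorem Test.int_cont {O : Set (Eu n)} {ψ f : Eu n → ℝ} (h : Test O ψ) (hf : ContinuousOn f O) :
    Integrable (fun x => ψ x * f x) := by
  have : IntegrableOn (fun x => ψ x * f x) (tsupport ψ) :=
    (h.continuous.continuousOn.mul (hf.mono h.sub)).integrableOn_compact h.cpt
  rwa [integrableOn_iff_integrable_of_support_subset] at this
  intro x hx
  apply subset_tsupport
  intro h0
  exact hx (by simp [h0])

theorem HC.cont {a : ℝ} (ha : 0 ≤ a) (ha1 : a < 1) {O : Set (Eu n)} (hO : IsOpen O) {m : ℕ} {f : Eu n → ℝ}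
    (h : HC a O m f) : ContinuousOn f O := (HC.contDiffOn ha ha1 hO h).continuousOn

theorem HC.ibp {a : ℝ} (ha : 0 ≤ a) (ha1 : a < 1) {O : Set (Eu n)} (hO : IsOpen O) {m : ℕ} {V ψ : Eu n → ℝ}
    (hV : HC a O (m+1) V) (h : Test O ψ) (i : Fin n) : ∫ x, V x * pd i ψ x = - ∫ x, ψ x * pd i V x := by
  have i1 := h.int_cont ((hV.2.2 i).cont ha ha1 hO)
  have i2 := (h.pd i).int_cont (hV.cont ha ha1 hO)
  have i3 := h.int_cont (hV.cont ha ha1 hO)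
  simp_rw [mul_comm (ψ _)] at i1 i3 ⊢
  simp_rw [mul_comm (pd i ψ _)] at i2
  exact integral_mul_fderiv_eq_neg_fderiv_mul_of_integrable i1 i2 i3
    (fun x hx => hV.2.1 x (h.sub hx)) (fun x _ => h.diff x)

theorem cv_lap' (U : Eu n → ℝ) {κ : Eu n → ℝ} (hκ : Test (ball 0 1) κ) {t : ℝ} (ht : 0 < t)
    (x : Eu n) : cv (lap κ) U t x = t^2 * ∫ z, U z * lap (fun z => κ (t⁻¹ • (x - z))) z := by
  rw [lap_scl hκ.1]
  unfold cv
  rw [← integral_const_mul]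
  congr 1; funext z
  field_simp

/-- weak equation for the derivative -/
theorem weak_pd {a : ℝ} (ha : 0 ≤ a) (ha1 : a < 1) {O : Set (Eu n)} (hO : IsOpen O) {m : ℕ} {V f : Eu n → ℝ}
    (hV : HC a O (m+1) V) (hw : ∀ ψ, Test O ψ → ∫ x, V x * lap ψ x = - ∫ x, ψ x * f x) (i : Fin n)
    {ψ : Eu n → ℝ} (h : Test O ψ) : ∫ x, pd i V x * lap ψ x = ∫ x, pd i ψ x * f x := by
  have h1 := HC.ibp ha ha1 hO hV h.lap i
  have h2 := hw _ (h.pd i)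
  rw [lap_pd h.smooth] at h2
  simp_rw [mul_comm (pd i V _)]
  linarith

theorem base_pd (hn : 0 < n) {a : ℝ} (ha : 1/2 < a) (ha1 : a < 1) {y : Eu n} {R R' : ℝ} (hR : R' < R) {W f : Eu n → ℝ}
    (hWH : Hol a (ball y R) W) (hf : Hol a (ball y R) f) (i : Fin n)
    (hw : ∀ ψ, Test (ball y R) ψ → ∫ x, W x * lap ψ x = ∫ x, pd i ψ x * f x) : HC a (ball y R') 1 W := by
  have ha0 : 0 ≤ a := by linarith
  have hWc : ContinuousOn W (ball y R) := HC.cont (m := 0) ha0 ha1 isOpen_ball hWH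
  have hfc : ContinuousOn f (ball y R) := HC.cont (m := 0) ha0 ha1 isOpen_ball hf
  have hfin : IsFiniteMeasure (volume.restrict (ball y R)) := isFiniteMeasure_restrict.2 measure_ball_lt_top.ne
  have hWm : MemLp W 2 (volume.restrict (ball y R)) := by
    obtain ⟨D, _, hD, _⟩ := hWH
    refine MemLp.of_bound (hWc.aestronglyMeasurable measurableSet_ball) D ?_
    filter_upwards [ae_restrict_mem measurableSet_ball] with z hz using hD z hz
  set g : Eu n → ℝ := (ball y R).indicator W with hg
  have hgm : MemLp g 2 := (memLp_indicator_iff_restrict measurableSet_ball).2 hWm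
  have hom := om_pos (n := n)
  set r := min (R - R') 1 with hr
  have hr0 : 0 < r := lt_min (by linarith) one_pos
  obtain ⟨C, hC0, -, hC⟩ := hf
  have hQ : Qb (a/2) r (ball y R') g := by
    intro κ hκ
    obtain ⟨M, hM0, hM⟩ := (hκ.pd i).bdd
    refine ⟨r * M * (C * om n), by positivity, fun k x hx => ?_⟩
    have ht : 0 < r/2^k := by positivity
    have htr : r/2^k ≤ r := div_le_self hr0.le (one_le_pow₀ (by norm_num))
    have ht1 : r/2^k ≤ (1/2)^k := by
      rw [div_pow, one_pow]; gcongr; exact min_le_right _ _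
    set t := r/2^k with htdef
    have hsub : ball x t ⊆ ball y R := by
      refine ball_subset_ball' ?_
      have := min_le_left (R - R') 1
      rw [mem_ball] at hx; linarith
    have hψ := (hκ.scl ht x).mono hsub
    have hxR : x ∈ ball y R := hsub (mem_ball_self ht)
    have e1 : cv (lap κ) g t x = - t * ∫ z, pd i κ (t⁻¹ • (x - z)) * (f z - f x) := by
      rw [cv_lap' g hκ ht]
      have : ∫ z, g z * lap (fun z => κ (t⁻¹ • (x - z))) z = ∫ z, W z * lap (fun z => κ (t⁻¹ • (x - z))) z := by
        congr 1; funext z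
        by_cases hz : z ∈ ball y R
        · simp [hg, hz]
        · rw [hψ.lap.eq_zero hz, mul_zero, mul_zero]
      rw [this, hw _ hψ]
      have h0 := integral_pd_eq_zero hψ i
      have j1 := (hψ.pd i).int_cont hfc
      have j2 : Integrable (fun z => pd i (fun z => κ (t⁻¹ • (x - z))) z) :=
        (hψ.pd i).continuous.integrable_of_hasCompactSupport (hψ.pd i).cpt
      have : ∫ z, pd i (fun z => κ (t⁻¹ • (x - z))) z * f z = ∫ z, pd i (fun z => κ (t⁻¹ • (x - z))) z * (f z - f x) := by
        simp_rw [mul_sub]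
        rw [integral_sub j1 (j2.mul_const _), integral_mul_const, h0]; ring
      rw [this, pd_scl hκ.1, ← integral_const_mul, ← integral_const_mul]
      congr 1; funext z
      field_simp
    have e2 : |∫ z, pd i κ (t⁻¹ • (x - z)) * (f z - f x)| ≤ M * ∫ z in ball x t, |f z - f x| := by
      refine cv_bound (hκ.pd i) hM ht x (U := fun z => f z - f x) ?_
      have : IsFiniteMeasure (volume.restrict (ball x t)) := isFiniteMeasure_restrict.2 measure_ball_lt_top.ne
      refine Integrable.of_bound (((hfc.mono hsub).sub continuousOn_const).aestronglyMeasurable measurableSet_ball) (C * a^k) ?_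
      filter_upwards [ae_restrict_mem measurableSet_ball] with z hz
      exact hC k z (hsub hz) x hxR (by rw [← dist_eq_norm]; exact (mem_ball.1 hz).le.trans ht1)
    have e3 : ∫ z in ball x t, |f z - f x| ≤ (C * a^k) * (t^n * om n) := by
      have : ‖∫ z in ball x t, |f z - f x|‖ ≤ (C * a^k) * volume.real (ball x t) :=
        norm_setIntegral_le_of_norm_le_const measure_ball_lt_top fun z hz => by
          rw [Real.norm_eq_abs, abs_abs]
          exact hC k z (hsub hz) x hxR (by rw [← dist_eq_norm]; exact (mem_ball.1 hz).le.trans ht1)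
      rw [vol_ball x ht] at this
      exact (le_abs_self _).trans this
    rw [e1, abs_mul, abs_mul, abs_neg, abs_of_pos ht, abs_of_pos (by positivity : 0 < (t⁻¹)^n)]
    calc (t⁻¹)^n * (t * |∫ z, pd i κ (t⁻¹ • (x - z)) * (f z - f x)|)
        ≤ (t⁻¹)^n * (t * (M * ((C * a^k) * (t^n * om n)))) := by
          have := e2.trans (mul_le_mul_of_nonneg_left e3 hM0.le)
          gcongr
      _ = ((t⁻¹)^n * t^n) * (t * M * (C * om n)) * a^k := by ring
      _ = (r/2^k) * M * (C * om n) * a^k := by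
          rw [← mul_pow, inv_mul_cancel₀ ht.ne', one_pow, one_mul]
      _ = _ := by rw [div_pow]; ring
  obtain ⟨w, hw1, hw2⟩ := Qb_HC hn ha ha1 (by linarith) hr0 hgm hQ (m := 1) (by linarith)
  refine hw1.congr isOpen_ball ?_
  have hsub : ball y R' ⊆ ball y R := ball_subset_ball hR.le
  refine Measure.eqOn_open_of_ae_eq (μ := volume) ?_ isOpen_ball (hw1.cont ha0 ha1 isOpen_ball) (hWc.mono hsub)
  filter_upwards [ae_restrict_of_ae hw2, ae_restrict_mem measurableSet_ball] with x hx hxb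
  rw [← hx hxb, hg, indicator_of_mem (hsub hxb)]

theorem HC.one {a : ℝ} {O : Set (Eu n)} {m : ℕ} {f : Eu n → ℝ} (h : HC a O (m+1) f) : HC a O 1 f := by
  induction m with
  | zero => exact h
  | succ m ih => exact ih h.pred

theorem boot (hn : 0 < n) {a : ℝ} (ha : 1/2 < a) (ha1 : a < 1) {y : Eu n} (m : ℕ) : ∀ (V f : Eu n → ℝ) (R R' : ℝ),
    R' < R → HC a (ball y R) 1 V → HC a (ball y R) m f →
    (∀ ψ, Test (ball y R) ψ → ∫ x, V x * lap ψ x = - ∫ x, ψ x * f x) → HC a (ball y R') (m+2) V := by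
  have ha0 : 0 ≤ a := by linarith
  induction m with
  | zero =>
    intro V f R R' hR hV hf hw
    have hsub : ball y R' ⊆ ball y R := ball_subset_ball hR.le
    exact ⟨hV.1.mono hsub, fun x hx => hV.2.1 x (hsub hx), fun i => base_pd hn ha ha1 hR (hV.2.2 i).hol hf i
      fun ψ hψ => weak_pd ha0 ha1 isOpen_ball hV hw i hψ⟩
  | succ m ih =>
    intro V f R R' hR hV hf hw
    obtain ⟨R1, h1, h2⟩ := exists_between hR
    have hsub : ball y R' ⊆ ball y R := ball_subset_ball hR.le
    have hsub1 : ball y R1 ⊆ ball y R := ball_subset_ball h2.le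
    have hV2 := ih V f R R1 h2 hV hf.pred hw
    refine ⟨hV.1.mono hsub, fun x hx => hV.2.1 x (hsub hx), fun i => ?_⟩
    refine ih (pd i V) (pd i f) R1 R' h1 (hV2.2.2 i).one ((hf.2.2 i).mono hsub1) fun ψ hψ => ?_
    rw [weak_pd ha0 ha1 isOpen_ball hV hw i (hψ.mono hsub1), ← HC.ibp ha0 ha1 isOpen_ball hf (hψ.mono hsub1) i]
    simp_rw [mul_comm (f _)]
end

section
open scoped ContDiff Topology Convolution

variable {n p : ℕ}

namespace Sys
variable {y : Eu n} {ρ : ℝ} {U : Fin p → Eu n → ℝ} {G : Fin n → Fin p → Eu n → ℝ}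

theorem stepA (S : Sys y ρ U G) (hρ : 0 < ρ) (hn : 2 ≤ n) {e0 C : ℝ} (he : 0 < e0) (hC0 : 0 ≤ C)
    (hM : ∀ x ∈ ball y (ρ/2), ∀ s, 0 < s → s ≤ ρ/2 → ∫ z in ball x s, ed G z ≤ e0 * s^(n-2))
    (hC : ∀ x ∈ ball y (ρ/4), ∀ j : ℕ, ∃ c, ∫ z in ball x (ρ/8/2^j), osc U c z ≤
      C * (ρ/8/2^j)^n * (9/25)^j) (a : Fin p) : Qb (3/5) (ρ/8) (ball y (ρ/4)) (U a) := by
  intro κ hκ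
  choose N hN0 hN using fun i => (hκ.pd i).bdd
  set M := ∑ i, N i with hMdef
  have hM0 : 0 ≤ M := Finset.sum_nonneg fun i _ => (hN0 i).le
  have hMb : ∀ i x, |pd i κ x| ≤ M := fun i x =>
    (hN i x).trans (Finset.single_le_sum (fun i _ => (hN0 i).le) (Finset.mem_univ i))
  refine ⟨2 * n * p * M * Real.sqrt (e0 * C), by positivity, fun k x hx => ?_⟩
  have ht : 0 < ρ/8/2^k := by positivity
  have htr : ρ/8/2^k ≤ ρ/8 := div_le_self (by positivity) (one_le_pow₀ (by norm_num))
  obtain ⟨c, hc⟩ := hC x hx k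
  set t := ρ/8/2^k with htdef
  have hx' := mem_ball.1 hx
  have hsub : ball x t ⊆ ball y ρ := ball_subset_ball' (by linarith)
  have h1 := S.D1 a hκ hMb ht hsub c
  have h2 := hM x (mem_ball.2 (by linarith)) t ht (by linarith)
  have ho : 0 ≤ ∫ z in ball x t, osc U c z := integral_nonneg fun z => osc_nonneg _ _ _
  apply abs_le_of_sq_le_sq _ (by positivity)
  calc ((t⁻¹)^n * cv (lap κ) (U a) t x)^2 = ((t⁻¹)^n)^2 * (cv (lap κ) (U a) t x)^2 := by ring
    _ ≤ ((t⁻¹)^n)^2 * ((2 * n * p * M)^2 * t^2 * (e0 * t^(n-2)) * (C * t^n * (9/25)^k)) := by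
      refine mul_le_mul_of_nonneg_left (h1.trans ?_) (by positivity)
      refine mul_le_mul (mul_le_mul_of_nonneg_left h2 (by positivity)) hc ho (by positivity)
    _ = (2 * n * p * M * ((3/5)^k))^2 * (e0 * C) * ((t⁻¹)^n * t^n) * ((t⁻¹)^n * (t^2 * t^(n-2))) := by
      have h9 : (9/25:ℝ)^k = ((3/5)^k)^2 := by
        rw [← pow_mul, mul_comm, pow_mul]; norm_num
      rw [h9]; ring
    _ = (2 * n * p * M * ((3/5)^k))^2 * (e0 * C) := by
      rw [← pow_add, show 2 + (n-2) = n by omega, ← mul_pow, inv_mul_cancel₀ ht.ne']; simp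
    _ = (2 * n * p * M * ((3/5)^k))^2 * Real.sqrt (e0 * C)^2 := by
      rw [Real.sq_sqrt (by positivity)]
    _ = _ := by ring

theorem exists_bump : ∃ η : Eu n → ℝ, Test (ball 0 1) η ∧ (∀ x, 0 ≤ η x) ∧ ∀ x ∈ ball 0 (1/2), η x = 1 := by
  let f : ContDiffBump (0 : Eu n) := ⟨1/2, 3/4, by norm_num, by norm_num⟩
  refine ⟨f, ⟨f.contDiff, f.hasCompactSupport, ?_⟩, fun x => f.nonneg, fun x hx =>
    f.one_of_mem_closedBall (ball_subset_closedBall hx)⟩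
  rw [f.tsupport_eq]
  exact closedBall_subset_ball (by norm_num)

theorem cacc (S : Sys y ρ U G) {R : ℝ} (hR : 0 < R) (hRρ : R ≤ ρ) {w : Fin p → Eu n → ℝ}
    (hw : ∀ a, Hol (3/5) (ball y R) (w a)) (hUw : ∀ᵐ x, x ∈ ball y R → ∀ a, U a x = w a x) :
    ∃ D : ℝ, 0 ≤ D ∧ ∃ K0 : ℕ, (1/2:ℝ)^K0 ≤ R/2 ∧ ∀ k ≥ K0, ∀ x ∈ ball y (R/2),
      ∫ z in ball x ((1/2)^k/2), ed G z ≤ D * ((((1/2:ℝ)^k)⁻¹)^2 * ((1/2)^k)^n * (9/25)^k) := by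
  obtain ⟨η, hη, hη0, hη1⟩ := exists_bump (n := n)
  obtain ⟨M, hM0, hM⟩ := hη.lap.bdd
  have hom := om_pos (n := n)
  choose C hC0 hC1 hC using hw
  set D := ∑ a, (C a)^2 with hD
  have hD0 : 0 ≤ D := by positivity
  have hsph : ∀ x ∈ ball y R, ∑ a, (w a x)^2 = 1 := by
    have hc : ContinuousOn (fun x => ∑ a, (w a x)^2) (ball y R) :=
      continuousOn_finsetSum _ fun a _ => (HC.cont (m := 0) (a := 3/5) (by norm_num) (by norm_num) isOpen_ball (show Hol _ _ _ from ⟨C a, hC0 a, hC1 a, hC a⟩)).pow 2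
    refine Measure.eqOn_open_of_ae_eq (μ := volume) (g := fun _ => (1:ℝ)) ?_ isOpen_ball hc continuousOn_const
    filter_upwards [ae_restrict_of_ae hUw, ae_restrict_of_ae S.sph, ae_restrict_mem measurableSet_ball] with x h1 h2 hx
    rw [← h2 (ball_subset_ball hRρ hx)]
    simp [h1 hx]
  obtain ⟨K1, hK1⟩ := exists_pow_lt_of_lt_one (x := 1/(D+1)) (y := (9/25:ℝ)) (by positivity) (by norm_num)
  obtain ⟨K2, hK2⟩ := exists_pow_lt_of_lt_one (x := R/2) (y := (1/2:ℝ)) (by positivity) (by norm_num)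
  refine ⟨M * (D * om n), by positivity, max K1 K2, ?_, fun k hk x hx => ?_⟩
  · exact (pow_le_pow_of_le_one (by norm_num) (by norm_num) (le_max_right _ _)).trans hK2.le
  have hk1 : (9/25:ℝ)^k * (D+1) ≤ 1 := by
    have : (9/25:ℝ)^k ≤ (9/25)^K1 := pow_le_pow_of_le_one (by norm_num) (by norm_num) ((le_max_left _ _).trans hk)
    have := (this.trans hK1.le)
    rwa [le_div_iff₀ (by positivity)] at this
  have hk2 : (1/2:ℝ)^k ≤ R/2 :=
    (pow_le_pow_of_le_one (by norm_num) (by norm_num) ((le_max_right _ _).trans hk)).trans hK2.le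
  have ht : 0 < (1/2:ℝ)^k := by positivity
  set t := (1/2:ℝ)^k with htd
  have hsub : ball x t ⊆ ball y R := ball_subset_ball' (by have := mem_ball.1 hx; linarith)
  have hxR : x ∈ ball y R := hsub (mem_ball_self ht)
  set c := fun a => w a x with hc
  have hosc : ∀ᵐ z, z ∈ ball x t → osc U c z ≤ D * (9/25)^k := by
    filter_upwards [hUw] with z hz hzt
    rw [hD, Finset.sum_mul]
    refine Finset.sum_le_sum fun a _ => ?_
    rw [hz (hsub hzt)]
    have h1 := hC a k z (hsub hzt) x hxR (by rw [← dist_eq_norm]; exact (mem_ball.1 hzt).le)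
    have h2 := pow_le_pow_left₀ (abs_nonneg _) h1 2
    rw [sq_abs, mul_pow, ← pow_mul, mul_comm k 2, pow_mul] at h2
    norm_num at h2 ⊢
    exact h2
  have hdot : ∀ᵐ z, z ∈ ball x t → ∑ a, c a * U a z = 1 - osc U c z / 2 := by
    filter_upwards [hUw] with z hz hzt
    have h1 := hsph z (hsub hzt)
    have h2 := hsph x hxR
    have : osc U c z = ∑ a, (w a z)^2 + ∑ a, (w a x)^2 - 2 * ∑ a, c a * U a z := by
      unfold osc
      rw [Finset.mul_sum, ← Finset.sum_add_distrib, ← Finset.sum_sub_distrib]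
      refine Finset.sum_congr rfl fun a _ => ?_
      rw [hz (hsub hzt)]; ring
    rw [this, h1, h2]; ring
  set ψ := fun z => η (t⁻¹ • (x - z)) with hψd
  have hψt : Test (ball x t) ψ := hη.scl ht x
  have hψ : Test (ball y ρ) ψ := hψt.mono (hsub.trans (ball_subset_ball hRρ))
  have hedU : ∀ a, Integrable fun z => ψ z * (ed G z * U a z) := by
    intro a
    obtain ⟨B, _, hB⟩ := hψ.bdd
    refine Integrable.mono' (S.ed_int.const_mul B) (hψ.continuous.aestronglyMeasurable.mul (S.ed_int.1.mul (S.memU a).1)) ?_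
    filter_upwards [S.bdd] with z hz
    rw [norm_mul, norm_mul, Real.norm_eq_abs, Real.norm_eq_abs, Real.norm_eq_abs, abs_of_nonneg (ed_nonneg G z)]
    have := mul_le_mul_of_nonneg_left (hz a) (ed_nonneg G z)
    rw [mul_one] at this
    exact mul_le_mul (hB z) this (mul_nonneg (ed_nonneg G z) (abs_nonneg _)) (by linarith)
  have hlU : ∀ a, Integrable fun z => U a z * lap ψ z := fun a => by
    have := hψ.lap.int_mul (S.memU a)
    exact this.congr (ae_of_all _ fun z => mul_comm _ _)
  have key : ∫ z, lap ψ z * (∑ a, c a * U a z) = - ∫ z, ψ z * ed G z * ∑ a, c a * U a z := by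
    have e1 : ∫ z, lap ψ z * (∑ a, c a * U a z) = ∑ a, c a * ∫ z, U a z * lap ψ z := by
      simp_rw [← integral_const_mul]
      rw [← integral_finsetSum _ fun a _ => (hlU a).const_mul _]
      congr 1; funext z; rw [Finset.mul_sum]
      exact Finset.sum_congr rfl fun a _ => by ring
    have e2 : ∫ z, ψ z * ed G z * (∑ a, c a * U a z) = ∑ a, c a * ∫ z, ψ z * (ed G z * U a z) := by
      simp_rw [← integral_const_mul]
      rw [← integral_finsetSum _ fun a _ => (hedU a).const_mul _]
      congr 1; funext z; rw [Finset.mul_sum]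
      exact Finset.sum_congr rfl fun a _ => by ring
    rw [e1, e2, ← Finset.sum_neg_distrib]
    exact Finset.sum_congr rfl fun a _ => by rw [S.f3 a hψ]; ring
  have hlap0 : ∫ z, lap ψ z = 0 := by
    unfold lap
    rw [integral_finsetSum _ fun i _ => ((hψ.pd i).pd i).continuous.integrable_of_hasCompactSupport ((hψ.pd i).pd i).cpt]
    exact Finset.sum_eq_zero fun i _ => integral_pd_eq_zero (hψ.pd i) i
  have hosci := S.osc_int c x t
  have hlapi : Integrable (lap ψ) := hψ.lap.continuous.integrable_of_hasCompactSupport hψ.lap.cpt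
  obtain ⟨B, hB0, hB⟩ := hψ.lap.bdd
  have hoi : Integrable fun z => lap ψ z * osc U c z := by
    have : IntegrableOn (fun z => lap ψ z * osc U c z) (ball x t) :=
      Integrable.bdd_mul (c := B) hosci hψ.lap.continuous.aestronglyMeasurable (ae_of_all _ hB)
    rwa [integrableOn_iff_integrable_of_support_subset] at this
    intro z hz
    by_contra h0
    exact hz (by simp only; rw [hψt.lap.eq_zero h0, zero_mul])
  have k1 : ∫ z, lap ψ z * (∑ a, c a * U a z) = - (1/2) * ∫ z, lap ψ z * osc U c z := by
    have : ∫ z, lap ψ z * (∑ a, c a * U a z) = ∫ z, (lap ψ z + (-(1/2)) * (lap ψ z * osc U c z)) := by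
      refine integral_congr_ae ?_
      filter_upwards [hdot] with z hz
      by_cases hzt : z ∈ ball x t
      · rw [hz hzt]; ring
      · rw [hψt.lap.eq_zero hzt]; ring
    rw [this, integral_add hlapi (hoi.const_mul _), hlap0, integral_const_mul, zero_add]
  have hψed : Integrable fun z => ψ z * ed G z := by
    obtain ⟨B, _, hB⟩ := hψ.bdd
    exact Integrable.bdd_mul (c := B) S.ed_int hψ.continuous.aestronglyMeasurable (ae_of_all _ hB)
  have k2 : (1/2) * ∫ z, ψ z * ed G z ≤ ∫ z, ψ z * ed G z * ∑ a, c a * U a z := by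
    rw [← integral_const_mul]
    refine integral_mono_ae (hψed.const_mul _) ?_ ?_
    · have := integrable_finsetSum Finset.univ fun a _ => (hedU a).const_mul (c a)
      refine this.congr (ae_of_all _ fun z => ?_)
      simp only [Finset.mul_sum]
      exact Finset.sum_congr rfl fun a _ => by ring
    · filter_upwards [hdot, hosc] with z h1 h2
      by_cases hzt : z ∈ ball x t
      · rw [h1 hzt]
        have h3 := h2 hzt
        have h4 : (0:ℝ) ≤ (9/25)^k := by positivity
        have : (1/2:ℝ) ≤ 1 - osc U c z / 2 := by linarith
        have h5 := mul_le_mul_of_nonneg_left this (mul_nonneg (hη0 (t⁻¹ • (x - z))) (ed_nonneg G z))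
        rw [mul_comm]; exact h5
      · rw [hψt.eq_zero hzt]; simp
  have k3 : |∫ z, lap ψ z * osc U c z| ≤ (t⁻¹)^2 * (M * (D * (9/25)^k * (t^n * om n))) := by
    have e : ∫ z, lap ψ z * osc U c z = (t⁻¹)^2 * ∫ z, lap η (t⁻¹ • (x - z)) * osc U c z := by
      rw [lap_scl hη.1, ← integral_const_mul]
      congr 1; funext z; ring
    rw [e, abs_mul, abs_of_pos (by positivity)]
    refine mul_le_mul_of_nonneg_left ?_ (by positivity)
    have := cv_bound hη.lap hM ht x hosci
    refine this.trans (mul_le_mul_of_nonneg_left ?_ hM0.le)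
    have : ‖∫ z in ball x t, |osc U c z|‖ ≤ D * (9/25)^k * volume.real (ball x t) :=
      norm_setIntegral_le_of_norm_le_const_ae measure_ball_lt_top (by
        rw [ae_restrict_iff' measurableSet_ball]
        filter_upwards [hosc] with z hz hzt
        rw [Real.norm_eq_abs, abs_abs, abs_of_nonneg (osc_nonneg _ _ _)]
        exact hz hzt)
    rw [vol_ball x ht] at this
    exact (le_abs_self _).trans this
  have k4 : ∫ z in ball x (t/2), ed G z ≤ ∫ z, ψ z * ed G z := by
    rw [← integral_indicator measurableSet_ball]
    refine integral_mono (S.ed_int.indicator measurableSet_ball) hψed fun z => ?_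
    by_cases hz : z ∈ ball x (t/2)
    · simp only [indicator_of_mem hz]
      have : ψ z = 1 := hη1 _ (by
        rw [mem_ball_zero_iff, norm_smul, norm_inv, Real.norm_eq_abs, abs_of_pos ht, ← dist_eq_norm, dist_comm]
        rw [inv_mul_lt_iff₀ ht]
        have := mem_ball.1 hz; linarith)
      rw [this, one_mul]
    · simp only [indicator_of_notMem hz]
      exact mul_nonneg (hη0 _) (ed_nonneg G z)
  have k5 := (le_abs_self _).trans k3
  have : M * (D * om n) * ((t⁻¹)^2 * t^n * (9/25)^k) = (t⁻¹)^2 * (M * (D * (9/25)^k * (t^n * om n))) := by ring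
  linarith

theorem stepB (S : Sys y ρ U G) {R : ℝ} (hR : 0 < R) (hRρ : R ≤ ρ) {w : Fin p → Eu n → ℝ}
    (hw : ∀ a, Hol (3/5) (ball y R) (w a)) (hUw : ∀ᵐ x, x ∈ ball y R → ∀ a, U a x = w a x) :
    ∃ r : ℝ, 0 < r ∧ ∀ a, Qb (9/25) r (ball y (R/2)) (U a) := by
  obtain ⟨D, hD0, K0, hK0, hD⟩ := S.cacc hR hRρ hw hUw
  refine ⟨(1/2)^K0/2, by positivity, fun a κ hκ => ?_⟩
  obtain ⟨M, hM0, hM⟩ := hκ.bdd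
  refine ⟨M * D * 2^n, by positivity, fun k x hx => ?_⟩
  have e : (1/2:ℝ)^K0/2/2^k = (1/2)^(K0+k)/2 := by
    rw [pow_add, div_pow 1 2 k, one_pow]; field_simp
  rw [e]
  have h1 := hD (K0+k) (by omega) x hx
  have ht : 0 < (1/2:ℝ)^(K0+k) := by positivity
  have htR : (1/2:ℝ)^(K0+k) ≤ R/2 :=
    (pow_le_pow_of_le_one (by norm_num) (by norm_num) (by omega)).trans hK0
  have h9 : (9/25:ℝ)^(K0+k) ≤ (9/25)^k := pow_le_pow_of_le_one (by norm_num) (by norm_num) (by omega)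
  set t := (1/2:ℝ)^(K0+k) with htd
  have hsub : ball x (t/2) ⊆ ball y ρ := ball_subset_ball' (by have := mem_ball.1 hx; linarith)
  have ht2 : 0 < t/2 := by positivity
  have hψ := (hκ.scl ht2 x).mono hsub
  have hEU : Integrable fun z => ed G z * U a z := by
    refine Integrable.mono' S.ed_int (S.ed_int.1.mul (S.memU a).1) ?_
    filter_upwards [S.bdd] with z hz
    rw [norm_mul, Real.norm_eq_abs, Real.norm_eq_abs, abs_of_nonneg (ed_nonneg G z)]
    exact mul_le_of_le_one_right (ed_nonneg G z) (hz a)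
  have h2 : |cv (lap κ) (U a) (t/2) x| ≤ (t/2)^2 * (M * ∫ z in ball x (t/2), ed G z) := by
    rw [S.cv_lap a hκ ht2, S.f3 a hψ, abs_mul, abs_neg, abs_of_pos (by positivity)]
    refine mul_le_mul_of_nonneg_left ?_ (by positivity)
    refine (cv_bound hκ hM ht2 x hEU.integrableOn).trans (mul_le_mul_of_nonneg_left ?_ hM0.le)
    refine integral_mono_ae hEU.integrableOn.abs S.ed_int.integrableOn ?_
    filter_upwards [ae_restrict_of_ae S.bdd] with z hz
    rw [abs_mul, abs_of_nonneg (ed_nonneg G z)]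
    exact mul_le_of_le_one_right (ed_nonneg G z) (hz a)
  rw [abs_mul, abs_of_pos (by positivity : 0 < ((t/2)⁻¹)^n)]
  calc ((t/2)⁻¹)^n * |cv (lap κ) (U a) (t/2) x|
      ≤ ((t/2)⁻¹)^n * ((t/2)^2 * (M * (D * ((t⁻¹)^2 * t^n * (9/25)^(K0+k))))) := by
        refine mul_le_mul_of_nonneg_left (h2.trans ?_) (by positivity)
        exact mul_le_mul_of_nonneg_left (mul_le_mul_of_nonneg_left h1 hM0.le) (by positivity)
    _ = M * D * 2^n * ((9/25)^(K0+k) / 4) * (t^n * (t⁻¹)^n) * (t * t⁻¹)^2 := by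
        rw [inv_div, div_pow, inv_pow]; ring
    _ = M * D * 2^n * ((9/25)^(K0+k) / 4) := by
        rw [← mul_pow, mul_inv_cancel₀ ht.ne']; simp
    _ ≤ M * D * 2^n * (9/25)^k := by
        refine mul_le_mul_of_nonneg_left ?_ (by positivity)
        have : 0 ≤ (9/25:ℝ)^(K0+k) := by positivity
        linarith

theorem stepC (S : Sys y ρ U G) {R : ℝ} (hRρ : R ≤ ρ) {v : Fin p → Eu n → ℝ}
    (hv : ∀ a, HC (18/25) (ball y R) 1 (v a)) (hUv : ∀ᵐ x, x ∈ ball y R → ∀ a, U a x = v a x) (m : ℕ) :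
    ∀ R' < R, ∀ a, HC (18/25) (ball y R') (m+1) (v a) := by
  have ha0 : (0:ℝ) ≤ 18/25 := by norm_num
  have ha1 : (18/25:ℝ) < 1 := by norm_num
  have hsub : ball y R ⊆ ball y ρ := ball_subset_ball hRρ
  have hG : ∀ i a, ∀ᵐ x, x ∈ ball y R → G i a x = pd i (v a) x := by
    intro i a
    have hcont := ((hv a).2.2 i).cont ha0 ha1 isOpen_ball
    have hl : LocallyIntegrableOn (fun x => G i a x - pd i (v a) x) (ball y R) :=
      (((S.memG i a).locallyIntegrable (by norm_num)).locallyIntegrableOn _).sub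
        (hcont.locallyIntegrableOn measurableSet_ball)
    have := isOpen_ball.ae_eq_zero_of_integral_contDiff_smul_eq_zero hl (by
      intro ψ h1 h2 h3
      have h : Test (ball y R) ψ := ⟨h1, h2, h3⟩
      have e1 := S.wd i a ψ (h.mono hsub)
      have e2 := HC.ibp ha0 ha1 isOpen_ball (hv a) h i
      have e3 : ∫ x, U a x * pd i ψ x = ∫ x, v a x * pd i ψ x := by
        refine integral_congr_ae ?_
        filter_upwards [hUv] with x hx
        by_cases hb : x ∈ ball y R
        · rw [hx hb]
        · rw [(h.pd i).eq_zero hb]; simp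
      simp only [smul_eq_mul, mul_sub]
      rw [integral_sub (h.int_mul (S.memG i a)) (h.int_cont hcont)]
      linarith)
    filter_upwards [this] with x hx hb
    linarith [hx hb]
  have hGall : ∀ᵐ x, x ∈ ball y R → ∀ i a, G i a x = pd i (v a) x := by
    have : ∀ᵐ x, ∀ i a, x ∈ ball y R → G i a x = pd i (v a) x :=
      ae_all_iff.2 fun i => ae_all_iff.2 fun a => hG i a
    filter_upwards [this] with x hx hb i a using hx i a hb
  have hweak : ∀ a ψ, Test (ball y R) ψ → ∫ x, v a x * lap ψ x =
      - ∫ x, ψ x * ((∑ i, ∑ b, pd i (v b) x * pd i (v b) x) * v a x) := by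
    intro a ψ h
    have := S.f3 a (h.mono hsub)
    rw [show ∫ x, v a x * lap ψ x = ∫ x, U a x * lap ψ x from ?_, this]
    · congr 1
      refine integral_congr_ae ?_
      filter_upwards [hUv, hGall] with x h1 h2
      by_cases hb : x ∈ ball y R
      · rw [h1 hb]; unfold ed; simp [h2 hb, sq]
      · rw [h.eq_zero hb]; simp
    · refine integral_congr_ae ?_
      filter_upwards [hUv] with x hx
      by_cases hb : x ∈ ball y R
      · rw [hx hb]
      · rw [h.lap.eq_zero hb]; simp
  induction m with
  | zero => exact fun R' h a => (hv a).mono (ball_subset_ball h.le)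
  | succ m ih =>
    intro R' hR' a
    obtain ⟨R1, h1, h2⟩ := exists_between hR'
    have hsub1 : ball y R1 ⊆ ball y R := ball_subset_ball h2.le
    refine boot S.hn (by norm_num) ha1 m (v a) _ R1 R' h1 ((hv a).mono hsub1) ?_
      (fun ψ h => hweak a ψ (h.mono hsub1))
    refine HC.mul ha0 isOpen_ball (HC.sum ha0 isOpen_ball _ fun i _ => HC.sum ha0 isOpen_ball _ fun b _ => ?_)
      (ih R1 h2 a).pred
    exact HC.mul ha0 isOpen_ball ((ih R1 h2 b).2.2 i) ((ih R1 h2 b).2.2 i)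

end Sys

theorem sys_reg (n p : ℕ) (hn : 2 ≤ n) : ∃ e0 : ℝ, 0 < e0 ∧ ∀ (y : Eu n) (ρ : ℝ) (U : Fin p → Eu n → ℝ)
    (G : Fin n → Fin p → Eu n → ℝ), 0 < ρ → Sys y ρ U G →
    (∀ x ∈ ball y (ρ/2), ∀ s, 0 < s → s ≤ ρ/2 → ∫ z in ball x s, ed G z ≤ e0 * s^(n-2)) →
    ∃ R : ℝ, 0 < R ∧ R ≤ ρ ∧ ∃ v : Fin p → Eu n → ℝ, (∀ a, ContDiffOn ℝ ∞ (v a) (ball y R)) ∧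
      ∀ᵐ x, x ∈ ball y R → ∀ a, U a x = v a x := by
  obtain ⟨e0, he0, H⟩ := decay n p hn
  refine ⟨e0, he0, fun y ρ U G hρ S hM => ?_⟩
  obtain ⟨C, hC0, hC⟩ := H y ρ U G hρ S hM
  have hQ := fun a => S.stepA hρ hn he0 hC0 hM hC a
  choose w hw1 hw2 using fun a => Qb_HC S.hn (a := 3/5) (by norm_num) (by norm_num) (by norm_num) (by positivity)
    (S.memU a) (hQ a) (m := 0) (by norm_num)
  have hUw : ∀ᵐ x, x ∈ ball y (ρ/4) → ∀ a, U a x = w a x := by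
    filter_upwards [ae_all_iff.2 hw2] with x hx hb a using hx a hb
  obtain ⟨r, hr, hQ2⟩ := S.stepB (R := ρ/4) (by positivity) (by linarith) hw1 hUw
  choose v hv1 hv2 using fun a => Qb_HC S.hn (a := 18/25) (by norm_num) (by norm_num) (by norm_num) hr
    (S.memU a) (hQ2 a) (m := 1) (by norm_num)
  have hUv : ∀ᵐ x, x ∈ ball y (ρ/4/2) → ∀ a, U a x = v a x := by
    filter_upwards [ae_all_iff.2 hv2] with x hx hb a using hx a hb
  refine ⟨ρ/16, by positivity, by linarith, v, fun a => ?_, ?_⟩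
  · rw [contDiffOn_infty]
    intro m
    exact (S.stepC (by linarith) hv1 hUv m (ρ/16) (by linarith) a).pred.contDiffOn (by norm_num) (by norm_num) isOpen_ball
  · filter_upwards [hUv] with x hx hb
    exact hx (ball_subset_ball (by linarith) hb)
end

section
open scoped ContDiff Topology Convolution

variable {n p : ℕ}

structure Mini (y : Eu n) (ρ : ℝ) (U : Fin p → Eu n → ℝ) (G : Fin n → Fin p → Eu n → ℝ) : Prop where
  hn : 0 < n
  memU : ∀ a, MemLp (U a) 2
  memG : ∀ i a, MemLp (G i a) 2
  wd : ∀ i a, WD (ball y ρ) i (U a) (G i a)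
  bdd : ∀ᵐ x, ∀ a, |U a x| ≤ 1
  sph : ∀ᵐ x, x ∈ ball y ρ → ∑ a, (U a x)^2 = 1
  min : ∀ (W : Fin p → Eu n → ℝ) (H : Fin n → Fin p → Eu n → ℝ) (σ : ℝ), σ < ρ →
    (∀ a, MemLp (W a) 2) → (∀ i a, MemLp (H i a) 2) → (∀ i a, WD (ball y ρ) i (W a) (H i a)) →
    (∀ᵐ x, x ∈ ball y ρ → ∑ a, (W a x)^2 = 1) →
    (∀ x ∉ closedBall y σ, (∀ a, W a x = U a x) ∧ ∀ i a, H i a x = G i a x) →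
    ∫ x, ed G x ≤ ∫ x, ed H x

theorem WD.mul {O : Set (Eu n)} {i : Fin n} {U G f : Eu n → ℝ} (h : WD O i U G) (hU : MemLp U 2) (hG : MemLp G 2)
    (hf : ContDiff ℝ ∞ f) : WD O i (fun x => f x * U x) (fun x => f x * G x + pd i f x * U x) := by
  intro ψ hψ
  have hfd : Differentiable ℝ f := hf.differentiable (by simp)
  have e : ∀ x, pd i (fun x => ψ x * f x) x = pd i ψ x * f x + ψ x * pd i f x :=
    fun x => pd_mul i (hψ.diff x) (hfd x)
  have w := h _ (hψ.mul hf)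
  simp only [e] at w
  have i1 : Integrable fun x => f x * U x * pd i ψ x :=
    (((hψ.pd i).mul hf).int_mul hU).congr (ae_of_all _ fun x => by simp only; ring)
  have i2 : Integrable fun x => ψ x * (pd i f x * U x) :=
    ((hψ.mul (contDiff_pd hf i)).int_mul hU).congr (ae_of_all _ fun x => by simp only; ring)
  have i3 : Integrable fun x => ψ x * (f x * G x) :=
    ((hψ.mul hf).int_mul hG).congr (ae_of_all _ fun x => by simp only; ring)
  have e1 : ∫ x, U x * (pd i ψ x * f x + ψ x * pd i f x) = (∫ x, f x * U x * pd i ψ x) + ∫ x, ψ x * (pd i f x * U x) := by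
    rw [← integral_add i1 i2]; congr 1; funext x; ring
  have e2 : ∫ x, ψ x * (f x * G x + pd i f x * U x) = (∫ x, ψ x * (f x * G x)) + ∫ x, ψ x * (pd i f x * U x) := by
    rw [← integral_add i3 i2]; congr 1; funext x; ring
  have e3 : ∫ x, ψ x * f x * G x = ∫ x, ψ x * (f x * G x) := by congr 1; funext x; ring
  rw [e2]; rw [e1, e3] at w; linarith

theorem WD.add {O : Set (Eu n)} {i : Fin n} {U G U' G' : Eu n → ℝ} (h : WD O i U G) (h' : WD O i U' G')
    (hU : MemLp U 2) (hG : MemLp G 2) (hU' : MemLp U' 2) (hG' : MemLp G' 2) :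
    WD O i (fun x => U x + U' x) (fun x => G x + G' x) := by
  intro ψ hψ
  have a1 := h ψ hψ
  have a2 := h' ψ hψ
  simp only [add_mul, mul_add]
  have i1 := (hψ.pd i).int_mul hU
  have i2 := (hψ.pd i).int_mul hU'
  simp_rw [mul_comm (pd i ψ _)] at i1 i2
  rw [integral_add i1 i2, integral_add (hψ.int_mul hG) (hψ.int_mul hG'), a1, a2]; ring

/-- smooth function bounded with bounded derivative, as multiplier -/
theorem memLp_mul_of_bdd {f U : Eu n → ℝ} (hf : Continuous f) {C : ℝ} (hC : ∀ x, |f x| ≤ C) (hU : MemLp U 2) :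
    MemLp (fun x => f x * U x) 2 := memLp_bdd_mul hf.aestronglyMeasurable (ae_of_all _ hC) hU

namespace Mini
variable {y : Eu n} {ρ : ℝ} {U : Fin p → Eu n → ℝ} {G : Fin n → Fin p → Eu n → ℝ}

theorem ed_int (S : Mini y ρ U G) : Integrable (ed G) := by
  unfold ed
  exact integrable_finsetSum _ fun i _ => integrable_finsetSum _ fun b _ => (S.memG i b).integrable_sq

theorem pd_cos {ψ : Eu n → ℝ} (h : Differentiable ℝ ψ) (t : ℝ) (i : Fin n) (x : Eu n) :
    pd i (fun x => Real.cos (t * ψ x)) x = - (t * pd i ψ x * Real.sin (t * ψ x)) := by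
  unfold pd
  have := (((h x).hasFDerivAt.const_mul t).cos).fderiv
  rw [this]; simp; ring

theorem pd_sin {ψ : Eu n → ℝ} (h : Differentiable ℝ ψ) (t : ℝ) (i : Fin n) (x : Eu n) :
    pd i (fun x => Real.sin (t * ψ x)) x = (t * pd i ψ x * Real.cos (t * ψ x)) := by
  unfold pd
  have := (((h x).hasFDerivAt.const_mul t).sin).fderiv
  rw [this]; simp; ring

theorem el (S : Mini y ρ U G) (a b : Fin p) (ψ : Eu n → ℝ) (h : Test (ball y ρ) ψ) :
    ∑ i, ∫ x, pd i ψ x * VV U G i a b x = 0 := by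
  by_cases hab : a = b
  · subst hab; simp [VV]
  obtain ⟨σ, hσ, hσ0⟩ := h.exists_radius
  obtain ⟨σ', hσ', hσ'2⟩ := exists_between hσ
  have hpd0 : ∀ i, ∀ x ∉ closedBall y σ, pd i ψ x = 0 := fun i x hx => by
    have : ψ =ᶠ[𝓝 x] fun _ => 0 := by
      filter_upwards [isClosed_closedBall.isOpen_compl.mem_nhds hx] with z hz using hσ0 z hz
    unfold pd; rw [this.fderiv_eq]; simp
  have hmV : ∀ i, MemLp (VV U G i a b) 2 := fun i =>
    (memLp_bdd_mul (S.memU a).1 (by filter_upwards [S.bdd] with x hx using hx a) (S.memG i b)).sub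
      (memLp_bdd_mul (S.memU b).1 (by filter_upwards [S.bdd] with x hx using hx b) (S.memG i a))
  have hi1 : ∀ i, Integrable fun x => pd i ψ x * VV U G i a b x := fun i => (h.pd i).int_mul (hmV i)
  have hi2 : ∀ i, Integrable fun x => (pd i ψ x)^2 * ((U a x)^2 + (U b x)^2) := fun i => by
    have h1 := ((h.pd i).memLp_mul (S.memU a)).integrable_sq.add ((h.pd i).memLp_mul (S.memU b)).integrable_sq
    exact h1.congr (ae_of_all _ fun x => by simp only [Pi.add_apply]; ring)
  set P := ∑ i, ∫ x, pd i ψ x * VV U G i a b x with hP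
  set Q := ∑ i, ∫ x, (pd i ψ x)^2 * ((U a x)^2 + (U b x)^2) with hQ
  have key : ∀ t : ℝ, 0 ≤ 2 * t * P + t^2 * Q := by
    intro t
    have hc : ContDiff ℝ ∞ (fun x => Real.cos (t * ψ x)) := (contDiff_const.mul h.1).cos
    have hs : ContDiff ℝ ∞ (fun x => Real.sin (t * ψ x)) := (contDiff_const.mul h.1).sin
    have hs' : ContDiff ℝ ∞ (fun x => -Real.sin (t * ψ x)) := hs.neg
    have pdn : ∀ i x, pd i (fun x => -Real.sin (t * ψ x)) x = -(t * pd i ψ x * Real.cos (t * ψ x)) := by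
      intro i x
      rw [← pd_sin h.diff t i x]; unfold pd; rw [fderiv_fun_neg]; simp
    set W : Fin p → Eu n → ℝ := fun c x => if c = a then Real.cos (t * ψ x) * U a x + -Real.sin (t * ψ x) * U b x
      else if c = b then Real.sin (t * ψ x) * U a x + Real.cos (t * ψ x) * U b x else U c x with hW
    set H : Fin n → Fin p → Eu n → ℝ := fun i c x =>
      if c = a then (Real.cos (t * ψ x) * G i a x + pd i (fun x => Real.cos (t * ψ x)) x * U a x)
         + (-Real.sin (t * ψ x) * G i b x + pd i (fun x => -Real.sin (t * ψ x)) x * U b x)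
      else if c = b then (Real.sin (t * ψ x) * G i a x + pd i (fun x => Real.sin (t * ψ x)) x * U a x)
         + (Real.cos (t * ψ x) * G i b x + pd i (fun x => Real.cos (t * ψ x)) x * U b x) else G i c x with hH
    have mc : ∀ {V : Eu n → ℝ}, MemLp V 2 → MemLp (fun x => Real.cos (t * ψ x) * V x) 2 := fun hV =>
      memLp_mul_of_bdd hc.continuous (fun x => Real.abs_cos_le_one _) hV
    have ms : ∀ {V : Eu n → ℝ}, MemLp V 2 → MemLp (fun x => Real.sin (t * ψ x) * V x) 2 := fun hV =>
      memLp_mul_of_bdd hs.continuous (fun x => Real.abs_sin_le_one _) hV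
    have ms' : ∀ {V : Eu n → ℝ}, MemLp V 2 → MemLp (fun x => -Real.sin (t * ψ x) * V x) 2 := fun hV =>
      memLp_mul_of_bdd hs'.continuous (fun x => by rw [abs_neg]; exact Real.abs_sin_le_one _) hV
    have mpc : ∀ i {V : Eu n → ℝ}, MemLp V 2 → MemLp (fun x => pd i (fun x => Real.cos (t * ψ x)) x * V x) 2 := by
      intro i V hV
      obtain ⟨M, _, hM⟩ := (h.pd i).bdd
      refine memLp_mul_of_bdd (C := |t| * M) (contDiff_pd hc i).continuous (fun x => ?_) hV
      rw [pd_cos h.diff, abs_neg, abs_mul, abs_mul]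
      exact mul_le_of_le_one_right (by positivity) (Real.abs_sin_le_one _) |>.trans (mul_le_mul_of_nonneg_left (hM x) (abs_nonneg _))
    have mps : ∀ i {V : Eu n → ℝ}, MemLp V 2 → MemLp (fun x => pd i (fun x => Real.sin (t * ψ x)) x * V x) 2 := by
      intro i V hV
      obtain ⟨M, _, hM⟩ := (h.pd i).bdd
      refine memLp_mul_of_bdd (C := |t| * M) (contDiff_pd hs i).continuous (fun x => ?_) hV
      rw [pd_sin h.diff, abs_mul, abs_mul]
      exact mul_le_of_le_one_right (by positivity) (Real.abs_cos_le_one _) |>.trans (mul_le_mul_of_nonneg_left (hM x) (abs_nonneg _))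
    have mps' : ∀ i {V : Eu n → ℝ}, MemLp V 2 → MemLp (fun x => pd i (fun x => -Real.sin (t * ψ x)) x * V x) 2 := by
      intro i V hV
      have := (mps i hV).neg
      refine this.ae_eq (ae_of_all _ fun x => ?_)
      simp only [Pi.neg_apply]; rw [pdn, pd_sin h.diff]; ring
    have hHm : ∀ i c, MemLp (H i c) 2 := by
      intro i c
      simp only [hH]
      split_ifs
      · exact ((mc (S.memG i a)).add (mpc i (S.memU a))).add ((ms' (S.memG i b)).add (mps' i (S.memU b)))
      · exact ((ms (S.memG i a)).add (mps i (S.memU a))).add ((mc (S.memG i b)).add (mpc i (S.memU b)))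
      · exact S.memG i c
    have main := S.min W H σ hσ ?_ hHm ?_ ?_ ?_
    · have e : ∀ x, ed H x = ed G x + ((∑ i, 2 * t * (pd i ψ x * VV U G i a b x)) +
          ∑ i, t^2 * ((pd i ψ x)^2 * ((U a x)^2 + (U b x)^2))) := by
        intro x
        unfold ed
        rw [← Finset.sum_add_distrib, ← Finset.sum_add_distrib]
        refine Finset.sum_congr rfl fun i _ => ?_
        rw [← sub_eq_iff_eq_add', ← Finset.sum_sub_distrib]
        rw [Finset.sum_eq_add a b hab (by rintro c _ ⟨h1, h2⟩; simp [hH, h1, h2]) (by simp) (by simp)]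
        simp only [hH, if_true, if_neg (Ne.symm hab)]
        rw [pdn, pd_cos h.diff, pd_sin h.diff, VV]
        have h1 := Real.sin_sq_add_cos_sq (t * ψ x)
        generalize Real.sin (t * ψ x) = s at *
        generalize Real.cos (t * ψ x) = c at *
        have h2 : s^2 = 1 - c^2 := by linarith
        ring_nf
        have h3 : s^3 = s * (1-c^2) := by rw [← h2]; ring
        have h4 : s^4 = (1-c^2)^2 := by rw [← h2]; ring
        simp only [h2, h3, h4]
        ring
      have j1 : Integrable fun x => (∑ i, 2 * t * (pd i ψ x * VV U G i a b x)) :=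
        integrable_finsetSum _ fun i _ => (hi1 i).const_mul _
      have j2 : Integrable fun x => ∑ i, t^2 * ((pd i ψ x)^2 * ((U a x)^2 + (U b x)^2)) :=
        integrable_finsetSum _ fun i _ => (hi2 i).const_mul _
      have j3 : Integrable fun x => (∑ i, 2 * t * (pd i ψ x * VV U G i a b x)) +
          ∑ i, t^2 * ((pd i ψ x)^2 * ((U a x)^2 + (U b x)^2)) := j1.add j2
      simp_rw [e] at main
      rw [integral_add S.ed_int j3, integral_add j1 j2, integral_finsetSum _ fun i _ => (hi1 i).const_mul _,
        integral_finsetSum _ fun i _ => (hi2 i).const_mul _] at main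
      simp_rw [integral_const_mul, ← Finset.mul_sum] at main
      linarith
    · intro c
      simp only [hW]
      split_ifs
      · exact (mc (S.memU a)).add (ms' (S.memU b))
      · exact (ms (S.memU a)).add (mc (S.memU b))
      · exact S.memU c
    · intro i c
      simp only [hW, hH]
      split_ifs
      · exact ((S.wd i a).mul (S.memU a) (S.memG i a) hc).add ((S.wd i b).mul (S.memU b) (S.memG i b) hs')
          (mc (S.memU a)) ((mc (S.memG i a)).add (mpc i (S.memU a))) (ms' (S.memU b)) ((ms' (S.memG i b)).add (mps' i (S.memU b)))
      · exact ((S.wd i a).mul (S.memU a) (S.memG i a) hs).add ((S.wd i b).mul (S.memU b) (S.memG i b) hc)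
          (ms (S.memU a)) ((ms (S.memG i a)).add (mps i (S.memU a))) (mc (S.memU b)) ((mc (S.memG i b)).add (mpc i (S.memU b)))
      · exact S.wd i c
    · filter_upwards [S.sph] with x hx hb
      rw [← hx hb, ← sub_eq_zero, ← Finset.sum_sub_distrib]
      rw [Finset.sum_eq_add a b hab (by rintro c _ ⟨h1, h2⟩; simp [hW, h1, h2]) (by simp) (by simp)]
      simp only [hW, if_true, if_neg (Ne.symm hab)]
      have h1 := Real.sin_sq_add_cos_sq (t * ψ x)
      generalize Real.sin (t * ψ x) = s at *
      generalize Real.cos (t * ψ x) = c at *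
      linear_combination ((U a x)^2 + (U b x)^2) * h1
    · intro x hx
      have h0 := hσ0 x hx
      refine ⟨fun c => ?_, fun i c => ?_⟩
      · simp only [hW, h0]
        split_ifs with h1 h2 <;> simp [*]
      · simp only [hH, pdn, pd_cos h.diff, pd_sin h.diff, hpd0 i x hx, h0]
        split_ifs with h1 h2 <;> simp [*]
  by_contra hne
  have hQ0 : 0 ≤ Q := Finset.sum_nonneg fun i _ => integral_nonneg fun x => by positivity
  have := key (-(P / (Q+1)))
  have h1 : 2 * (-(P / (Q+1))) * P + (-(P / (Q+1)))^2 * Q = -(P^2 * (Q + 2) / (Q+1)^2) := by field_simp; ring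
  rw [h1] at this
  have : 0 < P^2 * (Q+2) / (Q+1)^2 := by positivity
  linarith

theorem toSys (S : Mini y ρ U G) : Sys y ρ U G :=
  ⟨S.hn, S.memU, S.memG, S.wd, S.bdd, S.sph, S.el⟩

end Mini
end

section
open scoped ContDiff Topology Convolution

variable {n p : ℕ}

theorem bdd_of_const {f : Eu n → ℝ} (hf : Continuous f) {y : Eu n} {σ c : ℝ} (h : ∀ x ∉ closedBall y σ, f x = c) :
    ∃ M : ℝ, 0 ≤ M ∧ ∀ x, |f x| ≤ M := by
  obtain ⟨C, hC⟩ := (isCompact_closedBall y σ).exists_bound_of_continuousOn hf.continuousOn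
  refine ⟨max C |c|, le_max_of_le_right (abs_nonneg _), fun x => ?_⟩
  by_cases hx : x ∈ closedBall y σ
  · exact (hC x hx).trans (le_max_left _ _)
  · rw [h x hx]; exact le_max_right _ _

structure Diffeo (y : Eu n) (σ : ℝ) (e : Eu n ≃ₜ Eu n) (A : Eu n → (Eu n ≃L[ℝ] Eu n)) : Prop where
  smooth : ContDiff ℝ ∞ e
  deriv : ∀ z, HasFDerivAt e (A z : Eu n →L[ℝ] Eu n) z
  id1 : ∀ z ∉ closedBall y σ, e z = z
  id2 : ∀ z ∉ closedBall y σ, A z = ContinuousLinearEquiv.refl ℝ (Eu n)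

namespace Diffeo
variable {y : Eu n} {σ : ℝ} {e : Eu n ≃ₜ Eu n} {A : Eu n → (Eu n ≃L[ℝ] Eu n)}

def J (A : Eu n → (Eu n ≃L[ℝ] Eu n)) (z : Eu n) : ℝ := |(A z : Eu n →L[ℝ] Eu n).det|
def B (A : Eu n → (Eu n ≃L[ℝ] Eu n)) (i l : Fin n) (z : Eu n) : ℝ := ((A z).symm (EuclideanSpace.single i 1)) l

theorem symm_smooth (D : Diffeo y σ e A) : ContDiff ℝ ∞ e.symm := e.contDiff_symm D.deriv D.smooth

theorem symm_deriv (D : Diffeo y σ e A) (x : Eu n) :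
    HasFDerivAt e.symm ((A (e.symm x)).symm : Eu n →L[ℝ] Eu n) x :=
  (D.deriv _).of_local_left_inverse e.symm.continuous.continuousAt
    (Eventually.of_forall fun z => e.apply_symm_apply z)

theorem contJ (D : Diffeo y σ e A) : Continuous (J A) := by
  have h : J A = fun z => |(fderiv ℝ e z).det| := by
    funext z; rw [(D.deriv z).fderiv]; rfl
  rw [h]
  exact (ContinuousLinearMap.continuous_det.comp (D.smooth.continuous_fderiv (by simp))).abs

theorem contB (D : Diffeo y σ e A) (i l : Fin n) : Continuous (B A i l) := by
  have h : B A i l = fun z => (fderiv ℝ e.symm (e z) (EuclideanSpace.single i 1)) l := by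
    funext z; rw [(D.symm_deriv _).fderiv, e.symm_apply_apply]; rfl
  rw [h]
  have h1 := (D.symm_smooth.continuous_fderiv (by simp)).comp e.continuous
  have h2 := h1.clm_apply (continuous_const (y := EuclideanSpace.single i (1:ℝ)))
  exact (EuclideanSpace.proj (𝕜 := ℝ) l).continuous.comp h2

theorem bddJ (D : Diffeo y σ e A) : ∃ M : ℝ, 0 ≤ M ∧ ∀ x, |J A x| ≤ M :=
  bdd_of_const D.contJ (c := J (fun _ => ContinuousLinearEquiv.refl ℝ (Eu n)) 0) fun x hx => by
    unfold J; rw [D.id2 x hx]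

theorem bddB (D : Diffeo y σ e A) (i l : Fin n) : ∃ M : ℝ, 0 ≤ M ∧ ∀ x, |B A i l x| ≤ M :=
  bdd_of_const (D.contB i l) (c := B (fun _ => ContinuousLinearEquiv.refl ℝ (Eu n)) i l 0) fun x hx => by
    unfold B; rw [D.id2 x hx]

theorem cov (D : Diffeo y σ e A) (f : Eu n → ℝ) : ∫ x, f x = ∫ z, J A z * f (e z) := by
  have := integral_image_eq_integral_abs_det_fderiv_smul (μ := (volume : Measure (Eu n))) (s := univ) MeasurableSet.univ
    (fun x _ => (D.deriv x).hasFDerivWithinAt) e.injective.injOn f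
  rw [image_univ, e.surjective.range_eq, Measure.restrict_univ] at this
  exact this

theorem cov_int (D : Diffeo y σ e A) (f : Eu n → ℝ) : Integrable f ↔ Integrable fun z => J A z * f (e z) := by
  have := integrableOn_image_iff_integrableOn_abs_det_fderiv_smul (μ := (volume : Measure (Eu n))) (s := univ) MeasurableSet.univ
    (fun x _ => (D.deriv x).hasFDerivWithinAt) e.injective.injOn f
  rw [image_univ, e.surjective.range_eq, integrableOn_univ, integrableOn_univ] at this
  exact this

theorem qmp (D : Diffeo y σ e A) : Measure.QuasiMeasurePreserving e.symm (volume : Measure (Eu n)) volume := by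
  refine ⟨e.symm.continuous.measurable, Measure.AbsolutelyContinuous.mk fun s hs h0 => ?_⟩
  rw [Measure.map_apply e.symm.continuous.measurable hs]
  have : e.symm ⁻¹' s = e '' s := by
    rw [e.image_eq_preimage_symm]
  rw [this]
  exact addHaar_image_eq_zero_of_differentiableOn_of_addHaar_eq_zero _
    (fun x _ => (D.deriv x).differentiableAt.differentiableWithinAt) h0

theorem memLp_comp (D : Diffeo y σ e A) {f : Eu n → ℝ} (hf : MemLp f 2) : MemLp (fun x => f (e.symm x)) 2 := by
  have hm : AEStronglyMeasurable (fun x => f (e.symm x)) volume := hf.1.comp_quasiMeasurePreserving D.qmp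
  rw [memLp_two_iff_integrable_sq hm, D.cov_int]
  simp only [e.symm_apply_apply]
  obtain ⟨M, _, hM⟩ := D.bddJ
  exact Integrable.bdd_mul (c := M) hf.integrable_sq D.contJ.aestronglyMeasurable (ae_of_all _ hM)

theorem pd_comp (D : Diffeo y σ e A) {v : Eu n → ℝ} (hv : ContDiff ℝ ∞ v) (i : Fin n) (x : Eu n) :
    pd i (fun x => v (e.symm x)) x = ∑ l, B A i l (e.symm x) * pd l v (e.symm x) := by
  have h1 := ((hv.differentiable (by simp) (e.symm x)).hasFDerivAt.comp x (D.symm_deriv x)).fderiv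
  simp only [Function.comp_def] at h1
  unfold pd
  rw [h1]
  simp only [ContinuousLinearMap.comp_apply]
  rw [fderiv_eq_sum_pd]; rfl

theorem mem_ball_iff (D : Diffeo y σ e A) {ρ : ℝ} (hσ : σ < ρ) {x : Eu n} (hx : x ∈ ball y ρ) : e.symm x ∈ ball y ρ := by
  by_contra h
  have h1 : e.symm x ∉ closedBall y σ := fun h' => h (closedBall_subset_ball hσ h')
  have h2 := D.id1 _ h1
  rw [e.apply_symm_apply] at h2
  rw [← h2] at h
  exact h hx

theorem wd_comp (D : Diffeo y σ e A) {ρ : ℝ} (hσ : σ < ρ) (hn : 0 < n) {U : Eu n → ℝ} {G : Fin n → Eu n → ℝ}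
    (hU : MemLp U 2) (hG : ∀ l, MemLp (G l) 2) (hW : ∀ l, WD (ball y ρ) l U (G l)) (i : Fin n) :
    WD (ball y ρ) i (fun x => U (e.symm x)) (fun x => ∑ l, B A i l (e.symm x) * G l (e.symm x)) := by
  intro ψ h
  obtain ⟨s, hs, hs0⟩ := h.exists_radius
  have cψ : HasCompactSupport fun z => ψ (e z) := h.cpt.comp_homeomorph e
  have cpψ : HasCompactSupport fun z => pd i ψ (e z) := (h.pd i).cpt.comp_homeomorph e
  have hψc := h.continuous.comp e.continuous
  have hpψc := (h.pd i).continuous.comp e.continuous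
  have hbc : ∀ l, Continuous fun z => J A z * B A i l z * ψ (e z) := fun l => (D.contJ.mul (D.contB i l)).mul hψc
  have hbs : ∀ l, HasCompactSupport fun z => J A z * B A i l z * ψ (e z) := fun l => cψ.mul_left
  have hac : Continuous fun z => J A z * pd i ψ (e z) := D.contJ.mul hpψc
  have has : HasCompactSupport fun z => J A z * pd i ψ (e z) := cpψ.mul_left
  have hbm : ∀ l, MemLp (fun z => J A z * B A i l z * ψ (e z)) 2 := fun l => (hbc l).memLp_of_hasCompactSupport (hbs l)
  have key := approx_id (max_lt hs hσ) hn hU hG hW (a := fun z => J A z * pd i ψ (e z))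
    (b := fun l z => J A z * B A i l z * ψ (e z)) (hac.memLp_of_hasCompactSupport has)
    hbm
    (by
      intro l x hx
      have h1 : x ∉ closedBall y s := fun h' => hx (closedBall_subset_closedBall (le_max_left _ _) h')
      have h2 : x ∉ closedBall y σ := fun h' => hx (closedBall_subset_closedBall (le_max_right _ _) h')
      rw [D.id1 x h2, hs0 x h1, mul_zero])
    (by
      intro v hv
      have hvc : ContDiff ℝ ∞ fun x => v (e.symm x) := hv.comp D.symm_smooth
      have h0 := integral_pd_eq_zero (h.mul hvc) i
      have e1 : ∀ x, pd i (fun x => ψ x * v (e.symm x)) x = pd i ψ x * v (e.symm x) +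
          ψ x * ∑ l, B A i l (e.symm x) * pd l v (e.symm x) := fun x => by
        rw [← D.pd_comp hv]
        exact pd_mul i (h.diff x) (hvc.differentiable (by simp) x)
      simp_rw [e1] at h0
      rw [D.cov] at h0
      simp only [e.symm_apply_apply] at h0
      have i1 : Integrable fun z => J A z * pd i ψ (e z) * v z :=
        (hac.mul hv.continuous).integrable_of_hasCompactSupport has.mul_right
      have i2 : ∀ l, Integrable fun z => J A z * B A i l z * ψ (e z) * pd l v z := fun l =>
        ((hbc l).mul (contDiff_pd hv l).continuous).integrable_of_hasCompactSupport (hbs l).mul_right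
      rw [← integral_finsetSum _ fun l _ => i2 l, ← integral_add i1 (integrable_finsetSum _ fun l _ => i2 l), ← h0]
      congr 1; funext z
      rw [mul_add, Finset.mul_sum, Finset.mul_sum]
      congr 1
      · ring
      · exact Finset.sum_congr rfl fun l _ => by ring)
  rw [D.cov, D.cov (fun x => ψ x * ∑ l, B A i l (e.symm x) * G l (e.symm x))]
  simp only [e.symm_apply_apply]
  have j2 : ∀ l, Integrable fun z => J A z * B A i l z * ψ (e z) * G l z := fun l => memLp_mul (hbm l) (hG l)
  rw [← integral_finsetSum _ fun l _ => j2 l] at key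
  have e1 : ∫ z, J A z * (U z * pd i ψ (e z)) = ∫ z, J A z * pd i ψ (e z) * U z := by
    congr 1; funext z; ring
  have e2 : ∫ z, J A z * (ψ (e z) * ∑ l, B A i l z * G l z) = ∫ z, ∑ l, J A z * B A i l z * ψ (e z) * G l z := by
    congr 1; funext z
    rw [Finset.mul_sum, Finset.mul_sum]
    exact Finset.sum_congr rfl fun l _ => by ring
  rw [e1, e2]; linarith

end Diffeo

theorem Mini.dv {y : Eu n} {ρ : ℝ} {U : Fin p → Eu n → ℝ} {G : Fin n → Fin p → Eu n → ℝ} (S : Mini y ρ U G)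
    {σ : ℝ} (hσ : σ < ρ) {e : Eu n ≃ₜ Eu n} {A : Eu n → (Eu n ≃L[ℝ] Eu n)} (D : Diffeo y σ e A) :
    ∫ x, ed G x ≤ ∫ z, Diffeo.J A z * ∑ i, ∑ a, (∑ l, Diffeo.B A i l z * G l a z)^2 := by
  have main := S.min (fun a x => U a (e.symm x)) (fun i a x => ∑ l, Diffeo.B A i l (e.symm x) * G l a (e.symm x)) σ hσ
    (fun a => D.memLp_comp (S.memU a))
    (fun i a => by
      refine D.memLp_comp (f := fun z => ∑ l, Diffeo.B A i l z * G l a z) ?_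
      refine memLp_finsetSum _ fun l _ => ?_
      obtain ⟨M, _, hM⟩ := D.bddB i l
      exact memLp_mul_of_bdd (D.contB i l) hM (S.memG l a))
    (fun i a => D.wd_comp hσ S.hn (S.memU a) (fun l => S.memG l a) (fun l => S.wd l a) i)
    (by
      filter_upwards [D.qmp.ae S.sph] with x hx hb
      exact hx (D.mem_ball_iff hσ hb))
    (by
      intro x hx
      have h1 : e.symm x = x := by
        rw [e.symm_apply_eq, D.id1 x hx]
      refine ⟨fun a => by simp only [h1], fun i a => ?_⟩
      simp only [h1]
      unfold Diffeo.B
      rw [D.id2 x hx, Finset.sum_eq_single i]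
      · simp
      · intro l _ hl; simp [hl]
      · simp)
  refine main.trans (le_of_eq ?_)
  rw [D.cov]
  simp only [ed, e.symm_apply_apply]
end

section
open scoped ContDiff Topology Convolution

variable {n p : ℕ}

theorem pow_bern (m : ℕ) {x : ℝ} (h0 : 0 ≤ x) (h1 : x ≤ 1) : (1 - x)^m ≤ 1 - m * x + m^2 * x^2 := by
  induction m with
  | zero => simp
  | succ m ih =>
    rw [pow_succ]
    have := mul_le_mul_of_nonneg_right ih (by linarith : 0 ≤ 1 - x)
    refine this.trans ?_
    push_cast
    have h2 : (0:ℝ) ≤ m := by positivity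
    have h3 : 0 ≤ (m:ℝ)^2 * x^3 := by positivity
    have h4 : 0 ≤ (m:ℝ) * x^2 := by positivity
    nlinarith [sq_nonneg x]

theorem expand_bound (m : ℕ) {t χ k X : ℝ} (ht : 0 ≤ t) (ht1 : t ≤ 1) (hχ : 0 ≤ χ) (hX : χ ≤ X) (hk : 0 ≤ k) (hkX : k ≤ X)
    (htX : t * X ≤ 1/2) : (1 - t*χ)^m * (1 - t*χ + 2*t*k) ≤
      1 - t * ((m+1) * χ - 2 * k) + t^2 * (m * X^2 + m^2 * X^2 * (1 + 2*X)) := by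
  have h1 : t*χ ≤ 1/2 := (mul_le_mul_of_nonneg_left hX ht).trans htX
  have h0 : 0 ≤ t * χ := by positivity
  have h2 : 0 ≤ 1 - t*χ + 2*t*k := by
    have : 0 ≤ t * k := by positivity
    linarith
  have h3 := mul_le_mul_of_nonneg_right (pow_bern m h0 (by linarith)) h2
  refine h3.trans ?_
  have hX0 : 0 ≤ X := hχ.trans hX
  have hm : (0:ℝ) ≤ m := by positivity
  have a1 : χ^2 ≤ X^2 := pow_le_pow_left₀ hχ hX 2
  have a2 : t * k ≤ X := by
    calc t * k ≤ 1 * X := mul_le_mul ht1 hkX hk zero_le_one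
      _ = X := one_mul _
  have a3 : χ^2 * (1 - t*χ + 2*t*k) ≤ X^2 * (1 + 2*X) :=
    mul_le_mul a1 (by linarith) h2 (by positivity)
  have e : (1 - m * (t*χ) + m^2 * (t*χ)^2) * (1 - t*χ + 2*t*k) =
      1 - t * ((m+1) * χ - 2 * k) + t^2 * (m * χ^2 - 2 * (m * χ * k) + m^2 * (χ^2 * (1 - t*χ + 2*t*k))) := by ring
  rw [e]
  have a4 : 0 ≤ m * χ * k := by positivity
  have a5 := mul_le_mul_of_nonneg_left a1 hm
  have a6 := mul_le_mul_of_nonneg_left a3 (by positivity : 0 ≤ (m:ℝ)^2)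
  have : t^2 * (m * χ^2 - 2 * (m * χ * k) + m^2 * (χ^2 * (1 - t*χ + 2*t*k))) ≤ t^2 * (m * X^2 + m^2 * X^2 * (1 + 2*X)) :=
    mul_le_mul_of_nonneg_left (by linarith) (by positivity)
  linarith

/-- `v ↦ c v + m ⟨z,v⟩ z` -/
def radL (c m : ℝ) (z : Eu n) : Eu n →L[ℝ] Eu n :=
  c • ContinuousLinearMap.id ℝ (Eu n) + m • (innerSL ℝ z).smulRight z

theorem radL_apply (c m : ℝ) (z v : Eu n) : radL c m z v = c • v + m • (inner ℝ z v • z) := by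
  simp [radL]

theorem rad_inv {c m : ℝ} (hc : 0 < c) (hm : 0 ≤ m) (z v : Eu n) :
    radL c⁻¹ (-(c⁻¹ * (m / (c + m * ‖z‖^2)))) z (radL c m z v) = v := by
  have h : 0 < c + m * ‖z‖^2 := by positivity
  simp only [radL_apply, inner_add_right, inner_smul_right, real_inner_self_eq_norm_sq, smul_smul, smul_add]
  rw [inv_mul_cancel₀ hc.ne', one_smul, add_assoc, ← add_smul]
  convert add_zero v
  rw [smul_eq_zero]; left
  field_simp; ring

theorem rad_inv' {c m : ℝ} (hc : 0 < c) (hm : 0 ≤ m) (z v : Eu n) :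
    radL c m z (radL c⁻¹ (-(c⁻¹ * (m / (c + m * ‖z‖^2)))) z v) = v := by
  have h : 0 < c + m * ‖z‖^2 := by positivity
  simp only [radL_apply, inner_add_right, inner_smul_right, real_inner_self_eq_norm_sq, smul_smul, smul_add]
  rw [mul_inv_cancel₀ hc.ne', one_smul, add_assoc, ← add_smul]
  convert add_zero v
  rw [smul_eq_zero]; left
  field_simp; ring

def radE {c m : ℝ} (hc : 0 < c) (hm : 0 ≤ m) (z : Eu n) : Eu n ≃L[ℝ] Eu n :=
  ContinuousLinearEquiv.equivOfInverse (radL c m z) (radL c⁻¹ (-(c⁻¹ * (m / (c + m * ‖z‖^2)))) z)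
    (rad_inv hc hm z) (rad_inv' hc hm z)

theorem radL_det {c : ℝ} (hc : 0 < c) (m : ℝ) (z : Eu n) : (radL c m z).det = c^n * (1 + m / c * ‖z‖^2) := by
  have h : ((radL c m z : Eu n →L[ℝ] Eu n) : Eu n →ₗ[ℝ] Eu n) =
      c • LinearMap.transvection ((m/c) • (innerSL ℝ z : Eu n →L[ℝ] ℝ).toLinearMap) z := by
    ext1 v
    simp only [ContinuousLinearMap.coe_coe, radL_apply, LinearMap.smul_apply, LinearMap.transvection.apply, smul_add, smul_smul,
      smul_eq_mul, innerSL_apply_apply]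
    congr 2
    field_simp
  unfold ContinuousLinearMap.det
  rw [h, LinearMap.det_smul, LinearMap.transvection.det]
  simp [real_inner_self_eq_norm_sq]

theorem rad_energy {c m : ℝ} (hc : 0 < c) (hm : 0 ≤ m) (z : Eu n) (q : Fin n → ℝ) :
    ∑ i, (∑ l, ((radE hc hm z).symm (EuclideanSpace.single i 1)) l * q l)^2 ≤ (c⁻¹)^2 * ∑ i, (q i)^2 := by
  set μ := m / (c + m * ‖z‖^2) with hμ
  have hpos : 0 < c + m * ‖z‖^2 := by positivity
  have hμ0 : 0 ≤ μ := by positivity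
  have hμ1 : μ * ‖z‖^2 ≤ 1 := by
    rw [hμ, div_mul_eq_mul_div, div_le_one hpos]; linarith
  set Q := ∑ l, z l * q l with hQ
  have e1 : ∀ i, ∑ l, ((radE hc hm z).symm (EuclideanSpace.single i 1)) l * q l = c⁻¹ * (q i - μ * Q * z i) := by
    intro i
    have : ∀ l, ((radE hc hm z).symm (EuclideanSpace.single i 1)) l * q l =
        c⁻¹ * ((if l = i then q l else 0) - μ * z i * (z l * q l)) := by
      intro l
      have : (radE hc hm z).symm (EuclideanSpace.single i 1) = radL c⁻¹ (-(c⁻¹ * μ)) z (EuclideanSpace.single i 1) := rfl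
      rw [this, radL_apply]
      simp only [PiLp.add_apply, PiLp.smul_apply, smul_eq_mul, EuclideanSpace.inner_single_right, PiLp.single_apply]
      split_ifs <;> simp <;> ring
    simp_rw [this]
    rw [← Finset.mul_sum, Finset.sum_sub_distrib, ← Finset.mul_sum, ← hQ]
    simp
    left; ring
  simp_rw [e1]
  have e2 : ∑ i, (c⁻¹ * (q i - μ * Q * z i))^2 = (c⁻¹)^2 * ((∑ i, (q i)^2) - μ * Q^2 * (2 - μ * ‖z‖^2)) := by
    rw [EuclideanSpace.real_norm_sq_eq]
    have : ∀ i, (c⁻¹ * (q i - μ * Q * z i))^2 = (c⁻¹)^2 * ((q i)^2 - 2 * μ * Q * (z i * q i) + μ^2 * Q^2 * (z i)^2) := fun i => by ring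
    simp_rw [this]
    rw [← Finset.mul_sum, Finset.sum_add_distrib, Finset.sum_sub_distrib, ← Finset.mul_sum, ← Finset.mul_sum, ← hQ]
    ring
  rw [e2]
  refine mul_le_mul_of_nonneg_left ?_ (by positivity)
  have : 0 ≤ μ * Q^2 * (2 - μ * ‖z‖^2) := mul_nonneg (by positivity) (by linarith)
  linarith

structure Cut (n : ℕ) (r X : ℝ) (χ κ : ℝ → ℝ) : Prop where
  smooth : ContDiff ℝ ∞ (fun z : Eu n => χ (‖z‖^2))
  cont : Continuous (fun z : Eu n => κ (‖z‖^2))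
  der : ∀ s, 0 ≤ s → HasDerivAt χ (-κ s) s
  chi0 : ∀ s, 0 ≤ s → 0 ≤ χ s
  chi1 : ∀ s, 0 ≤ s → χ s ≤ X
  kap0 : ∀ s, 0 ≤ s → 0 ≤ κ s
  kap1 : ∀ s, 0 ≤ s → s * κ s ≤ X
  out : ∀ s, r^2 ≤ s → χ s = 0 ∧ κ s = 0

theorem exists_diffeo (hn : 0 < n) {r X : ℝ} {χ κ : ℝ → ℝ} (hr : 0 < r) (C : Cut n r X χ κ) (x0 : Eu n) :
    ∃ L : ℝ, 0 < L ∧ ∀ t, 0 < t → t * L ≤ 1/2 → t * X ≤ 1/2 → ∀ y σ, closedBall x0 r ⊆ closedBall y σ →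
    ∃ (hc : ∀ z, 0 < 1 - t * χ (‖z - x0‖^2)) (hm : ∀ z, 0 ≤ 2 * t * κ (‖z - x0‖^2)) (e : Eu n ≃ₜ Eu n),
      Diffeo y σ e (fun z => radE (hc z) (hm z) (z - x0)) := by
  set ζ : Eu n → Eu n := fun w => χ (‖w‖^2) • w with hζ
  have hζs : ContDiff ℝ ∞ ζ := C.smooth.smul contDiff_id
  have hout : ∀ w : Eu n, w ∉ ball 0 r → χ (‖w‖^2) = 0 ∧ κ (‖w‖^2) = 0 := by
    intro w hw
    rw [mem_ball_zero_iff, not_lt] at hw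
    exact C.out _ (pow_le_pow_left₀ hr.le hw 2)
  have hζc : HasCompactSupport ζ := HasCompactSupport.intro (isCompact_closedBall 0 r) fun w hw => by
    simp only [hζ]
    rw [(hout w fun h => hw (ball_subset_closedBall h)).1, zero_smul]
  obtain ⟨L, hL⟩ := hζs.lipschitzWith_of_hasCompactSupport hζc (by simp)
  refine ⟨L + 1, by positivity, fun t ht htL htX y σ hsub => ?_⟩
  have hc : ∀ z, 0 < 1 - t * χ (‖z - x0‖^2) := fun z => by
    have := mul_le_mul_of_nonneg_left (C.chi1 (‖z - x0‖^2) (by positivity)) ht.le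
    linarith
  have hm : ∀ z, 0 ≤ 2 * t * κ (‖z - x0‖^2) := fun z => by
    have := C.kap0 (‖z - x0‖^2) (by positivity)
    positivity
  set φ : Eu n → Eu n := fun z => z - t • ζ (z - x0) with hφ
  have hφs : ContDiff ℝ ∞ φ := contDiff_id.sub ((hζs.comp (contDiff_id.sub contDiff_const)).const_smul t)
  have hφd : ∀ z, HasFDerivAt φ (radE (hc z) (hm z) (z - x0) : Eu n →L[ℝ] Eu n) z := by
    intro z
    have h1 : HasFDerivAt (fun w : Eu n => χ (‖w‖^2)) ((-κ (‖z-x0‖^2)) • ((2:ℕ) • innerSL ℝ (z - x0))) (z - x0) :=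
      (C.der _ (by positivity)).comp_hasFDerivAt (z - x0) (hasStrictFDerivAt_norm_sq (z - x0)).hasFDerivAt
    have h2 := h1.smul (hasFDerivAt_id (𝕜 := ℝ) (z - x0))
    have h3 : HasFDerivAt (fun z : Eu n => z - x0) (ContinuousLinearMap.id ℝ (Eu n)) z :=
      (hasFDerivAt_id (𝕜 := ℝ) z).sub_const x0
    have h4 := (hasFDerivAt_id (𝕜 := ℝ) z).sub ((h2.comp z h3).const_smul t)
    refine h4.congr_fderiv ?_
    ext1 v
    have : (radE (hc z) (hm z) (z - x0) : Eu n →L[ℝ] Eu n) v = radL (1 - t * χ (‖z - x0‖^2)) (2 * t * κ (‖z - x0‖^2)) (z - x0) v := rfl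
    rw [this, radL_apply]
    simp only [ContinuousLinearMap.sub_apply, ContinuousLinearMap.id_apply, ContinuousLinearMap.smul_apply,
      ContinuousLinearMap.comp_apply, ContinuousLinearMap.add_apply, ContinuousLinearMap.smulRight_apply, id, innerSL_apply_apply]
    simp only [smul_eq_mul, nsmul_eq_mul]
    push_cast
    module
  have hne : Nonempty (Fin n) := ⟨⟨0, hn⟩⟩
  set c : NNReal := Real.toNNReal t * L with hcdef
  have hap : ApproximatesLinearOn φ ((ContinuousLinearEquiv.refl ℝ (Eu n) : Eu n ≃L[ℝ] Eu n) : Eu n →L[ℝ] Eu n) univ c := by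
    rw [ApproximatesLinearOn.approximatesLinearOn_iff_lipschitzOnWith]
    rw [lipschitzOnWith_univ]
    refine LipschitzWith.of_dist_le_mul fun a b => ?_
    have := hL.dist_le_mul (a - x0) (b - x0)
    rw [dist_sub_right] at this
    have e : ∀ a, (φ - ⇑((ContinuousLinearEquiv.refl ℝ (Eu n) : Eu n ≃L[ℝ] Eu n) : Eu n →L[ℝ] Eu n)) a = - (t • ζ (a - x0)) := by
      intro a; simp [hφ]
    rw [e, e, dist_neg_neg, dist_smul₀, Real.norm_eq_abs, abs_of_pos ht]
    rw [hcdef, NNReal.coe_mul, Real.coe_toNNReal t ht.le, mul_assoc]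
    exact mul_le_mul_of_nonneg_left this ht.le
  have hcN : c < ‖((ContinuousLinearEquiv.refl ℝ (Eu n)).symm : Eu n →L[ℝ] Eu n)‖₊⁻¹ := by
    have : ‖((ContinuousLinearEquiv.refl ℝ (Eu n)).symm : Eu n →L[ℝ] Eu n)‖₊ = 1 := by
      have := ContinuousLinearMap.norm_id (𝕜 := ℝ) (E := Eu n)
      exact NNReal.eq this
    rw [this, inv_one, ← NNReal.coe_lt_coe, hcdef, NNReal.coe_mul, Real.coe_toNNReal t ht.le, NNReal.coe_one]
    nlinarith [L.coe_nonneg]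
  refine ⟨hc, hm, hap.toHomeomorph φ (Or.inr hcN), ?_⟩
  have hcoe : ⇑(hap.toHomeomorph φ (Or.inr hcN)) = φ := rfl
  have hz0 : ∀ z ∉ closedBall y σ, z - x0 ∉ ball (0 : Eu n) r := fun z hz h => by
    apply hz; apply hsub
    rw [mem_ball_zero_iff] at h
    rw [mem_closedBall, dist_eq_norm]; exact h.le
  refine ⟨by rw [hcoe]; exact hφs, by rw [hcoe]; exact hφd, ?_, ?_⟩
  · intro z hz
    rw [hcoe]
    simp [hφ, hζ, (hout _ (hz0 z hz)).1]
  · intro z hz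
    apply ContinuousLinearEquiv.ext
    funext v
    have : radE (hc z) (hm z) (z - x0) v = radL (1 - t * χ (‖z - x0‖^2)) (2 * t * κ (‖z - x0‖^2)) (z - x0) v := rfl
    refine this.trans ?_
    rw [radL_apply, (hout _ (hz0 z hz)).1, (hout _ (hz0 z hz)).2]
    simp

theorem Mini.first_var {y : Eu n} {ρ : ℝ} {U : Fin p → Eu n → ℝ} {G : Fin n → Fin p → Eu n → ℝ} (S : Mini y ρ U G)
    (hn : 3 ≤ n) {σ : ℝ} (hσ : σ < ρ) {r X : ℝ} {χ κ : ℝ → ℝ} (hr : 0 < r) (C : Cut n r X χ κ) (x0 : Eu n)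
    (hsub : closedBall x0 r ⊆ closedBall y σ) :
    (Integrable fun z => ed G z * ((n - 2) * χ (‖z - x0‖^2) - 2 * (‖z - x0‖^2 * κ (‖z - x0‖^2)))) ∧
    ∫ z, ed G z * ((n - 2) * χ (‖z - x0‖^2) - 2 * (‖z - x0‖^2 * κ (‖z - x0‖^2))) ≤ 0 := by
  obtain ⟨m, rfl⟩ : ∃ m, n = m + 3 := ⟨n - 3, by omega⟩
  obtain ⟨L, hL, H⟩ := exists_diffeo S.hn hr C x0
  have hX0 : 0 ≤ X := (C.chi0 0 le_rfl).trans (C.chi1 0 le_rfl)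
  set F : Eu (m+3) → ℝ := fun z => ((m:ℝ)+1) * χ (‖z - x0‖^2) - 2 * (‖z - x0‖^2 * κ (‖z - x0‖^2)) with hF
  have hFe : ∀ z : Eu (m+3), (((m + 3 : ℕ):ℝ) - 2) * χ (‖z - x0‖^2) - 2 * (‖z - x0‖^2 * κ (‖z - x0‖^2)) = F z := by
    intro z; simp only [hF]; push_cast; ring
  simp_rw [hFe]
  have hFc : Continuous F := by
    have h1 : Continuous fun z : Eu (m+3) => χ (‖z - x0‖^2) := C.smooth.continuous.comp (continuous_id.sub continuous_const)
    have h2 : Continuous fun z : Eu (m+3) => κ (‖z - x0‖^2) := C.cont.comp (continuous_id.sub continuous_const)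
    show Continuous fun z : Eu (m+3) => ((m:ℝ)+1) * χ (‖z - x0‖^2) - 2 * (‖z - x0‖^2 * κ (‖z - x0‖^2))
    exact (continuous_const.mul h1).sub (continuous_const.mul (((continuous_id.sub continuous_const).norm.pow 2).mul h2))
  have hFb : ∀ z, |F z| ≤ (m+1) * X + 2 * X := by
    intro z
    have hs : 0 ≤ ‖z - x0‖^2 := by positivity
    have a1 := C.chi0 _ hs
    have a2 := mul_le_mul_of_nonneg_left (C.chi1 _ hs) (by positivity : (0:ℝ) ≤ m+1)
    have a3 := mul_nonneg hs (C.kap0 _ hs)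
    have a4 := C.kap1 _ hs
    have a5 : 0 ≤ ((m:ℝ)+1) * χ (‖z - x0‖^2) := by positivity
    rw [abs_le]; simp only [hF]
    constructor <;> nlinarith
  have hFi : Integrable fun z => ed G z * F z := by
    have := Integrable.bdd_mul (c := (m+1) * X + 2 * X) S.ed_int hFc.aestronglyMeasurable (ae_of_all _ hFb)
    exact this.congr (ae_of_all _ fun z => mul_comm _ _)
  set K := m * X^2 + m^2 * X^2 * (1 + 2*X) with hK
  have hK0 : 0 ≤ K := by positivity
  have key : ∀ t, 0 < t → t ≤ 1 → t * L ≤ 1/2 → t * X ≤ 1/2 → ∫ z, ed G z * F z ≤ t * (K * ∫ z, ed G z) := by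
    intro t ht ht1 htL htX
    obtain ⟨hc, hm, e, D⟩ := H t ht htL htX y σ hsub
    have h1 := S.dv hσ D
    have hi : Integrable fun z => ed G z + (-t * (ed G z * F z) + t^2 * K * ed G z) :=
      S.ed_int.add ((hFi.const_mul _).add (S.ed_int.const_mul _))
    have h2 : ∫ z, Diffeo.J (fun z => radE (hc z) (hm z) (z - x0)) z *
        ∑ i, ∑ a, (∑ l, Diffeo.B (fun z => radE (hc z) (hm z) (z - x0)) i l z * G l a z)^2 ≤
        ∫ z, (ed G z + (-t * (ed G z * F z) + t^2 * K * ed G z)) := by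
      refine integral_mono_of_nonneg (ae_of_all _ fun z => ?_) hi (ae_of_all _ fun z => ?_)
      · exact mul_nonneg (abs_nonneg _) (Finset.sum_nonneg fun i _ => Finset.sum_nonneg fun a _ => sq_nonneg _)
      · set c := 1 - t * χ (‖z - x0‖^2) with hcz
        set k := ‖z - x0‖^2 * κ (‖z - x0‖^2) with hk
        have hs : 0 ≤ ‖z - x0‖^2 := by positivity
        have hk0 : 0 ≤ k := mul_nonneg hs (C.kap0 _ hs)
        have hc0 : 0 < c := hc z
        have b1 : Diffeo.J (fun z => radE (hc z) (hm z) (z - x0)) z = c^(m+3) * (1 + 2 * t * k / c) := by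
          have : Diffeo.J (fun z => radE (hc z) (hm z) (z - x0)) z = |(radL c (2 * t * κ (‖z - x0‖^2)) (z - x0)).det| := rfl
          rw [this, radL_det hc0]
          have : 2 * t * κ (‖z - x0‖^2) / c * ‖z - x0‖^2 = 2 * t * k / c := by rw [hk]; ring
          rw [this, abs_of_nonneg (by positivity)]
        have b2 : ∑ i, ∑ a, (∑ l, Diffeo.B (fun z => radE (hc z) (hm z) (z - x0)) i l z * G l a z)^2 ≤ (c⁻¹)^2 * ed G z := by
          rw [Finset.sum_comm]
          unfold ed
          rw [Finset.sum_comm (f := fun i b => (G i b z)^2), Finset.mul_sum]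
          exact Finset.sum_le_sum fun a _ => rad_energy (hc z) (hm z) (z - x0) fun l => G l a z
        have b3 := expand_bound m ht.le ht1 (C.chi0 _ hs) (C.chi1 _ hs) hk0 (C.kap1 _ hs) htX
        rw [← hcz, ← hK] at b3
        simp only
        rw [b1]
        calc c^(m+3) * (1 + 2 * t * k / c) * ∑ i, ∑ a, (∑ l, Diffeo.B (fun z => radE (hc z) (hm z) (z - x0)) i l z * G l a z)^2
            ≤ c^(m+3) * (1 + 2 * t * k / c) * ((c⁻¹)^2 * ed G z) := mul_le_mul_of_nonneg_left b2 (by positivity)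
          _ = (c^m * (c + 2 * t * k)) * ed G z := by field_simp; ring
          _ ≤ (1 - t * ((m+1) * χ (‖z - x0‖^2) - 2 * k) + t^2 * K) * ed G z := mul_le_mul_of_nonneg_right b3 (ed_nonneg G z)
          _ = _ := by simp only [hF]; ring
    have h3 := h1.trans h2
    have hA : Integrable fun z => -t * (ed G z * F z) := hFi.const_mul _
    have hB : Integrable fun z => t^2 * K * ed G z := S.ed_int.const_mul _
    have hAB : Integrable fun z => -t * (ed G z * F z) + t^2 * K * ed G z := hA.add hB
    rw [integral_add S.ed_int hAB, integral_add hA hB,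
      integral_const_mul, integral_const_mul] at h3
    have h4 : t * ∫ z, ed G z * F z ≤ t * (t * (K * ∫ z, ed G z)) := by nlinarith
    exact le_of_mul_le_mul_left h4 ht
  have hlim : Tendsto (fun t : ℝ => t * (K * ∫ z, ed G z)) (𝓝[>] 0) (𝓝 0) := by
    have : Tendsto (fun t : ℝ => t * (K * ∫ z, ed G z)) (𝓝 0) (𝓝 (0 * (K * ∫ z, ed G z))) := tendsto_id.mul_const _
    rw [zero_mul] at this
    exact this.mono_left nhdsWithin_le_nhds
  refine ⟨hFi, ge_of_tendsto hlim ?_⟩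
  have hpos : (0:ℝ) < Min.min 1 (Min.min (1/(2*L)) (1/(2*(X+1)))) := by positivity
  filter_upwards [Ioo_mem_nhdsGT hpos] with t ht
  obtain ⟨h0, h1⟩ := ht
  have a1 := h1.le.trans (min_le_left _ _)
  have a2 := h1.le.trans ((min_le_right _ _).trans (min_le_left _ _))
  have a3 := h1.le.trans ((min_le_right _ _).trans (min_le_right _ _))
  rw [le_div_iff₀ (by positivity)] at a2 a3
  exact key t h0 a1 (by linarith) (by nlinarith)
end

section
open scoped ContDiff Topology Convolution

variable {n p : ℕ}

theorem exists_beta : ∃ (β B : ℝ → ℝ) (M : ℝ), 0 < M ∧ ContDiff ℝ ∞ β ∧ Continuous B ∧ (∀ s, HasDerivAt β (-B s) s) ∧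
    (∀ s, 0 ≤ β s) ∧ (∀ s, β s ≤ 1) ∧ (∀ s, 0 ≤ B s) ∧ (∀ s, B s ≤ M) ∧ (∀ s, s ≤ 1/2 → β s = 1 ∧ B s = 0) ∧
    ∀ s, 3/4 ≤ s → β s = 0 ∧ B s = 0 := by
  set β : ℝ → ℝ := fun s => Real.smoothTransition (3 - 4 * s) with hβ
  have hs : ContDiff ℝ ∞ β := Real.smoothTransition.contDiff.comp (contDiff_const.sub (contDiff_const.mul contDiff_id))
  have h0 : ∀ s, 0 ≤ β s := fun s => Real.smoothTransition.nonneg _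
  have h1 : ∀ s, β s ≤ 1 := fun s => Real.smoothTransition.le_one _
  have hc : Continuous (fun s => - deriv β s) := (hs.continuous_deriv (by simp)).neg
  have ha : ∀ s, s ≤ 1/2 → β s = 1 := fun s h => Real.smoothTransition.one_of_one_le (by linarith)
  have hb : ∀ s, 3/4 ≤ s → β s = 0 := fun s h => Real.smoothTransition.zero_of_nonpos (by linarith)
  have ha' : ∀ s, s ≤ 1/2 → deriv β s = 0 := fun s h => by
    apply IsLocalMax.deriv_eq_zero
    exact Eventually.of_forall fun t => by rw [ha s h]; exact h1 t
  have hb' : ∀ s, 3/4 ≤ s → deriv β s = 0 := fun s h => by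
    apply IsLocalMin.deriv_eq_zero
    exact Eventually.of_forall fun t => by rw [hb s h]; exact h0 t
  have hanti : Antitone β := fun a b hab => Real.smoothTransition.monotone (by linarith)
  obtain ⟨M, hM⟩ := isCompact_Icc.exists_bound_of_continuousOn (s := Icc (0:ℝ) 1) hc.continuousOn
  have hMM : ∀ s, - deriv β s ≤ |M| + 1 := by
    intro s
    by_cases h : s ∈ Icc (0:ℝ) 1
    · have := hM s h
      have h2 := le_abs_self M
      have h3 := Real.le_norm_self (-deriv β s)
      linarith
    · have : deriv β s = 0 := by
        by_cases h2 : s ≤ 1/2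
        · exact ha' s h2
        · apply hb'
          by_contra h3
          exact h ⟨by linarith, by linarith⟩
      rw [this]; simp; positivity
  refine ⟨β, fun s => - deriv β s, |M| + 1, by positivity, hs, hc, fun s => ?_, h0, h1, fun s => ?_, hMM,
    fun s h => ⟨ha s h, by simp [ha' s h]⟩, fun s h => ⟨hb s h, by simp [hb' s h]⟩⟩
  · rw [neg_neg]; exact (hs.differentiable (by simp) s).hasDerivAt
  · have := hanti.deriv_nonpos (x := s)
    linarith

theorem Mini.mono_aux {y : Eu n} {ρ : ℝ} {U : Fin p → Eu n → ℝ} {G : Fin n → Fin p → Eu n → ℝ} (S : Mini y ρ U G)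
    (hn : 3 ≤ n) {β B : ℝ → ℝ} {M : ℝ} (hM : 0 < M) (hβs : ContDiff ℝ ∞ β) (hBc : Continuous B)
    (hβd : ∀ s, HasDerivAt β (-B s) s) (hβ0 : ∀ s, 0 ≤ β s) (hβ1 : ∀ s, β s ≤ 1) (hB0 : ∀ s, 0 ≤ B s) (hBM : ∀ s, B s ≤ M)
    (hin : ∀ s, s ≤ 1/2 → β s = 1 ∧ B s = 0) (hout : ∀ s, 3/4 ≤ s → β s = 0 ∧ B s = 0)
    {R : ℝ} (hR : 0 < R) {x0 : Eu n} (hx : dist x0 y + 7/8*R < ρ) {τ : ℝ} (hτ : 0 < τ) (hτR : τ^2 ≤ R^2/2)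
    {m : ℝ} (hm : m = ((n:ℝ)-2)/2) :
    m * (2*τ^2)^(-m) * ∫ z in ball x0 τ, ed G z ≤ 2 * M * (R^2/2)^(-m) * ∫ z, ed G z := by
  have hn3 : (3:ℝ) ≤ n := by exact_mod_cast hn
  have hm0 : 0 < m := by rw [hm]; linarith
  set δ := τ^2 with hδ
  have hδ0 : 0 < δ := by positivity
  set Q := R^2 with hQ
  have hQ0 : 0 < Q := by positivity
  set χ : ℝ → ℝ := fun s => β (s/Q) * (s + δ)^(-m) with hχ
  set κ : ℝ → ℝ := fun s => B (s/Q) / Q * (s + δ)^(-m) + m * β (s/Q) * (s+δ)^(-m-1) with hκ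
  have hP : ∀ s, 0 ≤ s → (s + δ)^(-m) ≤ δ^(-m) := fun s hs =>
    Real.rpow_le_rpow_of_nonpos hδ0 (by linarith) (by linarith)
  have hsp : ∀ s, 0 ≤ s → (s+δ)^(-m) = (s+δ) * (s+δ)^(-m-1) := fun s hs => by
    have : 0 < s + δ := by linarith
    rw [Real.rpow_sub_one this.ne']; field_simp
  have C : Cut n (7/8*R) ((M+m+1) * δ^(-m)) χ κ := by
    have hpd : 0 ≤ δ^(-m) := by positivity
    refine ⟨?_, ?_, ?_, ?_, ?_, ?_, ?_, ?_⟩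
    · have a1 : ContDiff ℝ ∞ (fun z : Eu n => β (‖z‖^2/Q)) := hβs.comp ((contDiff_norm_sq ℝ).div_const Q)
      have a2 : ContDiff ℝ ∞ (fun z : Eu n => (‖z‖^2 + δ)^(-m)) :=
        ((contDiff_norm_sq ℝ).add contDiff_const).rpow_const_of_ne fun z => by positivity
      exact a1.mul a2
    · have c0 : Continuous (fun z : Eu n => ‖z‖^2) := continuous_norm.pow 2
      have c1 : Continuous (fun z : Eu n => ‖z‖^2 + δ) := c0.add continuous_const
      have c2 : ∀ q : ℝ, Continuous (fun z : Eu n => (‖z‖^2 + δ)^q) := fun q =>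
        c1.rpow_const fun z => Or.inl (by positivity)
      exact (((hBc.comp (c0.div_const Q)).div_const Q).mul (c2 _)).add
        ((continuous_const.mul (hβs.continuous.comp (c0.div_const Q))).mul (c2 _))
    · intro s hs
      have d1 : HasDerivAt (fun s => β (s/Q)) (-B (s/Q) * (1/Q)) s := (hβd (s/Q)).comp s ((hasDerivAt_id s).div_const Q)
      have d2 : HasDerivAt (fun s : ℝ => (s+δ)^(-m)) (1 * (-m) * (s+δ)^(-m-1)) s :=
        ((hasDerivAt_id s).add_const δ).rpow_const (Or.inl (by simp; positivity))
      have := d1.mul d2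
      refine this.congr_deriv ?_
      simp only [hκ]; ring
    · intro s hs
      exact mul_nonneg (hβ0 _) (by positivity)
    · intro s hs
      simp only [hχ]
      have e1 : 0 ≤ (s+δ)^(-m) := by positivity
      calc β (s/Q) * (s+δ)^(-m) ≤ 1 * (s+δ)^(-m) := mul_le_mul_of_nonneg_right (hβ1 _) e1
        _ ≤ δ^(-m) := by rw [one_mul]; exact hP s hs
        _ ≤ _ := by nlinarith
    · intro s hs
      have e1 := hB0 (s/Q)
      have e2 := hβ0 (s/Q)
      simp only [hκ]
      positivity
    · intro s hs
      simp only [hκ]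
      have e1 : 0 ≤ (s+δ)^(-m) := by positivity
      have e2 : s / Q * B (s/Q) ≤ M := by
        by_cases h : 3/4 ≤ s/Q
        · rw [(hout _ h).2, mul_zero]; exact hM.le
        · have : 0 ≤ s/Q := by positivity
          nlinarith [hBM (s/Q), hB0 (s/Q)]
      have e3 : s * (s+δ)^(-m-1) ≤ (s+δ)^(-m) := by
        rw [hsp s hs]
        have : 0 ≤ (s+δ)^(-m-1) := by positivity
        nlinarith
      have e4 : s * (B (s/Q) / Q * (s+δ)^(-m) + m * β (s/Q) * (s+δ)^(-m-1)) =
        (s/Q * B (s/Q)) * (s+δ)^(-m) + m * β (s/Q) * (s * (s+δ)^(-m-1)) := by ring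
      rw [e4]
      have e5 := mul_le_mul_of_nonneg_right e2 e1
      have e6 : m * β (s/Q) ≤ m := by nlinarith [hβ1 (s/Q)]
      have e7 : m * β (s/Q) * (s * (s+δ)^(-m-1)) ≤ m * (s+δ)^(-m) :=
        mul_le_mul e6 e3 (by positivity) hm0.le
      have e8 := hP s hs
      nlinarith [mul_le_mul_of_nonneg_left e8 (by positivity : 0 ≤ M + m)]
    · intro s hs
      have : 3/4 ≤ s/Q := by
        rw [le_div_iff₀ hQ0]
        have : (7/8*R)^2 = 49/64 * Q := by rw [hQ]; ring
        nlinarith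
      simp [hχ, hκ, (hout _ this).1, (hout _ this).2]
  obtain ⟨hFi, hv⟩ := S.first_var hn hx (by positivity) C x0 (closedBall_subset_closedBall' (by rw [add_comm]))
  set F : Eu n → ℝ := fun z => ((n:ℝ) - 2) * χ (‖z - x0‖^2) - 2 * (‖z - x0‖^2 * κ (‖z - x0‖^2)) with hF
  have hFs : ∀ z, (ball x0 τ).indicator (fun _ => m * (2*δ)^(-m)) z - 2 * M * (Q/2)^(-m) ≤ F z := by
    intro z
    set s := ‖z - x0‖^2 with hs
    have hs0 : 0 ≤ s := by positivity
    have e0 : F z = 2 * m * β (s/Q) * δ * (s+δ)^(-m-1) - 2 * (s/Q * B (s/Q) * (s+δ)^(-m)) := by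
      have : (n:ℝ) - 2 = 2 * m := by rw [hm]; ring
      simp only [hF, hχ, hκ, this, ← hs]
      rw [hsp s hs0]; ring
    have e1 : s/Q * B (s/Q) * (s+δ)^(-m) ≤ M * (Q/2)^(-m) := by
      by_cases h1 : s/Q ≤ 1/2
      · rw [(hin _ h1).2]; simp; positivity
      by_cases h2 : 3/4 ≤ s/Q
      · rw [(hout _ h2).2]; simp; positivity
      have h3 : Q/2 ≤ s + δ := by
        push Not at h1
        rw [lt_div_iff₀ hQ0] at h1; linarith
      have h4 : (s+δ)^(-m) ≤ (Q/2)^(-m) := Real.rpow_le_rpow_of_nonpos (by positivity) h3 (by linarith)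
      have h5 : s / Q * B (s/Q) ≤ M := by
        have : 0 ≤ s/Q := by positivity
        nlinarith [hBM (s/Q), hB0 (s/Q)]
      exact mul_le_mul h5 h4 (by positivity) hM.le
    have e2 : 0 ≤ 2 * m * β (s/Q) * δ * (s+δ)^(-m-1) := by
      have := hβ0 (s/Q)
      positivity
    by_cases hz : z ∈ ball x0 τ
    · rw [indicator_of_mem hz]
      have h1 : s ≤ δ := by
        rw [mem_ball, dist_eq_norm] at hz
        exact pow_le_pow_left₀ (norm_nonneg _) hz.le 2
      have h2 : s/Q ≤ 1/2 := by rw [div_le_iff₀ hQ0]; linarith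
      have h3 : (2*δ)^(-m-1) ≤ (s+δ)^(-m-1) :=
        Real.rpow_le_rpow_of_nonpos (by positivity) (by linarith) (by linarith)
      have h4 : (2*δ)^(-m) = 2*δ * (2*δ)^(-m-1) := by
        rw [Real.rpow_sub_one (by positivity)]; field_simp
      rw [e0, (hin _ h2).1, h4]
      have h5 := mul_le_mul_of_nonneg_left h3 (by positivity : 0 ≤ 2 * m * δ)
      nlinarith
    · rw [indicator_of_notMem hz, e0]
      linarith
  have hE := S.ed_int
  have i1 : Integrable fun z => (ball x0 τ).indicator (fun z => m * (2*δ)^(-m) * ed G z) z :=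
    (hE.const_mul _).indicator measurableSet_ball
  have i2 : Integrable fun z => 2 * M * (Q/2)^(-m) * ed G z := hE.const_mul _
  have h1 : ∫ z, ((ball x0 τ).indicator (fun z => m * (2*δ)^(-m) * ed G z) z - 2 * M * (Q/2)^(-m) * ed G z) ≤
      ∫ z, ed G z * F z := by
    refine integral_mono (i1.sub i2) hFi fun z => ?_
    have := mul_le_mul_of_nonneg_left (hFs z) (ed_nonneg G z)
    refine le_trans (le_of_eq ?_) this
    by_cases hz : z ∈ ball x0 τ
    · simp only [indicator_of_mem hz]; ring
    · simp only [indicator_of_notMem hz]; ring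
  rw [integral_sub i1 i2, integral_indicator measurableSet_ball, integral_const_mul, integral_const_mul] at h1
  linarith [h1.trans hv]

theorem Mini.mono (n : ℕ) (hn : 2 ≤ n) : ∃ C : ℝ, 0 < C ∧ ∀ (p : ℕ) (y : Eu n) (ρ : ℝ) (U : Fin p → Eu n → ℝ) (G : Fin n → Fin p → Eu n → ℝ),
    0 < ρ → Mini y ρ U G → ∀ x0 ∈ ball y (ρ/2), ∀ s, 0 < s →
    ∫ z in ball x0 s, ed G z ≤ C * (4*s/ρ)^(n-2) * ∫ z, ed G z := by
  have triv : ∀ {p : ℕ} {y : Eu n} {ρ : ℝ} {U : Fin p → Eu n → ℝ} {G : Fin n → Fin p → Eu n → ℝ}, Mini y ρ U G →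
      ∀ x0 s, ∫ z in ball x0 s, ed G z ≤ ∫ z, ed G z := fun S x0 s =>
    setIntegral_le_integral S.ed_int (ae_of_all _ fun z => ed_nonneg _ z)
  rcases hn.eq_or_lt with rfl | hn3
  · exact ⟨1, one_pos, fun p y ρ U G hρ S x0 hx s hs => by simpa using triv S x0 s⟩
  obtain ⟨β, B, M, hM, h1, h2, h3, h4, h5, h6, h7, h8, h9⟩ := exists_beta
  have hn3' : (3:ℝ) ≤ n := by exact_mod_cast hn3
  set m : ℝ := ((n:ℝ)-2)/2 with hm
  have hm0 : 0 < m := by rw [hm]; linarith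
  refine ⟨2*M/m + 1, by positivity, fun p y ρ U G hρ S x0 hx s hs => ?_⟩
  have hE : 0 ≤ ∫ z, ed G z := integral_nonneg fun z => ed_nonneg _ z
  have ht := triv S x0 s
  have hpos : 0 < (4*s/ρ)^(n-2) := by positivity
  by_cases hc : s^2 ≤ (ρ/2)^2/2
  · rw [mem_ball] at hx
    have key := S.mono_aux hn3 hM h1 h2 h3 h4 h5 h6 h7 h8 h9 (R := ρ/2) (by positivity) (x0 := x0) (by linarith) hs hc hm
    have e : (4*s/ρ)^(n-2) = ((ρ/2)^2/2)^(-m) / (2*s^2)^(-m) := by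
      rw [← Real.div_rpow (by positivity) (by positivity), Real.rpow_neg (by positivity), ← Real.inv_rpow (by positivity)]
      have : ((ρ/2)^2/2/(2*s^2))⁻¹ = (4*s/ρ)^(2:ℝ) := by
        rw [Real.rpow_two]; field_simp; ring
      rw [this, ← Real.rpow_mul (by positivity), ← Real.rpow_natCast]
      congr 1
      rw [Nat.cast_sub hn, hm]; push_cast; ring
    have hq : 0 < (2*s^2)^(-m) := by positivity
    have hq2 : 0 < ((ρ/2)^2/2)^(-m) := by positivity
    have : ∫ z in ball x0 s, ed G z ≤ 2*M/m * (4*s/ρ)^(n-2) * ∫ z, ed G z := by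
      rw [e]
      have e3 : 2*M/m * (((ρ/2)^2/2)^(-m) / (2*s^2)^(-m)) * ∫ z, ed G z =
        (2 * M * ((ρ/2)^2/2)^(-m) * ∫ z, ed G z) / (m * (2*s^2)^(-m)) := by
        field_simp
      rw [e3, le_div_iff₀ (by positivity)]
      linarith
    nlinarith [mul_nonneg hpos.le hE]
  · have : 1 ≤ (4*s/ρ)^(n-2) := by
      apply one_le_pow₀
      rw [le_div_iff₀ hρ]
      nlinarith
    have h10 : 1 ≤ (2*M/m + 1) * (4*s/ρ)^(n-2) := by
      have : 0 < 2*M/m := by positivity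
      nlinarith
    nlinarith
end

section
open scoped ContDiff Topology Convolution

variable {n p : ℕ}

theorem exists_cut (y : Eu n) {σ ρ : ℝ} (hρ : 0 < ρ) (hσ : σ < ρ) :
    ∃ η : Eu n → ℝ, Test (ball y ρ) η ∧ ∀ x ∈ closedBall y σ, η =ᶠ[𝓝 x] fun _ => 1 := by
  set a := max (ρ/3) ((2*σ+ρ)/3) with ha
  set b := max (2*ρ/3) ((σ+2*ρ)/3) with hb
  have h1 : 0 < a := lt_max_of_lt_left (by positivity)
  have h2 : a < b := max_lt (lt_max_of_lt_left (by linarith)) (lt_max_of_lt_right (by linarith))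
  have h3 : b < ρ := max_lt (by linarith) (by linarith)
  have h4 : σ < a := lt_max_of_lt_right (by linarith)
  let f : ContDiffBump y := ⟨a, b, h1, h2⟩
  refine ⟨f, ⟨f.contDiff, f.hasCompactSupport, ?_⟩, fun x hx => ?_⟩
  · rw [f.tsupport_eq]; exact closedBall_subset_ball h3
  · exact f.eventuallyEq_one_of_mem_ball (lt_of_le_of_lt hx h4)

/-- truncated components -/
def tU (u : Eu n → Eu p) (y : Eu n) (ρ : ℝ) (a : Fin p) : Eu n → ℝ := (ball y ρ).indicator fun x => u x a
def tG (g : Eu n → (Eu n →L[ℝ] Eu p)) (y : Eu n) (ρ : ℝ) (i : Fin n) (a : Fin p) : Eu n → ℝ :=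
  (ball y ρ).indicator fun x => g x (EuclideanSpace.single i 1) a

def addW (u : Eu n → Eu p) (D : Fin p → Eu n → ℝ) (x : Eu n) : Eu p := u x + ∑ a, D a x • EuclideanSpace.single a (1:ℝ)
def addH (g : Eu n → (Eu n →L[ℝ] Eu p)) (K : Fin n → Fin p → Eu n → ℝ) (x : Eu n) : Eu n →L[ℝ] Eu p :=
  g x + ∑ i, ∑ a, K i a x • (EuclideanSpace.proj i : Eu n →L[ℝ] ℝ).smulRight (EuclideanSpace.single a (1:ℝ) : Eu p)

theorem addW_apply (u : Eu n → Eu p) (D : Fin p → Eu n → ℝ) (x : Eu n) (b : Fin p) : addW u D x b = u x b + D b x := by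
  unfold addW
  simp [Pi.single_apply]

theorem addH_apply (g : Eu n → (Eu n →L[ℝ] Eu p)) (K : Fin n → Fin p → Eu n → ℝ) (x : Eu n) (j : Fin n) (b : Fin p) :
    addH g K x (EuclideanSpace.single j 1) b = g x (EuclideanSpace.single j 1) b + K j b x := by
  unfold addH
  simp [Pi.single_apply, sum_apply]

theorem ed_tG (g : Eu n → (Eu n →L[ℝ] Eu p)) (y : Eu n) (ρ : ℝ) : ed (tG g y ρ) = (ball y ρ).indicator (energyDensity n p g) := by
  funext x
  unfold ed tG energyDensity
  by_cases h : x ∈ ball y ρ <;> simp [h]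

theorem integrable_supp {f : Eu n → ℝ} {y : Eu n} {ρ : ℝ} (hf : MemLp f 2) (h0 : ∀ x ∉ ball y ρ, f x = 0) : Integrable f := by
  have : IsFiniteMeasure (volume.restrict (ball y ρ)) := isFiniteMeasure_restrict.2 measure_ball_lt_top.ne
  have h1 : IntegrableOn f (ball y ρ) := (hf.restrict (ball y ρ)).integrable one_le_two
  rwa [integrableOn_iff_integrable_of_support_subset] at h1
  intro x hx
  by_contra h
  exact hx (h0 x h)

theorem loc_clm {E F : Type*} [NormedAddCommGroup E] [NormedSpace ℝ E] [NormedAddCommGroup F] [NormedSpace ℝ F] {Ω : Set (Eu n)}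
    {f : Eu n → E} (L : E →L[ℝ] F) (hf : LocallyIntegrableOn f Ω) : LocallyIntegrableOn (fun x => L (f x)) Ω := by
  intro x hx
  obtain ⟨s, hs, hi⟩ := hf x hx
  exact ⟨s, hs, L.integrable_comp hi⟩

theorem loc_comp {Ω : Set (Eu n)} {g : Eu n → (Eu n →L[ℝ] Eu p)} (hg : LocallyIntegrableOn g Ω) (i : Fin n) (a : Fin p) :
    LocallyIntegrableOn (fun x => g x (EuclideanSpace.single i 1) a) Ω :=
  loc_clm (EuclideanSpace.proj a : Eu p →L[ℝ] ℝ)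
    (loc_clm (ContinuousLinearMap.apply ℝ (Eu p) (EuclideanSpace.single i (1:ℝ) : Eu n)) hg)

theorem Test.int_loc {Ω : Set (Eu n)} {ψ f : Eu n → ℝ} (h : Test Ω ψ) (hf : LocallyIntegrableOn f Ω) :
    Integrable fun x => ψ x * f x := by
  have h1 : IntegrableOn f (tsupport ψ) := hf.integrableOn_compact_subset h.sub h.cpt
  obtain ⟨M, -, hM⟩ := h.bdd
  have h2 : IntegrableOn (fun x => ψ x * f x) (tsupport ψ) :=
    Integrable.bdd_mul (c := M) h1 h.continuous.aestronglyMeasurable (ae_of_all _ hM)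
  rwa [integrableOn_iff_integrable_of_support_subset] at h2
  intro x hx
  by_contra hc
  exact hx (by simp only; rw [image_eq_zero_of_notMem_tsupport hc, zero_mul])

theorem addW_loc {Ω : Set (Eu n)} {u : Eu n → Eu p} {D : Fin p → Eu n → ℝ} (hu : LocallyIntegrableOn u Ω)
    (hD : ∀ a, Integrable (D a)) : LocallyIntegrableOn (addW u D) Ω := by
  have : Integrable fun x => ∑ a, D a x • (EuclideanSpace.single a (1:ℝ) : Eu p) :=
    integrable_finsetSum Finset.univ fun a _ => (hD a).smul_const _
  exact hu.add (this.locallyIntegrable.locallyIntegrableOn Ω)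

theorem sum_int {E : Type*} [NormedAddCommGroup E] [NormedSpace ℝ E] (e : Fin n → Fin p → E) {K : Fin n → Fin p → Eu n → ℝ}
    (hK : ∀ i a, Integrable (K i a)) : Integrable fun x => ∑ i, ∑ a, K i a x • e i a :=
  integrable_finsetSum Finset.univ fun i _ => integrable_finsetSum Finset.univ fun a _ => (hK i a).smul_const _

theorem addH_loc {Ω : Set (Eu n)} {g : Eu n → (Eu n →L[ℝ] Eu p)} {K : Fin n → Fin p → Eu n → ℝ} (hg : LocallyIntegrableOn g Ω)
    (hK : ∀ i a, Integrable (K i a)) : LocallyIntegrableOn (addH g K) Ω := by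
  have h := (sum_int (fun i a => (EuclideanSpace.proj i : Eu n →L[ℝ] ℝ).smulRight (EuclideanSpace.single a (1:ℝ) : Eu p)) hK).locallyIntegrable.locallyIntegrableOn Ω
  have h2 := LocallyIntegrableOn.add hg h
  exact h2

set_option maxHeartbeats 1000000 in
theorem ofMin (hn : 0 < n) {Ω : Set (Eu n)} (hΩ : IsOpen Ω) {u : Eu n → Eu p} {g : Eu n → (Eu n →L[ℝ] Eu p)}
    (hu : IsEnergyMinimizingToSphere n p Ω u g) {y : Eu n} {ρ : ℝ} (hρ : 0 < ρ) (hsub : closedBall y ρ ⊆ Ω) :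
    Mini y ρ (tU u y ρ) (tG g y ρ) := by
  obtain ⟨⟨hu1, hg1, hw⟩, he, hs, hmin⟩ := hu
  have hbΩ : ball y ρ ⊆ Ω := ball_subset_closedBall.trans hsub
  have : IsFiniteMeasure (volume.restrict (ball y ρ)) := isFiniteMeasure_restrict.2 measure_ball_lt_top.ne
  have huI : IntegrableOn u (ball y ρ) :=
    (hu1.integrableOn_compact_subset hsub (isCompact_closedBall y ρ)).mono_set ball_subset_closedBall
  have hgI : IntegrableOn g (ball y ρ) :=
    (hg1.integrableOn_compact_subset hsub (isCompact_closedBall y ρ)).mono_set ball_subset_closedBall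
  have heI : IntegrableOn (energyDensity n p g) (ball y ρ) :=
    (he.integrableOn_compact_subset hsub (isCompact_closedBall y ρ)).mono_set ball_subset_closedBall
  have hs' : ∀ᵐ x, x ∈ Ω → ‖u x‖ = 1 := (ae_restrict_iff' hΩ.measurableSet).1 hs
  have hub : ∀ᵐ x ∂(volume.restrict (ball y ρ)), ∀ a, |u x a| ≤ 1 := by
    rw [ae_restrict_iff' measurableSet_ball]
    filter_upwards [hs'] with x hx hb a
    rw [← hx (hbΩ hb)]; exact PiLp.norm_apply_le (u x) a
  have hmU : ∀ a, MemLp (tU u y ρ a) 2 := by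
    intro a
    unfold tU
    rw [memLp_indicator_iff_restrict measurableSet_ball]
    refine MemLp.of_bound ?_ 1 (hub.mono fun x hx => hx a)
    exact (EuclideanSpace.proj a : Eu p →L[ℝ] ℝ).continuous.comp_aestronglyMeasurable huI.1
  have hmG : ∀ i a, MemLp (tG g y ρ i a) 2 := by
    intro i a
    unfold tG
    rw [memLp_indicator_iff_restrict measurableSet_ball]
    have hm : AEStronglyMeasurable (fun x => g x (EuclideanSpace.single i 1) a) (volume.restrict (ball y ρ)) :=
      ((EuclideanSpace.proj a : Eu p →L[ℝ] ℝ).continuous.comp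
        (ContinuousLinearMap.apply ℝ (Eu p) (EuclideanSpace.single i (1:ℝ) : Eu n)).continuous).comp_aestronglyMeasurable hgI.1
    rw [memLp_two_iff_integrable_sq hm]
    refine Integrable.mono' heI (hm.pow 2) (ae_of_all _ fun x => ?_)
    rw [Real.norm_eq_abs, abs_of_nonneg (sq_nonneg _)]
    unfold energyDensity
    have h1 := Finset.single_le_sum (f := fun j => (g x (EuclideanSpace.single i 1) j)^2) (fun j _ => sq_nonneg _) (Finset.mem_univ a)
    have h2 := Finset.single_le_sum (f := fun i => ∑ j, (g x (EuclideanSpace.single i 1) j)^2)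
      (fun i _ => Finset.sum_nonneg fun j _ => sq_nonneg _) (Finset.mem_univ i)
    exact h1.trans h2
  have hwd : ∀ i a, WD (ball y ρ) i (tU u y ρ a) (tG g y ρ i a) := by
    intro i a ψ hψ
    have h := hw ψ hψ.smooth hψ.cpt (hψ.sub.trans hbΩ) i a
    have z1 : ∀ x ∉ ball y ρ, ψ x = 0 := fun x hx => image_eq_zero_of_notMem_tsupport fun h => hx (hψ.sub h)
    have z2 : ∀ x ∉ ball y ρ, pd i ψ x = 0 := fun x hx => by
      unfold pd
      rw [image_eq_zero_of_notMem_tsupport fun h => hx (hψ.sub (tsupport_fderiv_subset ℝ h))]; rfl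
    have e1 : ∫ x, tU u y ρ a x * pd i ψ x = ∫ x in Ω, u x a * fderiv ℝ ψ x (EuclideanSpace.single i 1) := by
      rw [setIntegral_eq_integral_of_forall_compl_eq_zero]
      · congr 1; funext x
        by_cases hx : x ∈ ball y ρ
        · simp [tU, hx, pd]
        · have := z2 x hx
          unfold pd at this ⊢
          rw [this]; simp
      · intro x hx
        have := z2 x fun h => hx (hbΩ h)
        unfold pd at this
        rw [this, mul_zero]
    have e2 : ∫ x, ψ x * tG g y ρ i a x = ∫ x in Ω, ψ x * g x (EuclideanSpace.single i 1) a := by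
      rw [setIntegral_eq_integral_of_forall_compl_eq_zero]
      · congr 1; funext x
        by_cases hx : x ∈ ball y ρ
        · simp [tG, hx]
        · rw [z1 x hx]; simp
      · intro x hx
        rw [z1 x fun h => hx (hbΩ h), zero_mul]
    rw [e1, e2, h]
  have hsph : ∀ᵐ x, x ∈ ball y ρ → ∑ a, (tU u y ρ a x)^2 = 1 := by
    filter_upwards [hs'] with x hx hb
    have := EuclideanSpace.real_norm_sq_eq (u x)
    rw [hx (hbΩ hb)] at this
    simp only [tU, indicator_of_mem hb]
    linarith
  refine ⟨hn, hmU, hmG, hwd, ?_, hsph, ?_⟩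
  · filter_upwards [(ae_restrict_iff' measurableSet_ball).1 hub] with x hx a
    unfold tU
    by_cases hb : x ∈ ball y ρ
    · simpa [hb] using hx hb a
    · simp [hb]
  intro W H σ hσ hW hH hWH hWs heq
  have hnb : ∀ x ∉ ball y ρ, x ∉ closedBall y σ := fun x hx h => hx (closedBall_subset_ball hσ h)
  set D : Fin p → Eu n → ℝ := fun a x => W a x - tU u y ρ a x with hD
  set K : Fin n → Fin p → Eu n → ℝ := fun i a x => H i a x - tG g y ρ i a x with hK
  have hD0 : ∀ x ∉ closedBall y σ, ∀ a, D a x = 0 := fun x hx a => by simp only [hD]; rw [(heq x hx).1 a, sub_self]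
  have hK0 : ∀ x ∉ closedBall y σ, ∀ i a, K i a x = 0 := fun x hx i a => by simp only [hK]; rw [(heq x hx).2 i a, sub_self]
  have hDm : ∀ a, MemLp (D a) 2 := fun a => (hW a).sub (hmU a)
  have hKm : ∀ i a, MemLp (K i a) 2 := fun i a => (hH i a).sub (hmG i a)
  have hDi : ∀ a, Integrable (D a) := fun a => integrable_supp (hDm a) fun x hx => hD0 x (hnb x hx) a
  have hKi : ∀ i a, Integrable (K i a) := fun i a => integrable_supp (hKm i a) fun x hx => hK0 x (hnb x hx) i a
  have hwin : ∀ x ∈ ball y ρ, ∀ a, addW u D x a = W a x := fun x hx a => by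
    rw [addW_apply]; simp [hD, tU, hx]
  have hhin : ∀ x ∈ ball y ρ, ∀ i a, addH g K x (EuclideanSpace.single i 1) a = H i a x := fun x hx i a => by
    rw [addH_apply]; simp [hK, tG, hx]
  have hwout : ∀ x ∉ closedBall y σ, addW u D x = u x := fun x hx => by
    ext a; rw [addW_apply, hD0 x hx a, add_zero]
  have hed : energyDensity n p (addH g K) = fun x => energyDensity n p g x + (ed H x - ed (tG g y ρ) x) := by
    funext x
    by_cases hx : x ∈ ball y ρ
    · rw [ed_tG, indicator_of_mem hx]
      simp only [energyDensity, ed, hhin x hx]; ring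
    · have : ed H x = ed (tG g y ρ) x := by
        unfold ed; simp only [(heq x (hnb x hx)).2]
      rw [this]
      simp only [energyDensity, addH_apply, hK0 x (hnb x hx)]; simp
  have hedH : ed H = (ball y ρ).indicator (energyDensity n p (addH g K)) := by
    funext x
    by_cases hx : x ∈ ball y ρ
    · rw [indicator_of_mem hx]
      simp only [energyDensity, ed, hhin x hx]
    · rw [indicator_of_notMem hx]
      have : ed H x = ed (tG g y ρ) x := by
        unfold ed; simp only [(heq x (hnb x hx)).2]
      rw [this, ed_tG, indicator_of_notMem hx]
  have hedI : ∀ {F : Fin n → Fin p → Eu n → ℝ}, (∀ i a, MemLp (F i a) 2) → Integrable (ed F) := fun hF =>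
    integrable_finsetSum Finset.univ fun i _ => integrable_finsetSum Finset.univ fun a _ => (hF i a).integrable_sq
  have hwg : HasWeakGradient n p Ω (addW u D) (addH g K) := by
    refine ⟨?_, ?_, ?_⟩
    · exact addW_loc hu1 hDi
    · exact addH_loc hg1 hKi
    · intro φ hφ hφc hφs i a
      obtain ⟨η, hη, hη1⟩ := exists_cut y hρ hσ
      have hT := hη.mul hφ
      have hφT : Test Ω φ := ⟨hφ, hφc, hφs⟩
      have a1 := hWH i a _ hT
      have a2 := hwd i a _ hT
      have j1 : ∀ {F : Eu n → ℝ}, MemLp F 2 → Integrable fun x => F x * pd i (fun x => η x * φ x) x := fun hF =>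
        ((hT.pd i).int_mul hF).congr (ae_of_all _ fun x => mul_comm _ _)
      have a3 : ∫ x, D a x * pd i (fun x => η x * φ x) x = - ∫ x, η x * φ x * K i a x := by
        simp only [hD, hK, sub_mul, mul_sub]
        rw [integral_sub (j1 (hW a)) (j1 (hmU a)), integral_sub (hT.int_mul (hH i a)) (hT.int_mul (hmG i a)), a1, a2]
        ring
      have a4 : ∀ x, D a x * pd i (fun x => η x * φ x) x = D a x * pd i φ x := by
        intro x
        by_cases hx : x ∈ closedBall y σ
        · congr 1
          apply pd_congr
          filter_upwards [hη1 x hx] with z hz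
          rw [hz, one_mul]
        · rw [hD0 x hx, zero_mul, zero_mul]
      have a5 : ∀ x, η x * φ x * K i a x = φ x * K i a x := by
        intro x
        by_cases hx : x ∈ closedBall y σ
        · rw [(hη1 x hx).self_of_nhds, one_mul]
        · rw [hK0 x hx, mul_zero, mul_zero]
      simp only [a4, a5] at a3
      have b1 : ∫ x, D a x * pd i φ x = ∫ x in Ω, D a x * pd i φ x := by
        rw [setIntegral_eq_integral_of_forall_compl_eq_zero]
        intro x hx
        rw [hD0 x (hnb x fun h => hx (hbΩ h)), zero_mul]
      have b2 : ∫ x, φ x * K i a x = ∫ x in Ω, φ x * K i a x := by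
        rw [setIntegral_eq_integral_of_forall_compl_eq_zero]
        intro x hx
        rw [hK0 x (hnb x fun h => hx (hbΩ h)), mul_zero]
      rw [b1, b2] at a3
      have c1 : IntegrableOn (fun x => D a x * pd i φ x) Ω :=
        (((hφT.pd i).int_mul (hDm a)).congr (ae_of_all _ fun x => mul_comm _ _)).integrableOn
      have c2 : IntegrableOn (fun x => φ x * K i a x) Ω := (hφT.int_mul (hKm i a)).integrableOn
      have c3 : IntegrableOn (fun x => u x a * pd i φ x) Ω :=
        (((hφT.pd i).int_loc (loc_clm (EuclideanSpace.proj a : Eu p →L[ℝ] ℝ) hu1)).congr (ae_of_all _ fun x => mul_comm _ _)).integrableOn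
      have c4 : IntegrableOn (fun x => φ x * g x (EuclideanSpace.single i 1) a) Ω :=
        (hφT.int_loc (loc_comp hg1 i a)).integrableOn
      have h0 := hw φ hφ hφc hφs i a
      have d1 : ∫ x in Ω, addW u D x a * pd i φ x = (∫ x in Ω, u x a * pd i φ x) + ∫ x in Ω, D a x * pd i φ x := by
        rw [← integral_add c3 c1]; simp only [addW_apply, add_mul]
      have d2 : ∫ x in Ω, φ x * addH g K x (EuclideanSpace.single i 1) a =
          (∫ x in Ω, φ x * g x (EuclideanSpace.single i 1) a) + ∫ x in Ω, φ x * K i a x := by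
        rw [← integral_add c4 c2]; simp only [addH_apply, mul_add]
      have d3 : ∫ x in Ω, u x a * pd i φ x = - ∫ x in Ω, φ x * g x (EuclideanSpace.single i 1) a := h0
      show ∫ x in Ω, addW u D x a * pd i φ x = _
      rw [d1, d2, d3, a3]; ring
  have hfin := hmin y ρ hρ hsub (addW u D) (addH g K) hwg ?_ ?_ ?_
  · rw [ed_tG, hedH, integral_indicator measurableSet_ball, integral_indicator measurableSet_ball]
    exact hfin
  · rw [hed]
    exact he.add (((hedI hH).sub (hedI hmG)).locallyIntegrable.locallyIntegrableOn Ω)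
  · rw [ae_restrict_iff' hΩ.measurableSet]
    filter_upwards [hs', hWs] with x h1 h2 hx
    by_cases hb : x ∈ ball y ρ
    · have := EuclideanSpace.real_norm_sq_eq (addW u D x)
      simp only [hwin x hb, h2 hb] at this
      nlinarith [norm_nonneg (addW u D x)]
    · rw [hwout x (hnb x hb)]; exact h1 hx
  · refine ⟨(σ+ρ)/2, by linarith, ?_⟩
    rw [ae_restrict_iff' (hΩ.measurableSet.diff measurableSet_ball)]
    refine ae_of_all _ fun x hx => hwout x fun h => hx.2 ?_
    rw [mem_closedBall] at h
    rw [mem_ball]; linarith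

theorem eps_reg (n p : ℕ) (hn : 2 ≤ n) :
    ∃ ε : ℝ, 0 < ε ∧
      ∀ (Ω : Set (Eu n)), IsOpen Ω →
        ∀ (u : Eu n → Eu p)
          (g : Eu n → (Eu n →L[ℝ] Eu p)),
          IsEnergyMinimizingToSphere n p Ω u g →
          ∀ (y : Eu n) (ρ : ℝ), 0 < ρ → closedBall y ρ ⊆ Ω →
            ρ ^ ((2 : ℝ) - n) * (∫ x in ball y ρ, energyDensity n p g x) < ε →
            y ∈ regSet n p Ω u := by
  obtain ⟨e0, he0, hreg⟩ := sys_reg n p hn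
  obtain ⟨C, hC, hmono⟩ := Mini.mono n hn
  refine ⟨e0 / (C * 4^(n-2)), by positivity, fun Ω hΩ u g hu y ρ hρ hsub hE => ?_⟩
  have S := ofMin (by omega) hΩ hu hρ hsub
  have hI : ∫ z, ed (tG g y ρ) z = ∫ x in ball y ρ, energyDensity n p g x := by
    rw [ed_tG, integral_indicator measurableSet_ball]
  rw [← hI] at hE
  have hpw : ρ^((2:ℝ)-n) = (ρ^(n-2))⁻¹ := by
    rw [← Real.rpow_natCast, ← Real.rpow_neg hρ.le, Nat.cast_sub hn]
    congr 1; push_cast; ring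
  rw [hpw] at hE
  obtain ⟨R, hR, hRρ, v, hv, hae⟩ := hreg y ρ _ _ hρ S.toSys fun x hx s hs _ => by
    refine (hmono p y ρ _ _ hρ S x hx s hs).trans ?_
    have : C * (4*s/ρ)^(n-2) * ∫ z, ed (tG g y ρ) z = (C * 4^(n-2)) * ((ρ^(n-2))⁻¹ * ∫ z, ed (tG g y ρ) z) * s^(n-2) := by
      rw [div_pow, mul_pow]; field_simp
    rw [this]
    refine mul_le_mul_of_nonneg_right ?_ (by positivity)
    rw [lt_div_iff₀ (by positivity)] at hE
    linarith
  have hb : ball y R ⊆ ball y ρ := ball_subset_ball hRρ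
  refine ⟨hsub (mem_closedBall_self hρ.le), ball y R, isOpen_ball, mem_ball_self hR,
    hb.trans (ball_subset_closedBall.trans hsub), fun x => WithLp.toLp 2 fun a => v a x, ?_, ?_⟩
  · rw [contDiffOn_euclidean]
    exact hv
  · rw [ae_restrict_iff' measurableSet_ball]
    filter_upwards [hae] with x hx hxb
    ext a
    have := hx hxb a
    simpa [tU, hb hxb] using this
end

/-- The ε-regularity theorem (Corollary 1 in Section 2.3 of the paper) for energy
minimizing maps into the unit sphere: there is `ε > 0` depending only on `n` and `p`
such that whenever `B̄_ρ(y) ⊆ Ω` and the scaled energy `ρ^(2-n) ∫_{B_ρ(y)} |Du|²` is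
less than `ε`, the point `y` is a regular point of `u`. -/
theorem epsilon_regularity
    (n p : ℕ) (hn : 2 ≤ n) (hp : 2 ≤ p) :
    ∃ ε : ℝ, 0 < ε ∧
      ∀ (Ω : Set (EuclideanSpace ℝ (Fin n))), IsOpen Ω →
        ∀ (u : EuclideanSpace ℝ (Fin n) → EuclideanSpace ℝ (Fin p))
          (g : EuclideanSpace ℝ (Fin n) →
            (EuclideanSpace ℝ (Fin n) →L[ℝ] EuclideanSpace ℝ (Fin p))),
          IsEnergyMinimizingToSphere n p Ω u g →
          ∀ (y : EuclideanSpace ℝ (Fin n)) (ρ : ℝ), 0 < ρ → closedBall y ρ ⊆ Ω →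
            ρ ^ ((2 : ℝ) - n) * (∫ x in ball y ρ, energyDensity n p g x) < ε →
            y ∈ regSet n p Ω u := by
  exact eps_reg n p hn
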